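/- Let F_1 ∈ Diff^∞(ℝ/ℤ) have exactly two fixed points, a repelling fixed point at 1/2 and an attracting fixed point at 0, with F_1 affine (in the lift coordinate) on the arc (1/10, 9/10) and on the complement of the arc (1/100, 99/100); let F_2 ∈ Diff^∞(ℝ/ℤ) be the identity outside the arc (1/4, 3/4) and satisfy F_2(x) = x + 1/100 for x ∈ (2/5, 3/5); and let F_3 be a rotation by an irrational number. Then there exist sequences ε_n > 0 and k_n > 0 such that: for every sequence h_n ∈ Diff^∞(ℝ/ℤ) with ‖h_n − id‖_{C^n} < ε_n for every n, there exist F_4, F_5 ∈ Diff^∞(ℝ/ℤ) such that S = {F_1, F_2, F_3, F_4, F_5} generates a group G containing every h_n with d_S(h_n, id) ≤ k_n for every n. -/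

import Mathlib

open Filter Topology Set

noncomputable section

/-- The circle ℝ/ℤ. -/
abbrev S1 := AddCircle (1 : ℝ)

/-- `F : ℝ → ℝ` is a lift of the circle map `f`: it is C^∞, commutes with the unit
translation, has everywhere positive derivative, and descends to `f` on ℝ/ℤ. -/
def IsLift (f : Equiv.Perm S1) (F : ℝ → ℝ) : Prop :=
  ContDiff ℝ (⊤ : ℕ∞) F ∧ (∀ x, F (x + 1) = F x + 1) ∧ (∀ x, 0 < deriv F x) ∧
    ∀ x : ℝ, f (x : S1) = ((F x : ℝ) : S1)

/-- `f` is an orientation preserving C^∞ diffeomorphism of ℝ/ℤ. -/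
def HasLift (f : Equiv.Perm S1) : Prop := ∃ F, IsLift f F

/-- max over 0 ≤ j ≤ k of sup over x of |F^(j)(x) - G^(j)(x)|. -/
noncomputable def liftDist (k : ℕ) (F G : ℝ → ℝ) : ℝ :=
  ⨆ j : Fin (k + 1), ⨆ x : ℝ, |iteratedDeriv (j : ℕ) F x - iteratedDeriv (j : ℕ) G x|

/-- The C^k distance between two smooth circle diffeomorphisms: infimum over lifts. -/
noncomputable def distC (k : ℕ) (f g : Equiv.Perm S1) : ℝ :=
  sInf {d | ∃ F G, IsLift f F ∧ IsLift g G ∧ d = liftDist k F G}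

/-- `f` is recurrent: for every k and ε > 0 there are arbitrarily large n ≥ 1 with
‖f^n − id‖_{C^k} < ε. -/
def Recurrent (f : Equiv.Perm S1) : Prop :=
  ∀ k : ℕ, ∀ ε : ℝ, 0 < ε → ∀ N : ℕ, ∃ n : ℕ, N ≤ n ∧ 1 ≤ n ∧ distC k (f ^ n) 1 < ε

/-- The word length of `g` with respect to the generating set `S`: the least `k` such that
`g` is a product of `k` elements of `S ∪ S⁻¹`. -/
noncomputable def wordLength (S : Set (Equiv.Perm S1)) (g : Equiv.Perm S1) : ℕ :=
  sInf {k | ∃ l : List (Equiv.Perm S1),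
    l.length = k ∧ (∀ x ∈ l, x ∈ S ∨ x⁻¹ ∈ S) ∧ l.prod = g}

/-- The rotation by `t` on ℝ/ℤ, `x ↦ x + t`. -/
def rot (t : S1) : Equiv.Perm S1 := Equiv.addRight t

/-- `f` is a distortion element of Diff^∞(ℝ/ℤ). -/
def IsDistortion (f : Equiv.Perm S1) : Prop :=
  ∃ S : Finset (Equiv.Perm S1), (∀ g ∈ S, HasLift g) ∧
    f ∈ Subgroup.closure (S : Set (Equiv.Perm S1)) ∧
    Tendsto (fun n : ℕ => (wordLength (S : Set (Equiv.Perm S1)) (f ^ n) : ℝ) / n)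
      atTop (nhds 0)

/-- The open arc in ℝ/ℤ which is the image of the interval `(a,b)`. -/
def arcOO (a b : ℝ) : Set S1 := (fun x : ℝ => (x : S1)) '' Set.Ioo a b

/-- The closed arc in ℝ/ℤ which is the image of the interval `[a,b]`. -/
def arcCC (a b : ℝ) : Set S1 := (fun x : ℝ => (x : S1)) '' Set.Icc a b

/-- `f` is supported on `U`: it is the identity outside `U`. -/
def SupportedOn (f : Equiv.Perm S1) (U : Set S1) : Prop := ∀ x : S1, x ∉ U → f x = x

/-- `f` has rotation number `t ∈ ℝ/ℤ`. -/
def HasRotNum (f : Equiv.Perm S1) (t : S1) : Prop :=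
  ∃ F : ℝ → ℝ, ∃ τ : ℝ, IsLift f F ∧ ((τ : ℝ) : S1) = t ∧
    Tendsto (fun n : ℕ => F^[n] 0 / n) atTop (nhds τ)

/-- A real number is Diophantine. -/
def DiophantineReal (t : ℝ) : Prop :=
  ∃ C : ℝ, 0 < C ∧ ∃ n : ℕ, 0 < n ∧ ∀ p q : ℤ, q ≠ 0 →
    C / |(q : ℝ)| ^ n < |(q : ℝ) * t - (p : ℝ)|

/-- An element of ℝ/ℤ is Diophantine if some (equivalently, every) lift is. -/
def Diophantine (t : S1) : Prop := ∃ τ : ℝ, (τ : S1) = t ∧ DiophantineReal τ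


/-- The hypotheses on `F₁`: a smooth circle diffeomorphism whose only fixed points are a
repelling one at 1/2 and an attracting one at 0, affine (in the lift coordinate) on the
arc (1/10, 9/10) and on the complement of the arc (1/100, 99/100). -/
def F1Hyp (F₁ : Equiv.Perm S1) : Prop :=
  (∀ x : S1, F₁ x = x ↔ (x = ((0 : ℝ) : S1) ∨ x = ((1/2 : ℝ) : S1))) ∧
  ∃ L : ℝ → ℝ, IsLift F₁ L ∧ 1 < deriv L (1/2) ∧ deriv L 0 < 1 ∧
    (∃ a b : ℝ, ∀ x ∈ Set.Ioo (1/10 : ℝ) (9/10), L x = a * x + b) ∧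
    (∃ a b : ℝ, ∀ x ∈ Set.Icc (-1/100 : ℝ) (1/100), L x = a * x + b)

/-- The hypotheses on `F₂`: a smooth circle diffeomorphism which is the identity outside
the arc (1/4, 3/4) and translates by 1/100 on the arc (2/5, 3/5). -/
def F2Hyp (F₂ : Equiv.Perm S1) : Prop :=
  HasLift F₂ ∧ SupportedOn F₂ (arcOO (1/4) (3/4)) ∧
    ∀ x ∈ Set.Ioo (2/5 : ℝ) (3/5), F₂ ((x : ℝ) : S1) = ((x + 1/100 : ℝ) : S1)

/-- The hypothesis on `F₃`: it is a rotation by an irrational number. -/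
def F3Hyp (F₃ : Equiv.Perm S1) : Prop :=
  ∃ α : ℝ, Irrational α ∧ F₃ = rot ((α : ℝ) : S1)


abbrev Sm (u : ℝ → ℝ) : Prop := ContDiff ℝ (⊤ : ℕ∞) u

lemma Sm.d {u : ℝ → ℝ} (h : Sm u) : Differentiable ℝ u := h.differentiable (by simp)

lemma Sm.deriv {u : ℝ → ℝ} (h : Sm u) : Sm (deriv u) :=
  (contDiff_infty_iff_deriv.1 h).2

lemma Sm.at {u : ℝ → ℝ} (h : Sm u) (n : ℕ) (x : ℝ) : ContDiffAt ℝ n u x :=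
  (h.of_le (by exact_mod_cast le_top)).contDiffAt

lemma Sm.iter {u : ℝ → ℝ} (h : Sm u) (n : ℕ) : Sm (iteratedDeriv n u) := by
  induction n with
  | zero => simpa using h
  | succ n ih => rw [iteratedDeriv_succ]; exact ih.deriv

lemma Sm.hd {u : ℝ → ℝ} (h : Sm u) (n : ℕ) (x : ℝ) :
    HasDerivAt (iteratedDeriv n u) (iteratedDeriv (n+1) u x) x := by
  rw [iteratedDeriv_succ]; exact ((h.iter n).d x).hasDerivAt

lemma Sm.comp1 {u v : ℝ → ℝ} (hu : Sm u) (hv : Sm v) : Sm (fun x => u (x + v x)) :=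
  hu.comp (contDiff_id.add hv)

lemma deriv_comp1 {u v : ℝ → ℝ} (hu : Sm u) (hv : Sm v) :
    deriv (fun x => u (x + v x)) = fun x => deriv u (x + v x) * (1 + deriv v x) := by
  funext x
  have h := (hu.d (x + v x)).hasDerivAt.comp x ((hasDerivAt_id x).add (hv.d x).hasDerivAt)
  exact h.deriv

variable {ι : Type*}

/-- eventually bounded derivatives up to order r -/
def EB (l : Filter ι) (r : ℕ) (u : ι → ℝ → ℝ) : Prop :=
  (∀ i, Sm (u i)) ∧ ∀ s ≤ r, ∃ C : ℝ, ∀ᶠ i in l, ∀ x, |iteratedDeriv s (u i) x| ≤ C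

/-- tends to zero with derivatives up to order r -/
def NL (l : Filter ι) (r : ℕ) (u : ι → ℝ → ℝ) : Prop :=
  (∀ i, Sm (u i)) ∧ ∀ s ≤ r, ∀ ε > 0, ∀ᶠ i in l, ∀ x, |iteratedDeriv s (u i) x| ≤ ε

variable {l : Filter ι} {r : ℕ} {u v : ι → ℝ → ℝ}

lemma EB.mono (h : EB l r u) {r' : ℕ} (hr : r' ≤ r) : EB l r' u :=
  ⟨h.1, fun s hs => h.2 s (hs.trans hr)⟩

lemma NL.mono (h : NL l r u) {r' : ℕ} (hr : r' ≤ r) : NL l r' u :=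
  ⟨h.1, fun s hs => h.2 s (hs.trans hr)⟩

lemma EB.zero_bd (h : EB l r u) : ∃ C : ℝ, ∀ᶠ i in l, ∀ x, |u i x| ≤ C := by
  simpa using h.2 0 (Nat.zero_le _)

lemma EB.deriv (h : EB l (r+1) u) : EB l r (fun i => deriv (u i)) := by
  refine ⟨fun i => (h.1 i).deriv, fun s hs => ?_⟩
  obtain ⟨C, hC⟩ := h.2 (s+1) (by omega)
  refine ⟨C, hC.mono fun i hi x => ?_⟩
  rw [← iteratedDeriv_succ']; exact hi x

lemma EB.of_zero (h : ∀ i, Sm (u i)) (h0 : ∃ C : ℝ, ∀ᶠ i in l, ∀ x, |u i x| ≤ C) : EB l 0 u := by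
  refine ⟨h, fun s hs => ?_⟩
  obtain rfl : s = 0 := by omega
  simpa using h0

lemma EB.of_deriv (h : ∀ i, Sm (u i)) (h0 : ∃ C : ℝ, ∀ᶠ i in l, ∀ x, |u i x| ≤ C)
    (h1 : EB l r (fun i => _root_.deriv (u i))) : EB l (r+1) u := by
  refine ⟨h, fun s hs => ?_⟩
  rcases s with _ | s
  · simpa using h0
  · obtain ⟨C, hC⟩ := h1.2 s (by omega)
    refine ⟨C, hC.mono fun i hi x => ?_⟩
    rw [iteratedDeriv_succ']; exact hi x

lemma EB.add (hu : EB l r u) (hv : EB l r v) : EB l r (fun i x => u i x + v i x) := by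
  refine ⟨fun i => (hu.1 i).add (hv.1 i), fun s hs => ?_⟩
  obtain ⟨C, hC⟩ := hu.2 s hs
  obtain ⟨D, hD⟩ := hv.2 s hs
  refine ⟨C + D, (hC.and hD).mono fun i hi x => ?_⟩
  have : iteratedDeriv s (fun x => u i x + v i x) x
      = iteratedDeriv s (u i) x + iteratedDeriv s (v i) x :=
    iteratedDeriv_add ((hu.1 i).at s x) ((hv.1 i).at s x)
  rw [this]
  exact (abs_add_le _ _).trans (add_le_add (hi.1 x) (hi.2 x))

lemma EB.mul (hu : EB l r u) (hv : EB l r v) : EB l r (fun i x => u i x * v i x) := by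
  induction r generalizing u v with
  | zero =>
    refine EB.of_zero (fun i => (hu.1 i).mul (hv.1 i)) ?_
    obtain ⟨C, hC⟩ := hu.zero_bd
    obtain ⟨D, hD⟩ := hv.zero_bd
    refine ⟨C * D, (hC.and hD).mono fun i hi x => ?_⟩
    rw [abs_mul]
    exact mul_le_mul (hi.1 x) (hi.2 x) (abs_nonneg _) ((abs_nonneg _).trans (hi.1 x))
  | succ r ih =>
    have h0 := ih (hu.mono (Nat.le_succ _)) (hv.mono (Nat.le_succ _))
    refine EB.of_deriv h0.1 h0.zero_bd ?_
    have h1 := (ih hu.deriv (hv.mono (Nat.le_succ _))).add (ih (hu.mono (Nat.le_succ _)) hv.deriv)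
    convert h1 using 2 with i
    funext x
    exact deriv_fun_mul ((hu.1 i).d x) ((hv.1 i).d x)

lemma EB.const {c : ι → ℝ} (hc : ∃ C : ℝ, ∀ᶠ i in l, |c i| ≤ C) : EB l r (fun i _ => c i) := by
  refine ⟨fun i => contDiff_const, fun s hs => ?_⟩
  rcases s with _ | s
  · obtain ⟨C, hC⟩ := hc
    exact ⟨C, hC.mono fun i hi x => by simpa using hi⟩
  · exact ⟨0, Eventually.of_forall fun i x => by simp [iteratedDeriv_const]⟩

lemma EB.cst (c : ℝ) : EB l r (fun _ _ => c) := EB.const ⟨|c|, Eventually.of_forall fun _ => le_rfl⟩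

lemma EB.cmul (c : ℝ) (hu : EB l r u) : EB l r (fun i x => c * u i x) := (EB.cst c).mul hu

lemma EB.neg (hu : EB l r u) : EB l r (fun i x => - u i x) := by
  simpa using hu.cmul (-1)

lemma EB.sub (hu : EB l r u) (hv : EB l r v) : EB l r (fun i x => u i x - v i x) := by
  simpa [sub_eq_add_neg] using hu.add hv.neg

lemma EB.comp1 (hu : EB l r u) (hv : EB l r v) : EB l r (fun i x => u i (x + v i x)) := by
  have hs : ∀ i, Sm (fun x => u i (x + v i x)) := fun i => (hu.1 i).comp1 (hv.1 i)
  have h0 : ∃ C : ℝ, ∀ᶠ i in l, ∀ x, |u i (x + v i x)| ≤ C := by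
    obtain ⟨C, hC⟩ := hu.zero_bd
    exact ⟨C, hC.mono fun i hi x => hi _⟩
  induction r generalizing u v with
  | zero => exact EB.of_zero hs h0
  | succ r ih =>
    refine EB.of_deriv hs h0 ?_
    have hd := hu.deriv
    have h1 := ih hd (hv.mono (Nat.le_succ _)) (fun i => (hd.1 i).comp1 (hv.1 i)) (by
      obtain ⟨C, hC⟩ := hd.zero_bd
      exact ⟨C, hC.mono fun i hi x => hi _⟩)
    convert h1.mul ((EB.cst 1).add hv.deriv) using 2 with i
    exact deriv_comp1 (hu.1 i) (hv.1 i)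

lemma EB.affine (a b : ℝ) (hu : EB l r u) : EB l r (fun i x => u i (a * x + b)) := by
  refine ⟨fun i => (hu.1 i).comp (by fun_prop), fun s hs => ?_⟩
  obtain ⟨C, hC⟩ := hu.2 s hs
  refine ⟨|a|^s * C, hC.mono fun i hi x => ?_⟩
  have h1 : iteratedDeriv s (fun x => u i (a * x + b)) x
      = a^s * iteratedDeriv s (u i) (a * x + b) := by
    have h2 := iteratedDeriv_comp_const_mul (n := s) (f := fun y => u i (y + b))
      (((hu.1 i).comp (contDiff_id.add contDiff_const)).of_le (by exact_mod_cast le_top)) a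
    have h3 := congrFun h2 x
    simp only [iteratedDeriv_comp_add_const, smul_eq_mul] at h3
    exact h3
  rw [h1, abs_mul, abs_pow]
  exact mul_le_mul_of_nonneg_left (hi _) (by positivity)

lemma EB.inv {c : ℝ} (hc : 0 < c) (hu : EB l r u) (hp : ∀ i x, u i x ≠ 0)
    (hl : ∀ᶠ i in l, ∀ x, c ≤ |u i x|) : EB l r (fun i x => (u i x)⁻¹) := by
  have hs : ∀ i, Sm (fun x => (u i x)⁻¹) := fun i => (hu.1 i).inv (hp i)
  have h0 : ∃ C : ℝ, ∀ᶠ i in l, ∀ x, |(u i x)⁻¹| ≤ C := by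
    refine ⟨c⁻¹, hl.mono fun i hi x => ?_⟩
    rw [abs_inv]
    exact inv_anti₀ hc (hi x)
  induction r with
  | zero => exact EB.of_zero hs h0
  | succ r ih =>
    refine EB.of_deriv hs h0 ?_
    have h1 := ih (hu.mono (Nat.le_succ _))
    convert (hu.deriv.mul (h1.mul h1)).neg using 2 with i
    funext x
    have := (((hu.1 i).d x).hasDerivAt.inv (hp i x)).deriv
    rw [show (fun x => (u i x)⁻¹) = (u i)⁻¹ from rfl, this]
    have := hp i x
    field_simp

/-- if `z + a (x+z) = b` with `1 + a'` bounded below then z bounded -/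
lemma EB.div {a b z : ι → ℝ → ℝ} {c : ℝ} (hc : 0 < c) (ha : EB l r a) (hb : EB l r b)
    (hz : ∀ i, Sm (z i)) (hp : ∀ i x, 0 < 1 + _root_.deriv (a i) x)
    (hl : ∀ᶠ i in l, ∀ x, c ≤ 1 + _root_.deriv (a i) x)
    (he : ∀ i x, z i x + a i (x + z i x) = b i x) : EB l r z := by
  have h0 : ∃ C : ℝ, ∀ᶠ i in l, ∀ x, |z i x| ≤ C := by
    obtain ⟨C, hC⟩ := ha.zero_bd
    obtain ⟨D, hD⟩ := hb.zero_bd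
    refine ⟨D + C, (hC.and hD).mono fun i hi x => ?_⟩
    rw [show z i x = b i x - a i (x + z i x) by rw [← he]; ring]
    exact (abs_sub _ _).trans (add_le_add (hi.2 x) (hi.1 _))
  induction r with
  | zero => exact EB.of_zero hz h0
  | succ r ih =>
    have h1 := ih (ha.mono (Nat.le_succ _)) (hb.mono (Nat.le_succ _))
    refine EB.of_deriv hz h0 ?_
    have h2 := ha.deriv.comp1 h1
    have h3 := EB.inv (u := fun i x => 1 + _root_.deriv (a i) (x + z i x)) hc
      ((EB.cst 1).add h2) (fun i x => (hp i _).ne')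
      (hl.mono fun i hi x => (hi _).trans (le_abs_self _))
    convert (hb.deriv.sub h2).mul h3 using 2 with i
    funext x
    have e1 : _root_.deriv (fun x => z i x + a i (x + z i x)) x = _root_.deriv (b i) x := by
      congr 1; funext x; exact he i x
    rw [deriv_fun_add ((hz i).d x) (((ha.1 i).comp1 (hz i)).d x), deriv_comp1 (ha.1 i) (hz i)] at e1
    have := (hp i (x + z i x)).ne'
    rw [← e1]
    field_simp
    ring

lemma landau {f : ℝ → ℝ} (hf : Sm f) {M N t : ℝ} (ht : 0 < t) (h0 : ∀ x, |f x| ≤ M)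
    (h2 : ∀ x, |iteratedDeriv 2 f x| ≤ N) (x : ℝ) : |deriv f x| ≤ 2 * M / t + t * N := by
  obtain ⟨ξ, hξ, he⟩ := exists_deriv_eq_slope f (show x < x + t by linarith)
    hf.continuous.continuousOn (hf.d.differentiableOn)
  have hd : deriv (deriv f) = iteratedDeriv 2 f := by
    rw [iteratedDeriv_succ, iteratedDeriv_one]
  obtain ⟨ζ, hζ, he2⟩ := exists_deriv_eq_slope (deriv f) hξ.1
    hf.deriv.continuous.continuousOn (hf.deriv.d.differentiableOn)
  have e1 : deriv f x = deriv f ξ - iteratedDeriv 2 f ζ * (ξ - x) := by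
    rw [← hd, he2]; field_simp [sub_ne_zero.2 hξ.1.ne']; ring
  have a1 : |deriv f ξ| ≤ 2 * M / t := by
    rw [he, abs_div, show x + t - x = t by ring, abs_of_pos ht]
    gcongr
    exact (abs_sub _ _).trans (by linarith [h0 x, h0 (x+t)])
  have a2 : |iteratedDeriv 2 f ζ * (ξ - x)| ≤ t * N := by
    rw [abs_mul, abs_of_pos (sub_pos.2 hξ.1), mul_comm]
    exact mul_le_mul (by linarith [hξ.2]) (h2 _) (abs_nonneg _) ht.le
  rw [e1]; exact (abs_sub _ _).trans (add_le_add a1 a2)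

lemma EB.nl (hu : EB l (r+1) u) (h0 : ∀ ε > 0, ∀ᶠ i in l, ∀ x, |u i x| ≤ ε) : NL l r u := by
  refine ⟨hu.1, fun s => ?_⟩
  induction s with
  | zero => intro _; simpa using h0
  | succ s ih =>
    intro hs ε hε
    obtain ⟨C, hC⟩ := hu.2 (s+2) (by omega)
    set D := max C 1
    have hD : 0 < D := lt_of_lt_of_le one_pos (le_max_right _ _)
    set t := ε / (2 * D)
    have ht : 0 < t := by positivity
    filter_upwards [hC, ih (by omega) (t * ε / 4) (by positivity)] with i h1 h2 x
    rw [iteratedDeriv_succ]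
    have := landau ((hu.1 i).iter s) (N := D) ht h2 (fun x => by
      rw [iteratedDeriv_succ, iteratedDeriv_one, ← iteratedDeriv_succ, ← iteratedDeriv_succ]
      exact (h1 x).trans (le_max_left _ _)) x
    refine this.trans (le_of_eq ?_)
    simp only [t]; field_simp; ring

lemma NL.eb (h : NL l r u) : EB l r u := ⟨h.1, fun s hs => ⟨1, h.2 s hs 1 one_pos⟩⟩


def BS (u : ℝ → ℝ) : Prop := ∀ r, EB (⊤ : Filter Unit) r (fun _ => u)

lemma BS.sm {u : ℝ → ℝ} (h : BS u) : Sm u := (h 0).1 ()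
lemma BS.bd {u : ℝ → ℝ} (h : BS u) (s : ℕ) : ∃ C : ℝ, ∀ x, |iteratedDeriv s u x| ≤ C := by
  obtain ⟨C, hC⟩ := (h s).2 s le_rfl
  exact ⟨C, by simpa using hC⟩
lemma BS.mk {u : ℝ → ℝ} (h : Sm u) (hb : ∀ s, ∃ C : ℝ, ∀ x, |iteratedDeriv s u x| ≤ C) : BS u :=
  fun _ => ⟨fun _ => h, fun s _ => (hb s).imp fun C hC => by simpa using hC⟩
lemma BS.eb {ι : Type*} {l : Filter ι} {u : ℝ → ℝ} (h : BS u) (r : ℕ) : EB l r (fun _ => u) :=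
  ⟨fun _ => h.sm, fun s _ => (h.bd s).imp fun C hC => by simp [hC]⟩
lemma BS.add {u v : ℝ → ℝ} (hu : BS u) (hv : BS v) : BS (fun x => u x + v x) :=
  fun r => (hu r).add (hv r)
lemma BS.sub {u v : ℝ → ℝ} (hu : BS u) (hv : BS v) : BS (fun x => u x - v x) :=
  fun r => (hu r).sub (hv r)
lemma BS.mul {u v : ℝ → ℝ} (hu : BS u) (hv : BS v) : BS (fun x => u x * v x) :=
  fun r => (hu r).mul (hv r)
lemma BS.cmul {u : ℝ → ℝ} (c : ℝ) (hu : BS u) : BS (fun x => c * u x) :=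
  fun r => (hu r).cmul c
lemma BS.cst (c : ℝ) : BS (fun _ => c) := fun _ => EB.cst c
lemma BS.affine {u : ℝ → ℝ} (a b : ℝ) (hu : BS u) : BS (fun x => u (a * x + b)) :=
  fun r => (hu r).affine a b
lemma BS.comp1 {u v : ℝ → ℝ} (hu : BS u) (hv : BS v) : BS (fun x => u (x + v x)) :=
  fun r => (hu r).comp1 (hv r)
lemma BS.deriv {u : ℝ → ℝ} (hu : BS u) : BS (deriv u) :=
  fun r => (hu (r+1)).deriv

lemma iter_zero_of_zero {u : ℝ → ℝ} {U : Set ℝ} (hU : IsOpen U) (h : ∀ x ∈ U, u x = 0)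
    (s : ℕ) : ∀ x ∈ U, iteratedDeriv s u x = 0 := by
  induction s with
  | zero => simpa using h
  | succ s ih =>
    intro x hx
    rw [iteratedDeriv_succ]
    have : iteratedDeriv s u =ᶠ[𝓝 x] fun _ => 0 := by
      filter_upwards [hU.mem_nhds hx] with y hy using ih y hy
    rw [this.deriv_eq]; simp

lemma iter_eq_of_eq {u v : ℝ → ℝ} {U : Set ℝ} (hU : IsOpen U) (h : ∀ x ∈ U, u x = v x)
    (s : ℕ) : ∀ x ∈ U, iteratedDeriv s u x = iteratedDeriv s v x := by
  induction s with
  | zero => simpa using h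
  | succ s ih =>
    intro x hx
    rw [iteratedDeriv_succ, iteratedDeriv_succ]
    have : iteratedDeriv s u =ᶠ[𝓝 x] iteratedDeriv s v := by
      filter_upwards [hU.mem_nhds hx] with y hy using ih y hy
    exact this.deriv_eq

lemma BS.of_supp {u : ℝ → ℝ} (hu : Sm u) {B : ℝ} (h : ∀ x, B < |x| → u x = 0) : BS u := by
  refine BS.mk hu fun s => ?_
  obtain ⟨C, hC⟩ := (isCompact_Icc (a := -B) (b := B)).exists_bound_of_continuousOn
    ((hu.iter s).continuous.continuousOn)
  refine ⟨max C 0, fun x => ?_⟩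
  by_cases hx : |x| ≤ B
  · exact (hC x (abs_le.1 hx)).trans (le_max_left _ _)
  · rw [iter_zero_of_zero (U := {x | B < |x|}) (isOpen_lt continuous_const continuous_abs)
      (fun x hx => h x hx) s x (not_le.1 hx)]
    simp

lemma iter_periodic {u : ℝ → ℝ} (h : ∀ x, u (x + 1) = u x) (s : ℕ) (x : ℝ) :
    iteratedDeriv s u (x + 1) = iteratedDeriv s u x := by
  have := congrFun (iteratedDeriv_comp_add_const s u 1) x
  rw [← this]; congr 1; funext y; exact h y

lemma BS.of_periodic {u : ℝ → ℝ} (hu : Sm u) (h : ∀ x, u (x + 1) = u x) : BS u := by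
  refine BS.mk hu fun s => ?_
  obtain ⟨C, hC⟩ := (isCompact_Icc (a := (0:ℝ)) (b := 1)).exists_bound_of_continuousOn
    ((hu.iter s).continuous.continuousOn)
  refine ⟨C, fun x => ?_⟩
  have hp : Function.Periodic (iteratedDeriv s u) 1 := iter_periodic h s
  obtain ⟨y, hy, he⟩ := hp.exists_mem_Ico₀ one_pos x
  rw [he]; exact hC y ⟨hy.1, hy.2.le⟩

def NN (s : ℕ) (u : ℝ → ℝ) : ℝ := ⨆ x, |iteratedDeriv s u x|
def nr (s : ℕ) (u : ℝ → ℝ) : ℝ := ∑ j ∈ Finset.range s, NN j u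

lemma NN_nonneg (s : ℕ) (u : ℝ → ℝ) : 0 ≤ NN s u := Real.iSup_nonneg fun _ => abs_nonneg _
lemma nr_nonneg (s : ℕ) (u : ℝ → ℝ) : 0 ≤ nr s u := Finset.sum_nonneg fun _ _ => NN_nonneg _ _
lemma NN_le {s : ℕ} {u : ℝ → ℝ} {C : ℝ} (h : ∀ x, |iteratedDeriv s u x| ≤ C) : NN s u ≤ C :=
  ciSup_le h
lemma BS.le {u : ℝ → ℝ} (h : BS u) (s : ℕ) (x : ℝ) : |iteratedDeriv s u x| ≤ NN s u := by
  obtain ⟨C, hC⟩ := h.bd s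
  exact le_ciSup (f := fun x => |iteratedDeriv s u x|) ⟨C, by rintro _ ⟨y, rfl⟩; exact hC y⟩ x
lemma BS.le0 {u : ℝ → ℝ} (h : BS u) (x : ℝ) : |u x| ≤ NN 0 u := by simpa using h.le 0 x
lemma BS.le1 {u : ℝ → ℝ} (h : BS u) (x : ℝ) : |_root_.deriv u x| ≤ NN 1 u := by
  simpa using h.le 1 x
lemma NN0_le {u : ℝ → ℝ} {C : ℝ} (h : ∀ x, |u x| ≤ C) : NN 0 u ≤ C := NN_le (by simpa using h)
lemma NN_le_nr {j s : ℕ} (h : j < s) (u : ℝ → ℝ) : NN j u ≤ nr s u :=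
  Finset.single_le_sum (f := fun j => NN j u) (fun _ _ => NN_nonneg _ _) (Finset.mem_range.2 h)
lemma nr_mono {s t : ℕ} (h : s ≤ t) (u : ℝ → ℝ) : nr s u ≤ nr t u :=
  Finset.sum_le_sum_of_subset_of_nonneg (Finset.range_mono h) fun _ _ _ => NN_nonneg _ _
lemma nr_succ (s : ℕ) (u : ℝ → ℝ) : nr (s+1) u = nr s u + NN s u := Finset.sum_range_succ _ _
lemma NN_deriv (s : ℕ) (u : ℝ → ℝ) : NN s (deriv u) = NN (s+1) u := by
  unfold NN; rw [iteratedDeriv_succ']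
lemma nr_deriv (s : ℕ) (u : ℝ → ℝ) : nr (s+1) u = NN 0 u + nr s (deriv u) := by
  unfold nr; rw [Finset.sum_range_succ', add_comm]; simp [NN_deriv]
lemma nr_deriv_le (s : ℕ) (u : ℝ → ℝ) : nr s (deriv u) ≤ nr (s+1) u := by
  rw [nr_deriv]; linarith [NN_nonneg 0 u]
lemma nr_le_mul {s : ℕ} {u : ℝ → ℝ} {C : ℝ} (h : ∀ j < s, NN j u ≤ C) : nr s u ≤ s * C := by
  have := Finset.sum_le_card_nsmul (Finset.range s) (fun j => NN j u) C (by simpa using h)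
  simpa [nr] using this

lemma NN_add {u v : ℝ → ℝ} (hu : BS u) (hv : BS v) (s : ℕ) :
    NN s (fun x => u x + v x) ≤ NN s u + NN s v := NN_le fun x => by
  rw [show iteratedDeriv s (fun x => u x + v x) x = iteratedDeriv s u x + iteratedDeriv s v x from
    iteratedDeriv_add (hu.sm.at s x) (hv.sm.at s x)]
  exact (abs_add_le _ _).trans (add_le_add (hu.le s x) (hv.le s x))
lemma NN_sub {u v : ℝ → ℝ} (hu : BS u) (hv : BS v) (s : ℕ) :
    NN s (fun x => u x - v x) ≤ NN s u + NN s v := NN_le fun x => by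
  rw [show iteratedDeriv s (fun x => u x - v x) x = iteratedDeriv s u x - iteratedDeriv s v x from
    iteratedDeriv_sub (hu.sm.at s x) (hv.sm.at s x)]
  exact (abs_sub _ _).trans (add_le_add (hu.le s x) (hv.le s x))
lemma nr_add {u v : ℝ → ℝ} (hu : BS u) (hv : BS v) (s : ℕ) :
    nr s (fun x => u x + v x) ≤ nr s u + nr s v := by
  unfold nr; rw [← Finset.sum_add_distrib]; exact Finset.sum_le_sum fun j _ => NN_add hu hv j
lemma nr_sub {u v : ℝ → ℝ} (hu : BS u) (hv : BS v) (s : ℕ) :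
    nr s (fun x => u x - v x) ≤ nr s u + nr s v := by
  unfold nr; rw [← Finset.sum_add_distrib]; exact Finset.sum_le_sum fun j _ => NN_sub hu hv j

lemma NN_mul {u v : ℝ → ℝ} (hu : BS u) (hv : BS v) (s : ℕ) :
    NN s (fun x => u x * v x) ≤
      ∑ k ∈ Finset.range (s+1), (s.choose k : ℝ) * NN k u * NN (s-k) v := NN_le fun x => by
  rw [show iteratedDeriv s (fun x => u x * v x) x = _ from
    iteratedDeriv_mul (hu.sm.at s x) (hv.sm.at s x)]
  refine (Finset.abs_sum_le_sum_abs _ _).trans (Finset.sum_le_sum fun k _ => ?_)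
  rw [abs_mul, abs_mul, Nat.abs_cast]
  gcongr
  · exact mul_nonneg (by positivity) (NN_nonneg _ _)
  · exact hu.le k x
  · exact hv.le _ x

lemma NN_mul_le {u v : ℝ → ℝ} (hu : BS u) (hv : BS v) {s t : ℕ} (h : s < t) :
    NN s (fun x => u x * v x) ≤ 2^s * (nr t u * nr t v) := by
  refine (NN_mul hu hv s).trans ?_
  have : (2:ℝ)^s = ∑ k ∈ Finset.range (s+1), (s.choose k : ℝ) := by
    exact_mod_cast (Nat.sum_range_choose s).symm
  rw [this, Finset.sum_mul]
  refine Finset.sum_le_sum fun k hk => ?_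
  rw [mul_assoc]
  have := Finset.mem_range.1 hk
  gcongr
  · exact NN_nonneg _ _
  · exact nr_nonneg _ _
  · exact NN_le_nr (by omega) u
  · exact NN_le_nr (by omega) v

lemma nr_mul {u v : ℝ → ℝ} (hu : BS u) (hv : BS v) (s : ℕ) :
    nr s (fun x => u x * v x) ≤ s * 2^s * (nr s u * nr s v) := by
  rw [mul_assoc]
  refine nr_le_mul fun j hj => (NN_mul_le hu hv hj).trans ?_
  have := mul_nonneg (nr_nonneg s u) (nr_nonneg s v)
  gcongr
  · norm_num

lemma NN_mul_top {u v : ℝ → ℝ} (hu : BS u) (hv : BS v) {s : ℕ} (hs : 1 ≤ s) :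
    NN s (fun x => u x * v x) ≤ NN 0 u * NN s v + NN s u * NN 0 v
      + 2^s * (nr s u * nr s v) := by
  refine (NN_mul hu hv s).trans ?_
  obtain ⟨s, rfl⟩ : ∃ t, s = t + 1 := ⟨s-1, by omega⟩
  rw [Finset.sum_range_succ, Finset.sum_range_succ']
  have h2 : (2:ℝ)^(s+1) = ∑ k ∈ Finset.range (s+2), ((s+1).choose k : ℝ) := by
    exact_mod_cast (Nat.sum_range_choose (s+1)).symm
  rw [Finset.sum_range_succ, Finset.sum_range_succ'] at h2
  have h3 : ∑ k ∈ Finset.range s, ((s+1).choose (k+1) : ℝ) * NN (k+1) u * NN (s+1-(k+1)) v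
      ≤ 2^(s+1) * (nr (s+1) u * nr (s+1) v) := by
    have h4 : ∑ k ∈ Finset.range s, ((s+1).choose (k+1) : ℝ) * NN (k+1) u * NN (s+1-(k+1)) v
      ≤ (∑ k ∈ Finset.range s, ((s+1).choose (k+1) : ℝ)) * (nr (s+1) u * nr (s+1) v) := by
      rw [Finset.sum_mul]
      refine Finset.sum_le_sum fun k hk => ?_
      have := Finset.mem_range.1 hk
      rw [mul_assoc]
      gcongr
      · exact NN_nonneg _ _
      · exact nr_nonneg _ _
      · exact NN_le_nr (by omega) u
      · exact NN_le_nr (by omega) v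
    refine h4.trans (mul_le_mul_of_nonneg_right ?_
      (mul_nonneg (nr_nonneg _ _) (nr_nonneg _ _)))
    rw [h2]; simp only [Nat.choose_zero_right, Nat.choose_self, Nat.cast_one]; linarith
  simp only [Nat.choose_zero_right, Nat.choose_self, Nat.cast_one, one_mul, Nat.sub_zero,
    Nat.sub_self]
  linarith

lemma NN0_comp {u v : ℝ → ℝ} (hu : BS u) : NN 0 (fun x => u (x + v x)) ≤ NN 0 u :=
  NN0_le fun x => hu.le0 _

lemma NN_succ_comp {u v : ℝ → ℝ} (hu : BS u) (hv : BS v) (s : ℕ) :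
    NN (s+1) (fun x => u (x + v x)) = NN s (fun x => deriv u (x + v x) * (1 + deriv v x)) := by
  rw [← NN_deriv, deriv_comp1 hu.sm hv.sm]

lemma nr_one_add (s : ℕ) {v : ℝ → ℝ} (hv : BS v) : nr s (fun x => 1 + v x) ≤ s + nr s v := by
  refine (nr_add (BS.cst 1) hv s).trans (add_le_add_left ?_ _)
  rw [← mul_one (s:ℝ)]
  refine nr_le_mul fun j _ => NN_le fun x => ?_
  rcases j with _ | j <;> simp [iteratedDeriv_const]

lemma soft (s : ℕ) (M : ℝ) : ∃ C ≥ 0, ∀ u v : ℝ → ℝ, BS u → BS v → nr s v ≤ M →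
    nr s (fun x => u (x + v x)) ≤ C * nr s u := by
  induction s with
  | zero => exact ⟨0, le_rfl, fun u v _ _ _ => by simp [nr]⟩
  | succ s ih =>
    obtain ⟨C, hC, h⟩ := ih
    refine ⟨1 + s * 2^s * (C * |s + M|), by positivity, fun u v hu hv hM => ?_⟩
    rw [nr_deriv, deriv_comp1 hu.sm hv.sm]
    have h1 := h _ v hu.deriv hv ((nr_mono (Nat.le_succ s) v).trans hM)
    have h2 := nr_mul (hu.deriv.comp1 hv) ((BS.cst 1).add hv.deriv) s
    have h3 : nr s (fun x => 1 + deriv v x) ≤ |s + M| :=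
      (nr_one_add s hv.deriv).trans ((add_le_add_right ((nr_deriv_le s v).trans hM) _).trans
        (le_abs_self _))
    have h4 : nr s (fun x => deriv u (x + v x)) ≤ C * nr (s+1) u :=
      h1.trans (mul_le_mul_of_nonneg_left (nr_deriv_le s u) hC)
    have h5 : NN 0 (fun x => u (x + v x)) ≤ nr (s+1) u :=
      (NN0_comp hu).trans (NN_le_nr (Nat.succ_pos _) u)
    have h6 : nr s (fun x => deriv u (x + v x)) * nr s (fun x => 1 + deriv v x)
      ≤ (C * nr (s+1) u) * |s + M| := mul_le_mul h4 h3 (nr_nonneg _ _)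
        (mul_nonneg hC (nr_nonneg _ _))
    have h7 := mul_le_mul_of_nonneg_left h6 (show (0:ℝ) ≤ s * 2^s by positivity)
    calc _ ≤ nr (s+1) u + s * 2^s * ((C * nr (s+1) u) * |s + M|) := add_le_add h5 (h2.trans h7)
      _ = _ := by ring

lemma NN1_comp {u v : ℝ → ℝ} (hu : BS u) (hv : BS v) :
    NN 1 (fun x => u (x + v x)) ≤ (1 + NN 1 v) * NN 1 u := by
  rw [NN_succ_comp hu hv 0]
  refine NN0_le fun x => ?_
  rw [abs_mul, mul_comm]
  refine mul_le_mul ((abs_add_le _ _).trans ?_) (hu.le1 _) (abs_nonneg _)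
    (by linarith [NN_nonneg 1 v])
  rw [abs_one]; linarith [hv.le1 x]

lemma Psharp (s : ℕ) (M : ℝ) : ∃ C ≥ 0, ∀ u v : ℝ → ℝ, BS u → BS v → nr (s+2) v ≤ M →
    NN (s+2) (fun x => u (x + v x)) ≤ (1 + NN 1 v)^(s+2) * NN (s+2) u + NN 1 u * NN (s+2) v
      + C * (nr (s+2) u * nr (s+2) v) := by
  induction s with
  | zero =>
    obtain ⟨C, hC, h⟩ := soft 1 M
    refine ⟨2 * C, by positivity, fun u v hu hv hM => ?_⟩
    have hb := hu.deriv.comp1 hv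
    rw [NN_succ_comp hu hv 1]
    have e : (fun x => deriv u (x + v x) * (1 + deriv v x)) =
      fun x => deriv u (x + v x) + deriv u (x + v x) * deriv v x := by funext x; ring
    rw [e]
    have h1 := NN_add hb (hb.mul hv.deriv) 1
    have h2 := NN_mul_top hb hv.deriv (le_refl 1)
    have h3 := NN1_comp hu.deriv hv
    have h4 := NN0_comp (v := v) hu.deriv
    have h5 := h _ v hu.deriv hv ((nr_mono (by norm_num) v).trans hM)
    rw [NN_deriv] at h3 h4
    simp only [NN_deriv] at h2
    norm_num at h1 h2 h3 h4 ⊢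
    have h6 := mul_le_mul_of_nonneg_right h3 (show 0 ≤ 1 + NN 1 v by linarith [NN_nonneg 1 v])
    have h7 := mul_le_mul_of_nonneg_right h4 (NN_nonneg 2 v)
    have h8 : nr 1 (fun x => deriv u (x + v x)) * nr 1 (deriv v) ≤ (C * nr 2 u) * nr 2 v :=
      mul_le_mul (h5.trans (mul_le_mul_of_nonneg_left (nr_deriv_le 1 u) hC)) (nr_deriv_le 1 v)
        (nr_nonneg _ _) (mul_nonneg hC (nr_nonneg _ _))
    nlinarith
  | succ s ih =>
    obtain ⟨C0, hC0, h0⟩ := soft (s+2) M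
    obtain ⟨C, hC, h⟩ := ih
    set N := 1 + |M|
    refine ⟨N * (1 + C) + 2^(s+2) * C0, by positivity, fun u v hu hv hM => ?_⟩
    have hb := hu.deriv.comp1 hv
    have hM' := (nr_mono (by omega : s+2 ≤ s+1+2) v).trans hM
    rw [NN_succ_comp hu hv (s+2)]
    have e : (fun x => deriv u (x + v x) * (1 + deriv v x)) =
      fun x => deriv u (x + v x) + deriv u (x + v x) * deriv v x := by funext x; ring
    rw [e]
    have h1 := NN_add hb (hb.mul hv.deriv) (s+2)
    have h2 := NN_mul_top hb hv.deriv (by omega : 1 ≤ s+2)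
    have h3 := h _ v hu.deriv hv hM'
    have h4 := NN0_comp (v := v) hu.deriv
    have h5 := h0 _ v hu.deriv hv hM'
    rw [NN_deriv] at h4
    simp only [NN_deriv] at h2 h3
    have n1 := NN_nonneg 1 v
    have h6 := mul_le_mul_of_nonneg_right h3 (show 0 ≤ 1 + NN 1 v by linarith)
    have h7 := mul_le_mul_of_nonneg_right h4 (NN_nonneg (s+3) v)
    have h8 : nr (s+2) (fun x => deriv u (x + v x)) * nr (s+2) (deriv v)
        ≤ (C0 * nr (s+3) u) * nr (s+3) v :=
      mul_le_mul (h5.trans (mul_le_mul_of_nonneg_left (nr_deriv_le _ u) hC0)) (nr_deriv_le _ v)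
        (nr_nonneg _ _) (mul_nonneg hC0 (nr_nonneg _ _))
    have h9 : NN 2 u * NN (s+2) v ≤ nr (s+3) u * nr (s+3) v :=
      mul_le_mul (NN_le_nr (by omega) u) (NN_le_nr (by omega) v) (NN_nonneg _ _) (nr_nonneg _ _)
    have h10 : nr (s+2) (deriv u) * nr (s+2) v ≤ nr (s+3) u * nr (s+3) v :=
      mul_le_mul (nr_deriv_le _ u) (nr_mono (by omega) v) (nr_nonneg _ _) (nr_nonneg _ _)
    have h11 : 1 + NN 1 v ≤ N := by
      have := (NN_le_nr (by omega : 1 < s+1+2) v).trans (hM.trans (le_abs_self M))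
      linarith
    have h12 : (1 + NN 1 v) * (NN 2 u * NN (s+2) v + C * (nr (s+2) (deriv u) * nr (s+2) v))
        ≤ N * ((1 + C) * (nr (s+3) u * nr (s+3) v)) := by
      refine mul_le_mul h11 ?_ ?_ (by positivity)
      · have := mul_le_mul_of_nonneg_left h10 hC
        linarith
      · have a1 := mul_nonneg (NN_nonneg 2 u) (NN_nonneg (s+2) v)
        have a2 := mul_nonneg hC (mul_nonneg (nr_nonneg (s+2) (deriv u)) (nr_nonneg (s+2) v))
        linarith
    have h13 := mul_le_mul_of_nonneg_left h8 (show (0:ℝ) ≤ 2^(s+2) by positivity)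
    rw [show s + 1 + 2 = s + 3 by ring, pow_succ (1 + NN 1 v) (s+2)]
    rw [show s + 2 + 1 = s + 3 by ring] at *
    linarith

lemma nr_diff (s : ℕ) (M : ℝ) : ∃ C ≥ 0, ∀ u v w : ℝ → ℝ, BS u → BS v → BS w → nr s v ≤ M →
    nr s w ≤ M → nr s (fun x => u (x + v x) - u (x + w x)) ≤
      C * (nr (s+1) u * nr s (fun x => v x - w x)) := by
  induction s with
  | zero => exact ⟨0, le_rfl, fun u v w _ _ _ _ _ => by simp [nr]⟩
  | succ s ih =>
    obtain ⟨C, hC, h⟩ := ih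
    obtain ⟨D, hD, hs⟩ := soft s M
    refine ⟨1 + s * 2^s * (C * |s + M|) + s * 2^s * D, by positivity,
      fun u v w hu hv hw hM hM' => ?_⟩
    have hMv := (nr_mono (Nat.le_succ s) v).trans hM
    have hMw := (nr_mono (Nat.le_succ s) w).trans hM'
    have b1 := hu.deriv.comp1 hv
    have b2 := hu.deriv.comp1 hw
    have e : deriv (fun x => u (x + v x) - u (x + w x)) = fun x =>
        (deriv u (x + v x) - deriv u (x + w x)) * (1 + deriv v x)
        + deriv u (x + w x) * deriv (fun x => v x - w x) x := by
      funext x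
      rw [deriv_fun_sub ((hu.sm.comp1 hv.sm).d x) ((hu.sm.comp1 hw.sm).d x),
        deriv_comp1 hu.sm hv.sm, deriv_comp1 hu.sm hw.sm, deriv_fun_sub (hv.sm.d x) (hw.sm.d x)]
      ring
    rw [nr_deriv, e]
    set δ := fun x => v x - w x with hδ
    have hδb : BS δ := hv.sub hw
    have h0 : NN 0 (fun x => u (x + v x) - u (x + w x)) ≤ nr (s+2) u * nr (s+1) δ := by
      refine NN0_le fun x => ?_
      have := Convex.norm_image_sub_le_of_norm_deriv_le (f := u) (s := univ) (C := NN 1 u)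
        (x := x + w x) (y := x + v x) (fun y _ => hu.sm.d y) (fun y _ => hu.le1 y) convex_univ
        trivial trivial
      rw [Real.norm_eq_abs, Real.norm_eq_abs] at this
      refine this.trans (mul_le_mul (NN_le_nr (by omega) u) ?_ (abs_nonneg _) (nr_nonneg _ _))
      rw [show x + v x - (x + w x) = δ x by simp [hδ]]
      exact (hδb.le0 x).trans (NN_le_nr (by omega) _)
    have h1 := h _ v w hu.deriv hv hw hMv hMw
    have h2 := nr_mul (b1.sub b2) ((BS.cst 1).add hv.deriv) s
    have h2' := nr_mul b2 hδb.deriv s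
    have h3 : nr s (fun x => 1 + deriv v x) ≤ |s + M| :=
      (nr_one_add s hv.deriv).trans ((add_le_add_right ((nr_deriv_le s v).trans hM) _).trans
        (le_abs_self _))
    have h4 : nr s (fun x => deriv u (x + v x) - deriv u (x + w x)) ≤
        C * (nr (s+2) u * nr (s+1) δ) := h1.trans (mul_le_mul_of_nonneg_left
          (mul_le_mul (nr_deriv_le _ u) (nr_mono (Nat.le_succ s) _) (nr_nonneg _ _)
            (nr_nonneg _ _)) hC)
    have h5 : nr s (fun x => deriv u (x + w x)) ≤ D * nr (s+2) u :=
      (hs _ w hu.deriv hw hMw).trans (mul_le_mul_of_nonneg_left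
        ((nr_deriv_le s u).trans (nr_mono (by omega) u)) hD)
    have hn : 0 ≤ nr (s+2) u * nr (s+1) δ := mul_nonneg (nr_nonneg _ _) (nr_nonneg _ _)
    have h6 := mul_le_mul h4 h3 (nr_nonneg _ _) (mul_nonneg hC hn)
    have h7 := mul_le_mul h5 (nr_deriv_le s δ) (nr_nonneg _ _) (mul_nonneg hD (nr_nonneg _ _))
    have p : (0:ℝ) ≤ s * 2^s := by positivity
    have h8 := h2.trans (mul_le_mul_of_nonneg_left h6 p)
    have h9 := h2'.trans (mul_le_mul_of_nonneg_left h7 p)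
    have h10 := nr_add ((b1.sub b2).mul ((BS.cst 1).add hv.deriv)) (b2.mul hδb.deriv) s
    have h11 : s * 2^s * (C * (nr (s+2) u * nr (s+1) δ) * |s + M|) +
      s * 2^s * (D * nr (s+2) u * nr (s+1) δ) + nr (s+2) u * nr (s+1) δ =
      (1 + s * 2^s * (C * |s + M|) + s * 2^s * D) * (nr (s+2) u * nr (s+1) δ) := by ring
    linarith


abbrev st : ℝ → ℝ := Real.smoothTransition
lemma st_sm : Sm st := Real.smoothTransition.contDiff
lemma st_mono : Monotone st := Real.smoothTransition.monotone
lemma st0 {x : ℝ} (h : x ≤ 0) : st x = 0 := Real.smoothTransition.zero_of_nonpos h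
lemma st1 {x : ℝ} (h : 1 ≤ x) : st x = 1 := Real.smoothTransition.one_of_one_le h
lemma st_nn (x : ℝ) : 0 ≤ st x := Real.smoothTransition.nonneg x
lemma st_le (x : ℝ) : st x ≤ 1 := Real.smoothTransition.le_one x

/-- cutoff -/
def th (x : ℝ) : ℝ := st (2 * (2 - x)) * st (2 * (2 + x))
def rt (x : ℝ) : ℝ := st (x + 1) * th x
def rt1 (x : ℝ) : ℝ := st x * th x

lemma th_sm : Sm th := by
  unfold th
  exact (st_sm.comp (by fun_prop)).mul (st_sm.comp (by fun_prop))
lemma rt_sm : Sm rt := (st_sm.comp (by fun_prop : ContDiff ℝ _ fun x : ℝ => x + 1)).mul th_sm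
lemma rt1_sm : Sm rt1 := st_sm.mul th_sm
lemma th1 {x : ℝ} (h : |x| ≤ 3/2) : th x = 1 := by
  have := abs_le.1 h
  rw [th, st1 (by linarith), st1 (by linarith), one_mul]
lemma th0 {x : ℝ} (h : 2 ≤ |x|) : th x = 0 := by
  rcases le_abs.1 h with h | h
  · rw [th, st0 (by linarith), zero_mul]
  · rw [th, st0 (x := 2 * (2 + x)) (by linarith), mul_zero]
lemma th_nn (x : ℝ) : 0 ≤ th x := mul_nonneg (st_nn _) (st_nn _)
lemma th_le (x : ℝ) : th x ≤ 1 := mul_le_one₀ (st_le _) (st_nn _) (st_le _)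
lemma rt_z {x : ℝ} (h : 2 < |x|) : rt x = 0 := by rw [rt, th0 h.le, mul_zero]
lemma rt1_z {x : ℝ} (h : 2 < |x|) : rt1 x = 0 := by rw [rt1, th0 h.le, mul_zero]
lemma rt_BS : BS rt := BS.of_supp rt_sm fun _ => rt_z
lemma rt1_BS : BS rt1 := BS.of_supp rt1_sm fun _ => rt1_z
lemma rt_N : NN 0 rt ≤ 1 := NN0_le fun x => by
  rw [rt, abs_of_nonneg (mul_nonneg (st_nn _) (th_nn _))]
  exact mul_le_one₀ (st_le _) (th_nn _) (th_le _)
lemma rt1_N : NN 0 rt1 ≤ 1 := NN0_le fun x => by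
  rw [rt1, abs_of_nonneg (mul_nonneg (st_nn _) (th_nn _))]
  exact mul_le_one₀ (st_le _) (th_nn _) (th_le _)

lemma poincare {w : ℝ → ℝ} (hw : Sm w) (h0 : w 0 = 0)
    (hp : ∀ x, |x| < 1/2 → w (x + 1) = w x) {s : ℕ} {K : ℝ}
    (hK : ∀ x, |iteratedDeriv s w x| ≤ K) (m : ℕ) : ∀ j, j + m = s → ∀ x, |x| ≤ 2 →
      |iteratedDeriv j w x| ≤ 3^m * K := by
  induction m with
  | zero => intro j hj x _; simp at hj; subst hj; simpa using hK x
  | succ m ih =>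
    intro j hj x hx
    have h1 := ih (j+1) (by omega)
    have hz : ∃ ξ ∈ Icc (0:ℝ) 1, iteratedDeriv j w ξ = 0 := by
      rcases j with _ | j
      · exact ⟨0, by simp, by simpa using h0⟩
      · have e : iteratedDeriv j w 0 = iteratedDeriv j w 1 := by
          have := iter_eq_of_eq (u := fun x => w (x + 1)) (v := w) (U := {x | |x| < 1/2})
            (isOpen_lt continuous_abs continuous_const) hp j 0 (by norm_num)
          rw [iteratedDeriv_comp_add_const] at this
          simpa using this.symm
        obtain ⟨ξ, hξ, h⟩ := exists_deriv_eq_zero one_pos (hw.iter j).continuous.continuousOn e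
        exact ⟨ξ, ⟨hξ.1.le, hξ.2.le⟩, by rw [iteratedDeriv_succ]; exact h⟩
    obtain ⟨ξ, hξ, hz⟩ := hz
    have := Convex.norm_image_sub_le_of_norm_hasDerivWithin_le (f := iteratedDeriv j w)
      (s := Icc (-2:ℝ) 2) (C := 3^m * K) (x := ξ) (y := x)
      (fun y _ => (hw.hd j y).hasDerivWithinAt) (fun y hy => h1 y (abs_le.2 hy))
      (convex_Icc _ _) ⟨by linarith [hξ.1], by linarith [hξ.2]⟩ (abs_le.1 hx)
    rw [hz, sub_zero, Real.norm_eq_abs, Real.norm_eq_abs] at this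
    have hK0 : 0 ≤ 3^m * K := (abs_nonneg _).trans (h1 x hx)
    have h3 : |x - ξ| ≤ 3 := by
      rw [abs_le] at hx ⊢; constructor <;> linarith [hξ.1, hξ.2, hx.1, hx.2]
    rw [pow_succ]
    nlinarith

lemma locMul {p : ℝ → ℝ} (hp : BS p) (hz : ∀ x, 2 < |x| → p x = 0) (s : ℕ) :
    ∃ C ≥ 0, ∀ w K, BS w → (∀ j < s, ∀ x, |x| ≤ 2 → |iteratedDeriv j w x| ≤ K) →
      nr s (fun x => p x * w x) ≤ C * K := by
  refine ⟨s * (2^s * nr s p), mul_nonneg (by positivity) (mul_nonneg (by positivity)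
    (nr_nonneg _ _)), fun w K hw hK => ?_⟩
  rw [mul_assoc]
  refine nr_le_mul fun j hj => NN_le fun x => ?_
  have K0 : 0 ≤ K := (abs_nonneg _).trans (hK j hj 0 (by norm_num))
  by_cases hx : 2 < |x|
  · rw [iter_zero_of_zero (U := {x | 2 < |x|}) (isOpen_lt continuous_const continuous_abs)
      (fun x hx => by rw [hz x hx, zero_mul]) j x hx]
    have := nr_nonneg s p
    simp; positivity
  rw [show iteratedDeriv j (fun x => p x * w x) x = _ from
    iteratedDeriv_mul (hp.sm.at j x) (hw.sm.at j x)]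
  refine (Finset.abs_sum_le_sum_abs _ _).trans ?_
  have h1 : ∀ k ∈ Finset.range (j+1), |(j.choose k : ℝ) * iteratedDeriv k p x *
      iteratedDeriv (j-k) w x| ≤ (j.choose k : ℝ) * (nr s p * K) := by
    intro k hk
    have := Finset.mem_range.1 hk
    rw [abs_mul, abs_mul, Nat.abs_cast, mul_assoc]
    gcongr
    · exact nr_nonneg _ _
    · exact (hp.le k x).trans (NN_le_nr (by omega) p)
    · exact hK _ (by omega) x (not_lt.1 hx)
  refine (Finset.sum_le_sum h1).trans ?_
  have h2 : (2:ℝ)^j = ∑ k ∈ Finset.range (j+1), (j.choose k : ℝ) := by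
    exact_mod_cast (Nat.sum_range_choose j).symm
  rw [← Finset.sum_mul, ← h2, mul_assoc]
  have := nr_nonneg s p
  have h3 : (2:ℝ)^j ≤ 2^s := pow_le_pow_right₀ (by norm_num) hj.le
  gcongr

/-- limit of sequences with bounded derivatives -/
lemma limit_lemma {z : ℕ → ℝ → ℝ} (hs : ∀ k, Sm (z k))
    (hb : ∀ s, ∃ C : ℝ, ∀ k x, |iteratedDeriv s (z k) x| ≤ C)
    (hc : ∀ ε > 0, ∃ N, ∀ k ≥ N, ∀ m ≥ N, ∀ x, |z k x - z m x| ≤ ε) :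
    ∃ Z : ℝ → ℝ, Sm Z ∧ ∀ s, ∀ ε > 0, ∃ N, ∀ k ≥ N, ∀ x,
      |iteratedDeriv s (z k) x - iteratedDeriv s Z x| ≤ ε := by
  have hev : ∀ P : ℕ × ℕ → Prop, (∃ N, ∀ k ≥ N, ∀ m ≥ N, P (k, m)) ↔
      ∀ᶠ p in (atTop : Filter (ℕ × ℕ)), P p := by
    intro P
    rw [eventually_atTop]
    constructor
    · rintro ⟨N, hN⟩; exact ⟨(N, N), fun p hp => hN _ hp.1 _ hp.2⟩
    · rintro ⟨⟨a, b⟩, h⟩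
      exact ⟨max a b, fun k hk m hm => h (k, m)
        ⟨(le_max_left _ _).trans hk, (le_max_right _ _).trans hm⟩⟩
  have eb : ∀ r, EB (⊤ : Filter ℕ) r z := fun r => ⟨hs, fun s _ => (hb s).imp fun C h => by simpa using h⟩
  have hcau : ∀ s, ∀ ε > 0, ∃ N, ∀ k ≥ N, ∀ m ≥ N, ∀ x,
      |iteratedDeriv s (z k) x - iteratedDeriv s (z m) x| ≤ ε := by
    intro s ε hε
    have e1 : EB (atTop : Filter (ℕ × ℕ)) (s+1) (fun p x => z p.1 x - z p.2 x) := by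
      refine EB.sub ⟨fun p => hs _, fun t _ => ?_⟩ ⟨fun p => hs _, fun t _ => ?_⟩
      · exact (hb t).imp fun C h => Eventually.of_forall fun p => h _
      · exact (hb t).imp fun C h => Eventually.of_forall fun p => h _
    have e2 := (e1.nl (fun ε hε => (hev _).1 (hc ε hε))).2 s le_rfl ε hε
    obtain ⟨N, hN⟩ := (hev _).2 e2
    refine ⟨N, fun k hk m hm x => ?_⟩
    have := hN k hk m hm x
    rwa [show iteratedDeriv s (fun x => z k x - z m x) x = _ from
      iteratedDeriv_sub ((hs k).at s x) ((hs m).at s x)] at this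
  have hex : ∀ s, ∃ g : ℝ → ℝ, ∀ ε > 0, ∃ N, ∀ k ≥ N, ∀ x,
      |iteratedDeriv s (z k) x - g x| ≤ ε := by
    intro s
    have : ∀ x, ∃ y, Tendsto (fun k => iteratedDeriv s (z k) x) atTop (𝓝 y) := by
      intro x
      refine cauchySeq_tendsto_of_complete (Metric.cauchySeq_iff.2 fun ε hε => ?_)
      obtain ⟨N, hN⟩ := hcau s (ε/2) (half_pos hε)
      exact ⟨N, fun k hk m hm => by
        rw [Real.dist_eq]; exact (hN k hk m hm x).trans_lt (half_lt_self hε)⟩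
    choose g hg using this
    refine ⟨g, fun ε hε => ?_⟩
    obtain ⟨N, hN⟩ := hcau s ε hε
    refine ⟨N, fun k hk x => ?_⟩
    have h1 : Tendsto (fun m => |iteratedDeriv s (z k) x - iteratedDeriv s (z m) x|) atTop
      (𝓝 |iteratedDeriv s (z k) x - g x|) := (tendsto_const_nhds.sub (hg x)).abs
    exact le_of_tendsto h1 (eventually_atTop.2 ⟨N, fun m hm => hN k hk m hm x⟩)
  choose g hg using hex
  have hU : ∀ s, TendstoUniformly (fun k => iteratedDeriv s (z k)) (g s) atTop := by
    intro s
    rw [Metric.tendstoUniformly_iff]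
    intro ε hε
    obtain ⟨N, hN⟩ := hg s (ε/2) (half_pos hε)
    refine eventually_atTop.2 ⟨N, fun k hk x => ?_⟩
    rw [dist_comm, Real.dist_eq]; exact (hN k hk x).trans_lt (half_lt_self hε)
  have hD : ∀ s x, HasDerivAt (g s) (g (s+1) x) x := fun s x =>
    hasDerivAt_of_tendstoUniformly (hU (s+1)) (Eventually.of_forall fun k x => (hs k).hd s x)
      (fun x => (hU s).tendsto_at x) x
  have hI : ∀ s, iteratedDeriv s (g 0) = g s := by
    intro s
    induction s with
    | zero => simp
    | succ s ih => rw [iteratedDeriv_succ, ih]; funext x; exact (hD s x).deriv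
  refine ⟨g 0, ?_, fun s => by rw [hI]; exact hg s⟩
  refine contDiff_of_differentiable_iteratedDeriv fun m _ => ?_
  rw [hI]; exact fun x => (hD m x).differentiableAt


lemma NN_shift {u : ℝ → ℝ} (hu : BS u) (c : ℝ) (s : ℕ) : NN s (fun x => u (x + c)) ≤ NN s u :=
  NN_le fun x => by rw [iteratedDeriv_comp_add_const]; exact hu.le s _
lemma nr_shift {u : ℝ → ℝ} (hu : BS u) (c : ℝ) (s : ℕ) : nr s (fun x => u (x + c)) ≤ nr s u :=
  Finset.sum_le_sum fun j _ => NN_shift hu c j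
lemma BS.shift {u : ℝ → ℝ} (hu : BS u) (c : ℝ) : BS (fun x => u (x + c)) := by
  simpa using hu.affine 1 c

def gam (φ : ℝ → ℝ) : ℕ → ℝ → ℝ
  | 0 => fun _ => 0
  | j+1 => fun x => gam φ j x + φ (x + gam φ j x + (-j))

lemma gam_BS {φ : ℝ → ℝ} (h : BS φ) (j : ℕ) : BS (gam φ j) := by
  induction j with
  | zero => exact BS.cst 0
  | succ j ih => exact ih.add ((h.shift (-j)).comp1 ih)

lemma NN_zero (s : ℕ) : NN s (fun _ => (0:ℝ)) = 0 := by
  unfold NN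
  have : ∀ x : ℝ, |iteratedDeriv s (fun _ : ℝ => (0:ℝ)) x| = 0 := fun x => by
    simp [iteratedDeriv_const]
  simp only [this]; simp
lemma nr_zero (s : ℕ) : nr s (fun _ => (0:ℝ)) = 0 := by
  unfold nr; exact Finset.sum_eq_zero fun j _ => NN_zero j

lemma gam_soft (s : ℕ) (M : ℝ) (n : ℕ) : ∃ C ≥ 0, ∀ φ, BS φ → nr s φ ≤ M → ∀ j ≤ n,
    nr s (gam φ j) ≤ C * nr s φ := by
  induction n with
  | zero =>
    refine ⟨0, le_rfl, fun φ _ _ j hj => ?_⟩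
    obtain rfl : j = 0 := by omega
    simp [gam, nr_zero]
  | succ n ih =>
    obtain ⟨C, hC, h⟩ := ih
    obtain ⟨D, hD, hs⟩ := soft s (C * |M|)
    refine ⟨C + D, by positivity, fun φ hφ hM j hj => ?_⟩
    have p := nr_nonneg s φ
    rcases Nat.lt_or_ge j (n+1) with hj' | hj'
    · refine (h φ hφ hM j (by omega)).trans ?_; gcongr; linarith
    · obtain rfl : j = n + 1 := by omega
      have h1 := h φ hφ hM n le_rfl
      have h2 := hs _ _ (hφ.shift (-n)) (gam_BS hφ n)
        (h1.trans (mul_le_mul_of_nonneg_left (hM.trans (le_abs_self _)) hC))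
      have h3 := nr_add (gam_BS hφ n) ((hφ.shift (-n)).comp1 (gam_BS hφ n)) s
      have h4 := mul_le_mul_of_nonneg_left (nr_shift hφ (-n) s) hD
      calc _ ≤ _ := h3
        _ ≤ C * nr s φ + D * nr s φ := add_le_add h1 (h2.trans h4)
        _ = _ := by ring

lemma gam1 {φ : ℝ → ℝ} (hφ : BS φ) (j : ℕ) : 1 + NN 1 (gam φ j) ≤ (1 + NN 1 φ)^j := by
  induction j with
  | zero => simp [gam, NN_zero]
  | succ j ih =>
    have h1 := NN_add (gam_BS hφ j) ((hφ.shift (-j)).comp1 (gam_BS hφ j)) 1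
    have h2 := NN1_comp (hφ.shift (-j)) (gam_BS hφ j)
    have h3 := NN_shift hφ (-j) 1
    have p := NN_nonneg 1 φ
    have q := NN_nonneg 1 (gam φ j)
    have h4 := mul_le_mul_of_nonneg_left h3 (show 0 ≤ 1 + NN 1 (gam φ j) by linarith)
    rw [pow_succ]
    have h5 := mul_le_mul_of_nonneg_right ih (show 0 ≤ 1 + NN 1 φ by linarith)
    have h6 : NN 1 (gam φ (j+1)) ≤ NN 1 (gam φ j) + (1 + NN 1 (gam φ j)) * NN 1 φ := by
      refine h1.trans ?_; linarith
    linarith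

lemma gam_sharp (s : ℕ) (M : ℝ) (n : ℕ) : ∃ C ≥ 0, ∀ φ, BS φ → nr (s+2) φ ≤ M →
    (1 + NN 1 φ)^n ≤ 2 →
    NN (s+2) (gam φ n) ≤ 2 * n * (2^(s+2) * NN (s+2) φ + C * nr (s+2) φ ^ 2) := by
  obtain ⟨C, hC, h⟩ := gam_soft (s+2) M n
  obtain ⟨D, hD, hs⟩ := Psharp s (C * |M|)
  refine ⟨D * C, by positivity, fun φ hφ hM h2 => ?_⟩
  have p := NN_nonneg 1 φ
  have p1 : 1 ≤ 1 + NN 1 φ := by linarith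
  set Q := 2^(s+2) * NN (s+2) φ + D * C * nr (s+2) φ ^ 2 with hQ
  have q0 := NN_nonneg (s+2) φ
  have q1 := nr_nonneg (s+2) φ
  have Q0 : 0 ≤ Q := by positivity
  have key : ∀ j ≤ n, NN (s+2) (gam φ j) ≤ (1 + NN 1 φ)^j * (j * Q) := by
    intro j
    induction j with
    | zero => intro _; simp [gam, NN_zero]
    | succ j ih =>
      intro hj
      have ih := ih (by omega)
      have hb := gam_BS hφ j
      have h3 := h φ hφ hM j (by omega)
      have h4 := hs _ _ (hφ.shift (-j)) hb
        (h3.trans (mul_le_mul_of_nonneg_left (hM.trans (le_abs_self _)) hC))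
      have h5 := NN_add hb ((hφ.shift (-j)).comp1 hb) (s+2)
      have h6 : (1 + NN 1 (gam φ j))^(s+2) ≤ 2^(s+2) := by
        refine pow_le_pow_left₀ (by linarith [NN_nonneg 1 (gam φ j)]) ?_ _
        exact ((gam1 hφ j).trans (pow_le_pow_right₀ p1 (by omega))).trans h2
      have h7 : (1 + NN 1 (gam φ j))^(s+2) * NN (s+2) (fun x => φ (x + (-j))) ≤
          2^(s+2) * NN (s+2) φ := mul_le_mul h6 (NN_shift hφ _ _) (NN_nonneg _ _) (by positivity)
      have h8 := mul_le_mul_of_nonneg_right (NN_shift hφ (-j) 1) (NN_nonneg (s+2) (gam φ j))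
      have h9 : nr (s+2) (fun x => φ (x + (-j))) * nr (s+2) (gam φ j) ≤
          nr (s+2) φ * (C * nr (s+2) φ) := mul_le_mul (nr_shift hφ _ _) h3 (nr_nonneg _ _) q1
      have h10 := mul_le_mul_of_nonneg_left h9 hD
      have h11 : NN (s+2) (gam φ (j+1)) ≤ (1 + NN 1 φ) * NN (s+2) (gam φ j) + Q := by
        refine h5.trans ?_; rw [hQ]; nlinarith
      refine h11.trans ?_
      have h12 := mul_le_mul_of_nonneg_left ih (show 0 ≤ 1 + NN 1 φ by linarith)
      have h13 : Q ≤ (1 + NN 1 φ)^(j+1) * Q := le_mul_of_one_le_left Q0 (one_le_pow₀ p1)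
      push_cast
      rw [pow_succ] at *
      nlinarith
  refine (key n le_rfl).trans ?_
  rw [mul_assoc]
  exact mul_le_mul_of_nonneg_right h2 (by positivity)

lemma gam_diff_soft (n : ℕ) (M : ℝ) : ∃ C ≥ 0, ∀ φ ψ, BS φ → BS ψ → nr 5 φ ≤ M → nr 5 ψ ≤ M →
    ∀ j ≤ n, nr 4 (fun x => gam φ j x - gam ψ j x) ≤ C * nr 4 (fun x => φ x - ψ x) := by
  obtain ⟨C, hC, h⟩ := gam_soft 4 M n
  obtain ⟨D, hD, hs⟩ := soft 4 (C * |M|)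
  obtain ⟨E, hE, hd⟩ := nr_diff 4 (C * |M|)
  have key : ∀ m ≤ n, ∃ K ≥ 0, ∀ φ ψ, BS φ → BS ψ → nr 5 φ ≤ M → nr 5 ψ ≤ M →
      nr 4 (fun x => gam φ m x - gam ψ m x) ≤ K * nr 4 (fun x => φ x - ψ x) := by
    intro m
    induction m with
    | zero => intro _; exact ⟨0, le_rfl, fun φ ψ _ _ _ _ => by simp [gam, nr_zero]⟩
    | succ m ih =>
      intro hm
      obtain ⟨K, hK, hk⟩ := ih (by omega)
      refine ⟨K + E * (|M| * K) + D, by positivity, fun φ ψ hφ hψ h1 h2 => ?_⟩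
      have b1 := gam_BS hφ m
      have b2 := gam_BS hψ m
      have c1 := hφ.shift (-m)
      have c2 := hψ.shift (-m)
      have m1 : nr 4 φ ≤ M := (nr_mono (by norm_num) φ).trans h1
      have m2 : nr 4 ψ ≤ M := (nr_mono (by norm_num) ψ).trans h2
      have v1 := (h φ hφ m1 m (by omega)).trans
        (mul_le_mul_of_nonneg_left (m1.trans (le_abs_self _)) hC)
      have v2 := (h ψ hψ m2 m (by omega)).trans
        (mul_le_mul_of_nonneg_left (m2.trans (le_abs_self _)) hC)
      have k1 := hk φ ψ hφ hψ h1 h2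
      have d1 := hd _ _ _ c1 b1 b2 v1 v2
      have s1 := hs _ _ (c1.sub c2) b2 v2
      have e : (fun x => gam φ (m+1) x - gam ψ (m+1) x) = fun x =>
          ((gam φ m x - gam ψ m x) + (φ (x + gam φ m x + (-m)) - φ (x + gam ψ m x + (-m))))
          + (φ (x + gam ψ m x + (-m)) - ψ (x + gam ψ m x + (-m))) := by
        funext x; simp only [gam]; ring
      rw [e]
      have t1 := nr_add ((b1.sub b2).add ((c1.comp1 b1).sub (c1.comp1 b2)))
        ((c1.sub c2).comp1 b2) 4
      have t2 := nr_add (b1.sub b2) ((c1.comp1 b1).sub (c1.comp1 b2)) 4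
      have sh := nr_shift (hφ.sub hψ) (-m) 4
      set δ := nr 4 (fun x => φ x - ψ x)
      have δ0 : 0 ≤ δ := nr_nonneg _ _
      have d2 : nr 5 (fun x => φ (x + (-m))) * nr 4 (fun x => gam φ m x - gam ψ m x) ≤
          |M| * (K * δ) := mul_le_mul ((nr_shift hφ _ _).trans (h1.trans (le_abs_self _))) k1
            (nr_nonneg _ _) (abs_nonneg _)
      have d3 := mul_le_mul_of_nonneg_left d2 hE
      have s2 := mul_le_mul_of_nonneg_left sh hD
      calc _ ≤ _ := t1
        _ ≤ K * δ + E * (|M| * (K * δ)) + D * δ := by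
          refine add_le_add (t2.trans (add_le_add k1 (d1.trans d3))) (s1.trans s2)
        _ = _ := by ring
  choose! K hK hk using key
  refine ⟨∑ j ∈ Finset.range (n+1), K j, Finset.sum_nonneg fun j hj =>
    hK j (by have := Finset.mem_range.1 hj; omega), fun φ ψ hφ hψ h1 h2 j hj => ?_⟩
  refine (hk j hj φ ψ hφ hψ h1 h2).trans (mul_le_mul_of_nonneg_right ?_ (nr_nonneg _ _))
  exact Finset.single_le_sum (f := K) (fun j hj =>
    hK j (by have := Finset.mem_range.1 hj; omega)) (Finset.mem_range.2 (by omega))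

lemma gam_diff (n : ℕ) (M : ℝ) : ∃ C ≥ 0, ∀ φ ψ, BS φ → BS ψ → nr 5 φ ≤ M → nr 5 ψ ≤ M →
    (1 + NN 1 ψ)^n ≤ 2 →
    NN 3 (fun x => gam φ n x - gam ψ n x) ≤ n * (8 * NN 3 (fun x => φ x - ψ x) +
      C * ((nr 5 φ + nr 5 ψ) * nr 4 (fun x => φ x - ψ x))) := by
  obtain ⟨C, hC, h⟩ := gam_soft 4 M n
  obtain ⟨D, hD, hs⟩ := Psharp 1 (C * |M|)
  obtain ⟨E, hE, hd⟩ := nr_diff 4 (C * |M|)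
  obtain ⟨K, hK, hk⟩ := gam_diff_soft n M
  refine ⟨E * K + C + D * C, by positivity, fun φ ψ hφ hψ h1 h2 hp => ?_⟩
  set δ := nr 4 (fun x => φ x - ψ x) with hδ
  have δ0 : 0 ≤ δ := nr_nonneg _ _
  have p1 : 1 ≤ 1 + NN 1 ψ := by linarith [NN_nonneg 1 ψ]
  set Q := 8 * NN 3 (fun x => φ x - ψ x) + (E * K + C + D * C) * ((nr 5 φ + nr 5 ψ) * δ) with hQ
  have key : ∀ m ≤ n, NN 3 (fun x => gam φ m x - gam ψ m x) ≤ m * Q := by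
    intro m
    induction m with
    | zero => intro _; simp [gam, NN_zero]
    | succ m ih =>
      intro hm
      have ih := ih (by omega)
      have b1 := gam_BS hφ m
      have b2 := gam_BS hψ m
      have c1 := hφ.shift (-m)
      have c2 := hψ.shift (-m)
      have m1 : nr 4 φ ≤ M := (nr_mono (by norm_num) φ).trans h1
      have m2 : nr 4 ψ ≤ M := (nr_mono (by norm_num) ψ).trans h2
      have v1 := (h φ hφ m1 m (by omega)).trans
        (mul_le_mul_of_nonneg_left (m1.trans (le_abs_self _)) hC)
      have w2 := h ψ hψ m2 m (by omega)
      have v2 := w2.trans (mul_le_mul_of_nonneg_left (m2.trans (le_abs_self _)) hC)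
      have k1 := hk φ ψ hφ hψ h1 h2 m (by omega)
      have d1 := hd _ _ _ c1 b1 b2 v1 v2
      have s1 := hs _ _ (c1.sub c2) b2 ((nr_mono (by norm_num) _).trans v2)
      have e : (fun x => gam φ (m+1) x - gam ψ (m+1) x) = fun x =>
          ((gam φ m x - gam ψ m x) + (φ (x + gam φ m x + (-m)) - φ (x + gam ψ m x + (-m))))
          + (φ (x + gam ψ m x + (-m)) - ψ (x + gam ψ m x + (-m))) := by
        funext x; simp only [gam]; ring
      rw [e]
      have t1 := NN_add ((b1.sub b2).add ((c1.comp1 b1).sub (c1.comp1 b2)))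
        ((c1.sub c2).comp1 b2) 3
      have t2 := NN_add (b1.sub b2) ((c1.comp1 b1).sub (c1.comp1 b2)) 3
      have w3 : nr 4 (gam ψ m) ≤ C * nr 5 ψ :=
        w2.trans (mul_le_mul_of_nonneg_left (nr_mono (by norm_num) ψ) hC)
      have p5 := nr_nonneg 5 φ
      have p6 := nr_nonneg 5 ψ
      have d2 : nr 5 (fun x => φ (x + (-m))) * nr 4 (fun x => gam φ m x - gam ψ m x) ≤
          nr 5 φ * (K * δ) := mul_le_mul (nr_shift hφ _ _) k1 (nr_nonneg _ _) p5
      have d3 := ((NN_le_nr (by norm_num : 3 < 4) _).trans d1).trans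
        (mul_le_mul_of_nonneg_left d2 hE)
      have h6 : (1 + NN 1 (gam ψ m))^3 ≤ 8 := by
        have := pow_le_pow_left₀ (by linarith [NN_nonneg 1 (gam ψ m)])
          (((gam1 hψ m).trans (pow_le_pow_right₀ p1 (by omega : m ≤ n))).trans hp) 3
        norm_num at this ⊢; exact this
      have h7 : (1 + NN 1 (gam ψ m))^3 * NN 3 (fun x => φ (x + (-m)) - ψ (x + (-m))) ≤
        8 * NN 3 (fun x => φ x - ψ x) := mul_le_mul h6 (NN_shift (hφ.sub hψ) _ _)
          (NN_nonneg _ _) (by norm_num)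
      have h8 : NN 1 (fun x => φ (x + (-m)) - ψ (x + (-m))) * NN 3 (gam ψ m) ≤
          δ * (C * nr 5 ψ) := mul_le_mul ((NN_shift (hφ.sub hψ) _ _).trans
            (NN_le_nr (by norm_num) _)) ((NN_le_nr (by norm_num) _).trans w3) (NN_nonneg _ _) δ0
      have h9 : nr 3 (fun x => φ (x + (-m)) - ψ (x + (-m))) * nr 3 (gam ψ m) ≤
          δ * (C * nr 5 ψ) := mul_le_mul ((nr_shift (hφ.sub hψ) _ _).trans
            (nr_mono (by norm_num) _)) ((nr_mono (by norm_num) _).trans w3) (nr_nonneg _ _) δ0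
      have h10 := mul_le_mul_of_nonneg_left h9 hD
      have x1 : 0 ≤ E * K * (nr 5 ψ * δ) := by positivity
      have x2 : 0 ≤ C * (nr 5 φ * δ) := by positivity
      have x3 : 0 ≤ D * C * (nr 5 φ * δ) := by positivity
      norm_num at s1
      have f1 := s1.trans (add_le_add (add_le_add h7 h8) h10)
      have f2 := t1.trans (add_le_add (t2.trans (add_le_add ih d3)) f1)
      push_cast
      refine f2.trans ?_
      rw [hQ]; nlinarith
  exact key n le_rfl


lemma gam_succ (φ : ℝ → ℝ) (n : ℕ) (x : ℝ) :
    gam φ (n+1) x = gam φ n x + φ (x + gam φ n x + (-n)) := rfl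
lemma gam_shift (φ : ℝ → ℝ) (n : ℕ) (x : ℝ) : gam φ (n+1) x = φ x + gam φ n (x + φ x - 1) := by
  induction n with
  | zero => simp [gam]
  | succ n ih =>
    rw [gam_succ, ih, gam_succ]; push_cast
    rw [show x + (φ x + gam φ n (x + φ x - 1)) + -((n:ℝ)+1) =
      x + φ x - 1 + gam φ n (x + φ x - 1) + -(n:ℝ) by ring]; ring

lemma gam_desc {φ : ℝ → ℝ} (h : ∀ x, |φ x| ≤ 1/2) (n : ℕ) (x : ℝ) :
    x + gam φ n x - n ≤ x - n / 2 := by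
  induction n with
  | zero => simp [gam]
  | succ n ih =>
    rw [gam]; push_cast
    linarith [(abs_le.1 (h (x + gam φ n x + -(n:ℝ)))).2]

lemma gam_fix {φ : ℝ → ℝ} {A : ℕ} (h : ∀ x, |φ x| ≤ 1/2) (hz : ∀ x, (A:ℝ) ≤ |x| → φ x = 0)
    {x : ℝ} (hx : x ≤ A + 16) :
    gam φ (4*A+34) x = φ x + gam φ (4*A+34) (x + φ x - 1) := by
  rw [← gam_shift, gam_succ φ (4*A+34), hz, add_zero]
  have := gam_desc h (4*A+34) x
  push_cast at this ⊢
  rw [abs_of_neg] <;> linarith [(Nat.cast_nonneg A : (0:ℝ) ≤ A)]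

lemma gam_left {φ : ℝ → ℝ} {A : ℕ} (hz : ∀ x, (A:ℝ) ≤ |x| → φ x = 0)
    {x : ℝ} (hx : x ≤ -A) (n : ℕ) : gam φ n x = 0 := by
  induction n with
  | zero => rfl
  | succ n ih =>
    rw [gam_succ, ih, hz, add_zero]
    rw [abs_of_nonpos] <;> linarith [(Nat.cast_nonneg A : (0:ℝ) ≤ A), (Nat.cast_nonneg n : (0:ℝ) ≤ n)]

def PP (e z : ℝ → ℝ) (x : ℝ) : ℝ := e x + z (x + e x)
def ph (A : ℕ) (e z : ℝ → ℝ) (x : ℝ) : ℝ := A * PP e z ((A:ℝ)⁻¹ * x)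
def Ga (A : ℕ) (e z : ℝ → ℝ) (x : ℝ) : ℝ := gam (ph A e z) (4*A+34) (x + (A+8))
def Zn (Γ z : ℝ → ℝ) (x : ℝ) : ℝ := rt x * (Γ x - Γ 0) - rt1 (x + z x) * (Γ (x + z x) - Γ 0)
/-- support in the unit interval -/
def S1p (u : ℝ → ℝ) : Prop := ∀ x, 1 ≤ |x| → u x = 0

section
variable {e z : ℝ → ℝ} {A : ℕ}
lemma PP_BS (he : BS e) (hz : BS z) : BS (PP e z) := he.add (hz.comp1 he)
lemma ph_BS (he : BS e) (hz : BS z) : BS (ph A e z) := by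
  have := ((PP_BS he hz).affine (A:ℝ)⁻¹ 0).cmul (A:ℝ)
  simp only [add_zero] at this; exact this
lemma Ga_BS (he : BS e) (hz : BS z) : BS (Ga A e z) := (gam_BS (ph_BS he hz) _).shift _
lemma Gw_BS (he : BS e) (hz : BS z) : BS (fun x => Ga A e z x - Ga A e z 0) :=
  (Ga_BS he hz).sub (BS.cst _)
lemma Zn_BS (he : BS e) (hz : BS z) : BS (Zn (Ga A e z) z) :=
  (rt_BS.mul (Gw_BS he hz)).sub ((rt1_BS.mul (Gw_BS he hz)).comp1 hz)

lemma PP_S (he : S1p e) (hz : S1p z) : S1p (PP e z) := fun x hx => by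
  rw [PP, he x hx, add_zero, hz x hx, add_zero]
lemma ph_S (hA : 1 ≤ A) (he : S1p e) (hz : S1p z) (x : ℝ) (hx : (A:ℝ) ≤ |x|) : ph A e z x = 0 := by
  have : (0:ℝ) < A := by exact_mod_cast hA
  rw [ph, PP_S he hz, mul_zero]
  rw [abs_mul, abs_inv, abs_of_pos this, inv_mul_eq_div, one_le_div this]; exact hx

lemma rt_eq {x : ℝ} (h : 1 ≤ x) : rt x = rt1 x := by rw [rt, rt1, st1 (by linarith), st1 h]
lemma Zn_S (Γ : ℝ → ℝ) (hz : S1p z) : S1p (Zn Γ z) := fun x hx => by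
  rw [Zn, hz x hx, add_zero]
  rcases le_abs.1 hx with h | h
  · rw [rt_eq h, sub_self]
  · rw [rt, rt1, st0 (by linarith), st0 (by linarith)]; simp

lemma ph_NN (he : BS e) (hz : BS z) (s : ℕ) :
    NN s (ph A e z) ≤ A * ((A:ℝ)⁻¹)^s * NN s (PP e z) := NN_le fun x => by
  have hs : ContDiff ℝ s (PP e z) := (PP_BS he hz).sm.of_le (by exact_mod_cast le_top)
  have h1 : iteratedDeriv s (ph A e z) x =
      A * (((A:ℝ)⁻¹)^s * iteratedDeriv s (PP e z) ((A:ℝ)⁻¹ * x)) := by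
    unfold ph
    rw [iteratedDeriv_const_mul_field, iteratedDeriv_comp_const_mul hs]
  rw [h1, abs_mul, abs_mul, abs_of_nonneg (by positivity : (0:ℝ) ≤ A),
    abs_of_nonneg (by positivity : (0:ℝ) ≤ ((A:ℝ)⁻¹)^s), mul_assoc]
  gcongr
  exact (PP_BS he hz).le s _
lemma ph_NN' (hA : 1 ≤ A) (he : BS e) (hz : BS z) (s : ℕ) :
    NN s (ph A e z) ≤ A * NN s (PP e z) := by
  refine (ph_NN he hz s).trans (mul_le_mul_of_nonneg_right ?_ (NN_nonneg _ _))
  refine mul_le_of_le_one_right (by positivity) (pow_le_one₀ (by positivity) ?_)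
  exact inv_le_one_of_one_le₀ (by exact_mod_cast hA)
lemma ph_nr (hA : 1 ≤ A) (he : BS e) (hz : BS z) (s : ℕ) :
    nr s (ph A e z) ≤ A * nr s (PP e z) := by
  unfold nr; rw [Finset.mul_sum]; exact Finset.sum_le_sum fun j _ => ph_NN' hA he hz j
lemma PP_1 (he : BS e) (hz : BS z) {η : ℝ} (hη : η ≤ 1) (h1 : NN 1 e ≤ η) (h2 : NN 1 z ≤ η) :
    NN 1 (PP e z) ≤ 3 * η := by
  have := NN_add he (hz.comp1 he) 1
  have h3 := NN1_comp hz he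
  have h4 : (1 + NN 1 e) * NN 1 z ≤ 2 * η :=
    mul_le_mul (by linarith) h2 (NN_nonneg _ _) (by norm_num)
  unfold PP; linarith
end

lemma PP_nr (s : ℕ) (M : ℝ) : ∃ C ≥ 0, ∀ e z, BS e → BS z → nr s e ≤ M →
    nr s (PP e z) ≤ C * (nr s e + nr s z) := by
  obtain ⟨C, hC, h⟩ := soft s M
  refine ⟨1 + C, by positivity, fun e z he hz hM => ?_⟩
  have h1 := nr_add he (hz.comp1 he) s
  have h2 := h z e hz he hM
  have := nr_nonneg s e; have := nr_nonneg s z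
  unfold PP; nlinarith

lemma Ga_soft (A s : ℕ) (hA : 1 ≤ A) (M : ℝ) : ∃ C ≥ 0, ∀ e z, BS e → BS z → nr s e ≤ M → nr s z ≤ M →
    nr s (Ga A e z) ≤ C * (nr s e + nr s z) := by
  obtain ⟨C, hC, h⟩ := PP_nr s M
  obtain ⟨D, hD, h'⟩ := gam_soft s (A * (C * (M + M))) (4*A+34)
  refine ⟨D * (A * C), by positivity, fun e z he hz h1 h2 => ?_⟩
  have h3 := (ph_nr hA he hz s).trans (mul_le_mul_of_nonneg_left (h e z he hz h1) (by positivity))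
  have h4 := h' _ (ph_BS he hz) (h3.trans (by gcongr)) _ le_rfl
  refine (nr_shift (gam_BS (ph_BS he hz) _) _ s).trans (h4.trans ?_)
  refine (mul_le_mul_of_nonneg_left h3 hD).trans (le_of_eq (by ring))

lemma Ga_top (A s : ℕ) (hA : 1 ≤ A) (M : ℝ) : ∃ C ≥ 0, ∀ e z, BS e → BS z → nr (s+2) e ≤ M →
    nr (s+2) z ≤ M → NN 1 e ≤ 1 → (1 + NN 1 (ph A e z))^(4*A+34) ≤ 2 →
    NN (s+2) (Ga A e z) ≤ 2 * (4*A+34) * 4^(s+2) * (A * ((A:ℝ)⁻¹)^(s+2)) * NN (s+2) z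
      + C * NN (s+2) e + C * (nr (s+2) e + nr (s+2) z)^2 := by
  obtain ⟨C, hC, h⟩ := PP_nr (s+2) M
  obtain ⟨D, hD, h'⟩ := gam_sharp s (A * (C * (M + M))) (4*A+34)
  obtain ⟨E, hE, hs⟩ := Psharp s M
  set n : ℝ := 4*A+34 with hn
  have n0 : 0 ≤ n := by positivity
  set q : ℝ := A * ((A:ℝ)⁻¹)^(s+2) with hq
  have q0 : 0 ≤ q := by positivity
  set C1 := 2 * n * 2^(s+2) * q * (1 + |M|)
  set C2 := 2 * n * 2^(s+2) * q * E + 2 * n * D * (A * C)^2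
  have p1 : 0 ≤ C1 := by positivity
  have p2 : 0 ≤ C2 := by positivity
  refine ⟨C1 + C2, by positivity, fun e z he hz h1 h2 h3 h4 => ?_⟩
  have b := ph_BS (A := A) he hz
  have k1 := (ph_nr hA he hz (s+2)).trans
    (mul_le_mul_of_nonneg_left (h e z he hz h1) (by positivity))
  have k2 := h' _ b (k1.trans (by gcongr)) h4
  have k3 := NN_shift (gam_BS b (4*A+34)) (A+8) (s+2)
  have k4 := ph_NN (A := A) he hz (s+2)
  have k5 := NN_add he (hz.comp1 he) (s+2)
  have k6 := hs z e hz he h1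
  have ez : nr (s+2) z * nr (s+2) e ≤ (nr (s+2) e + nr (s+2) z)^2 := by
    nlinarith [nr_nonneg (s+2) e, nr_nonneg (s+2) z]
  have k7 : (1 + NN 1 e)^(s+2) ≤ 2^(s+2) := pow_le_pow_left₀ (by linarith [NN_nonneg 1 e]) (by linarith) _
  have k8 := mul_le_mul_of_nonneg_right k7 (NN_nonneg (s+2) z)
  have k9 : NN 1 z * NN (s+2) e ≤ |M| * NN (s+2) e := mul_le_mul_of_nonneg_right
    ((NN_le_nr (by omega) z).trans (h2.trans (le_abs_self _))) (NN_nonneg _ _)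
  have k10 := mul_le_mul_of_nonneg_left ez hE
  set X := (nr (s+2) e + nr (s+2) z)^2
  have k11 : NN (s+2) (PP e z) ≤ 2^(s+2) * NN (s+2) z + (1+|M|) * NN (s+2) e + E * X := by
    unfold PP; linarith
  have k12 := k4.trans (mul_le_mul_of_nonneg_left k11 q0)
  have k13 : nr (s+2) (ph A e z)^2 ≤ (A * C)^2 * X := by
    have := pow_le_pow_left₀ (nr_nonneg _ _) k1 2
    rw [← mul_assoc, mul_pow] at this; exact this
  have k14 := mul_le_mul_of_nonneg_left k13 hD
  have k15 := mul_le_mul_of_nonneg_left k12 (show (0:ℝ) ≤ 2^(s+2) by positivity)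
  have k16 := mul_le_mul_of_nonneg_left (add_le_add k15 k14) (show 0 ≤ 2 * n by positivity)
  have k17 : NN (s+2) (Ga A e z) ≤ _ := k3.trans k2
  have : ((4*A+34 : ℕ) : ℝ) = n := by push_cast; rfl
  rw [this] at k17
  refine (k17.trans k16).trans ?_
  have x1 := mul_nonneg p2 (NN_nonneg (s+2) e)
  have x2 : 0 ≤ C1 * X := by positivity
  have e4 : (4:ℝ)^(s+2) = 2^(s+2) * 2^(s+2) := by rw [← mul_pow]; norm_num
  rw [e4]
  have e5 : 2 * n * (2^(s+2) * (q * (2^(s+2) * NN (s+2) z + (1+|M|) * NN (s+2) e + E * X)) +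
    D * ((A * C)^2 * X)) = 2 * n * (2^(s+2) * 2^(s+2)) * q * NN (s+2) z + C1 * NN (s+2) e + C2 * X := by
    simp only [C1, C2]; ring
  rw [e5]; linarith


structure OK (A : ℕ) (η : ℝ) (a b : ℝ → ℝ) : Prop where
  e : BS a
  z : BS b
  se : S1p a
  sz : S1p b
  ne : nr 5 a ≤ η
  nz : nr 5 b ≤ η

structure CD (A : ℕ) (η : ℝ) : Prop where
  A1 : 1000 ≤ A
  p : 0 < η
  le : η ≤ 1
  pw : (1 + 3 * η)^(4*A+34) ≤ 2
  sm : 2 * A * η ≤ 1/2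

lemma OK.ph1 {A : ℕ} {η : ℝ} {e z : ℝ → ℝ} (c : CD A η) (h : OK A η e z) :
    (1 + NN 1 (ph A e z))^(4*A+34) ≤ 2 := by
  refine le_trans (pow_le_pow_left₀ (by linarith [NN_nonneg 1 (ph A e z)]) ?_ _) c.pw
  have h1 := ph_NN (A := A) h.e h.z 1
  have : (A:ℝ) ≠ 0 := by have := c.A1; positivity
  rw [pow_one, mul_inv_cancel₀ this, one_mul] at h1
  have := PP_1 h.e h.z c.le ((NN_le_nr (by norm_num) e).trans h.ne)
    ((NN_le_nr (by norm_num) z).trans h.nz)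
  linarith

lemma OK.phb {A : ℕ} {η : ℝ} {e z : ℝ → ℝ} (c : CD A η) (h : OK A η e z) (x : ℝ) :
    |ph A e z x| ≤ 1/2 := by
  refine le_trans ?_ c.sm
  rw [ph, PP, abs_mul, Nat.abs_cast, mul_comm 2, mul_assoc]
  have h1 := (h.e.le0 ((A:ℝ)⁻¹ * x)).trans ((NN_le_nr (by norm_num) e).trans h.ne)
  have h2 := (h.z.le0 ((A:ℝ)⁻¹ * x + e ((A:ℝ)⁻¹ * x))).trans ((NN_le_nr (by norm_num) z).trans h.nz)
  gcongr
  refine (abs_add_le _ _).trans (by linarith)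

lemma OK.per {A : ℕ} {η : ℝ} {e z : ℝ → ℝ} (c : CD A η) (h : OK A η e z) {x : ℝ}
    (h1 : -8 ≤ x) (h2 : x ≤ 8) : Ga A e z x = Ga A e z (x - 1) := by
  have z := ph_S (A := A) (by have := c.A1; omega) h.se h.sz
  unfold Ga
  rw [gam_fix (h.phb c) z (by linarith), z (x + (A+8)) (by rw [abs_of_nonneg] <;> linarith [(Nat.cast_nonneg A : (0:ℝ) ≤ A)])]
  ring_nf

lemma cutl (s : ℕ) : ∃ K ≥ 0, ∀ w, BS w → w 0 = 0 → (∀ x, |x| < 1/2 → w (x+1) = w x) →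
    nr (s+1) (fun x => rt x * w x) ≤ K * NN s w ∧ nr (s+1) (fun x => rt1 x * w x) ≤ K * NN s w := by
  obtain ⟨C, hC, h⟩ := locMul rt_BS (fun _ => rt_z) (s+1)
  obtain ⟨D, hD, h'⟩ := locMul rt1_BS (fun _ => rt1_z) (s+1)
  refine ⟨(C + D) * 3^s, by positivity, fun w hw h0 hp => ?_⟩
  have n0 := NN_nonneg s w
  have key : ∀ j < s+1, ∀ x, |x| ≤ 2 → |iteratedDeriv j w x| ≤ 3^s * NN s w := by
    intro j hj x hx
    refine (poincare hw.sm h0 hp (hw.le s) (s-j) j (by omega) x hx).trans ?_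
    gcongr
    · norm_num
    · omega
  have p : 0 ≤ 3^s * NN s w := by positivity
  constructor
  · refine (h w _ hw key).trans ?_; nlinarith
  · refine (h' w _ hw key).trans ?_; nlinarith

lemma NN_subc {u : ℝ → ℝ} (hu : BS u) (c : ℝ) {s : ℕ} (hs : 0 < s) :
    NN s (fun x => u x - c) ≤ NN s u := by
  refine (NN_sub hu (BS.cst c) s).trans ?_
  have : NN s (fun _ : ℝ => c) ≤ 0 := NN_le fun x => by
    simp [iteratedDeriv_const, hs.ne']
  linarith

lemma ev_small (c : ℝ) {d : ℝ} (hd : 0 < d) : ∀ᶠ η in 𝓝[>] (0:ℝ), c * η ≤ d := by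
  have : Tendsto (fun η : ℝ => c * η) (𝓝 0) (𝓝 (c * 0)) := (continuous_const_mul c).tendsto 0
  rw [mul_zero] at this
  exact ((this.eventually (gt_mem_nhds hd)).mono fun _ h => h.le).filter_mono nhdsWithin_le_nhds

set_option maxHeartbeats 1000000 in
lemma core : ∃ (A : ℕ) (η : ℝ), CD A η ∧ ∃ C ≥ 0,
    (∀ e z, OK A η e z → nr 5 (Zn (Ga A e z) z) ≤ 1/2 * nr 5 z + C * nr 5 e ∧
      nr 5 (fun x => rt1 x * (Ga A e z x - Ga A e z 0)) ≤ 1/4) ∧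
    (∀ e z₁ z₂, OK A η e z₁ → OK A η e z₂ → nr 4 (fun x => Zn (Ga A e z₁) z₁ x - Zn (Ga A e z₂) z₂ x)
      ≤ 1/2 * nr 4 (fun x => z₁ x - z₂ x)) := by
  obtain ⟨K, hK, cut4⟩ := cutl 4
  obtain ⟨K3, hK3, cut3⟩ := cutl 3
  obtain ⟨S5, hS5, soft5⟩ := soft 5 1
  obtain ⟨S4, hS4, soft4⟩ := soft 4 1
  obtain ⟨N4, hN4, diff4⟩ := nr_diff 4 1
  obtain ⟨A, hA⟩ := exists_nat_ge (1000 + 10240 * (K * (1 + S5)) + 320 * (K3 * (1 + S4) * S4))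
  have q1 : 0 ≤ K * (1 + S5) := by positivity
  have q2 : 0 ≤ K3 * (1 + S4) * S4 := by positivity
  have A3 : (1000:ℝ) ≤ A := by linarith
  have A3n : 1000 ≤ A := by exact_mod_cast A3
  have A0 : (0:ℝ) < A := by linarith
  have hn : (4*A+34 : ℝ) ≤ 5 * A := by linarith
  obtain ⟨G, hG, top⟩ := Ga_top A 2 (by omega) 1
  obtain ⟨P, hP, ppn⟩ := PP_nr 5 1
  obtain ⟨D, hD, gd⟩ := gam_diff (4*A+34) (A * (P * 2))
  have ev1 : ∀ᶠ η in 𝓝[>] (0:ℝ), (1 + 3 * η)^(4*A+34) ≤ 2 := by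
    have : Tendsto (fun η : ℝ => (1 + 3 * η)^(4*A+34)) (𝓝 0) (𝓝 ((1 + 3*0)^(4*A+34))) :=
      Continuous.tendsto (by fun_prop) 0
    rw [mul_zero, add_zero, one_pow] at this
    exact ((this.eventually (gt_mem_nhds one_lt_two)).mono fun _ h => h.le).filter_mono
      nhdsWithin_le_nhds
  obtain ⟨η, η0, e1, e2, e3, e4, e5, e6, e7⟩ := ((eventually_mem_nhdsWithin (a := (0:ℝ)) (s := Ioi 0)).and
    (ev1.and ((ev_small 1 one_pos).and ((ev_small (2*A) (show (0:ℝ) < 1/2 by norm_num)).and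
    ((ev_small (K * (1 + S5) * G * 2) (show (0:ℝ) < 1/4 by norm_num)).and
    ((ev_small (K * (1 + 5 * G)) (show (0:ℝ) < 1/4 by norm_num)).and
    ((ev_small (N4 * (K * (1 + 5 * G))) (show (0:ℝ) < 1/8 by norm_num)).and
    (ev_small (K3 * (1 + S4) * (5 * A * D * (A * P * 4) * A * S4)) (show (0:ℝ) < 1/8 by norm_num))))))))).exists
  replace η0 : 0 < η := η0
  rw [one_mul] at e2
  have cd : CD A η := ⟨A3n, η0, e2, e1, e3⟩
  have wper : ∀ e z, OK A η e z → ∀ x, |x| < 1/2 → Ga A e z (x+1) = Ga A e z x := fun e z h x hx => by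
    rw [h.per cd (x := x+1) (by linarith [abs_lt.1 hx]) (by linarith [abs_lt.1 hx]), add_sub_cancel_right]
  have inv1 : (A:ℝ) * (A:ℝ)⁻¹ = 1 := mul_inv_cancel₀ A0.ne'
  have i0 : (0:ℝ) < (A:ℝ)⁻¹ := by positivity
  have iA : (A:ℝ)⁻¹ ≤ 1/1000 := by rw [inv_le_comm₀ A0 (by norm_num)]; norm_num; exact A3n
  have i1 : (A:ℝ)⁻¹ ≤ 1 := by linarith
  have top4 : ∀ e z, OK A η e z → NN 4 (Ga A e z) ≤ 2560 * (A:ℝ)⁻¹^2 * nr 5 z + G * nr 5 e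
      + G * (nr 5 e + nr 5 z)^2 := by
    intro e z h
    have t := top e z h.e h.z (((nr_mono (by norm_num) _).trans h.ne).trans e2)
      (((nr_mono (by norm_num) _).trans h.nz).trans e2)
      (((NN_le_nr (by norm_num) _).trans h.ne).trans e2) (h.ph1 cd)
    norm_num at t
    have a1 : NN 4 z ≤ nr 5 z := NN_le_nr (by norm_num) z
    have a2 : NN 4 e ≤ nr 5 e := NN_le_nr (by norm_num) e
    have a3 : nr 4 z ≤ nr 5 z := nr_mono (by norm_num) z
    have a4 : nr 4 e ≤ nr 5 e := nr_mono (by norm_num) e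
    have a5 : 2 * (4*A+34) * 256 * (A * ((A:ℝ)^4)⁻¹) ≤ 2560 * (A:ℝ)⁻¹^2 := by
      calc 2 * (4*A+34) * 256 * (A * ((A:ℝ)^4)⁻¹) ≤ 2 * (5*A) * 256 * (A * ((A:ℝ)^4)⁻¹) := by gcongr
        _ = _ := by field_simp; norm_num
    refine t.trans ?_
    have := nr_nonneg 4 e; have := nr_nonneg 4 z
    gcongr
    · exact NN_nonneg _ _
  have small4 : ∀ e z, OK A η e z → NN 4 (Ga A e z) ≤ (1 + 5 * G) * η := by
    intro e z h
    refine (top4 e z h).trans ?_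
    have b1 := nr_nonneg 5 e; have b2 := nr_nonneg 5 z
    have b3 : 2560 * (A:ℝ)⁻¹^2 ≤ 1 := by nlinarith
    have b4 : (nr 5 e + nr 5 z)^2 ≤ 4 * η := by nlinarith [h.ne, h.nz]
    have b5 := mul_le_mul b3 h.nz b2 zero_le_one
    have b6 := mul_le_mul_of_nonneg_left h.ne hG
    have b7 := mul_le_mul_of_nonneg_left b4 hG
    linarith
  refine ⟨A, η, cd, K * (1 + S5) * G + 1/4, by positivity, fun e z h => ?_, fun e z₁ z₂ h₁ h₂ => ?_⟩
  · have wb := Gw_BS (A := A) h.e h.z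
    obtain ⟨c1, c2⟩ := cut4 _ wb (sub_self _) (fun x hx => by rw [wper e z h x hx])
    have c3 := NN_subc (Ga_BS (A := A) h.e h.z) (Ga A e z 0) (show 0 < 4 by norm_num)
    have c4 := mul_le_mul_of_nonneg_left c3 hK
    constructor
    · have c5 := nr_sub (rt_BS.mul wb) ((rt1_BS.mul wb).comp1 h.z) 5
      have c6 := soft5 _ z (rt1_BS.mul wb) h.z (h.nz.trans e2)
      have c7 := mul_le_mul_of_nonneg_left (c2.trans c4) hS5
      have c8 : nr 5 (Zn (Ga A e z) z) ≤ K * (1 + S5) * NN 4 (Ga A e z) := by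
        unfold Zn; linarith
      refine c8.trans ((mul_le_mul_of_nonneg_left (top4 e z h) q1).trans ?_)
      have b1 := nr_nonneg 5 e; have b2 := nr_nonneg 5 z
      have d1 : K * (1 + S5) * (2560 * (A:ℝ)⁻¹^2) ≤ 1/4 := by
        have : K * (1 + S5) * 10240 ≤ A := by linarith
        have := mul_le_mul_of_nonneg_right this (show 0 ≤ (A:ℝ)⁻¹^2 by positivity)
        have e : (A:ℝ) * (A:ℝ)⁻¹^2 = (A:ℝ)⁻¹ := by rw [pow_two, ← mul_assoc, inv1, one_mul]
        rw [e] at this; linarith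
      have d2 : (nr 5 e + nr 5 z)^2 ≤ 2 * η * (nr 5 e + nr 5 z) := by nlinarith [h.ne, h.nz]
      have d3 := mul_le_mul_of_nonneg_left d2 (show 0 ≤ K * (1 + S5) * G by positivity)
      have d4 := mul_le_mul_of_nonneg_right e4 (show 0 ≤ nr 5 e + nr 5 z by positivity)
      have d5 := mul_le_mul_of_nonneg_right d1 b2
      linarith
    · refine (c2.trans c4).trans (le_trans ?_ e5)
      rw [mul_assoc]; exact mul_le_mul_of_nonneg_left (small4 e z h) hK
  · set φ := ph A e z₁
    set ψ := ph A e z₂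
    set δ := nr 4 (fun x => z₁ x - z₂ x)
    have δ0 : 0 ≤ δ := nr_nonneg _ _
    have bφ : BS φ := ph_BS h₁.e h₁.z
    have bψ : BS ψ := ph_BS h₂.e h₂.z
    have ne1 : nr 5 e ≤ 1 := h₁.ne.trans e2
    have f1 : nr 5 φ ≤ A * (P * (2 * η)) := (ph_nr (by omega) h₁.e h₁.z 5).trans
      (mul_le_mul_of_nonneg_left ((ppn _ _ h₁.e h₁.z ne1).trans (mul_le_mul_of_nonneg_left
        (by linarith [h₁.ne, h₁.nz]) hP)) A0.le)
    have f2 : nr 5 ψ ≤ A * (P * (2 * η)) := (ph_nr (by omega) h₂.e h₂.z 5).trans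
      (mul_le_mul_of_nonneg_left ((ppn _ _ h₂.e h₂.z ne1).trans (mul_le_mul_of_nonneg_left
        (by linarith [h₂.ne, h₂.nz]) hP)) A0.le)
    have f3 : A * (P * (2 * η)) ≤ A * (P * 2) := by gcongr; linarith
    have g := gd φ ψ bφ bψ (f1.trans f3) (f2.trans f3) (h₂.ph1 cd)
    set ζ : ℝ → ℝ := fun x => z₁ (x + e x) - z₂ (x + e x)
    have bz := h₁.z.sub h₂.z
    have bζ : BS ζ := bz.comp1 h₁.e
    have hζ : nr 4 ζ ≤ S4 * δ := soft4 (fun x => z₁ x - z₂ x) e bz h₁.e ((nr_mono (by norm_num) e).trans ne1)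
    have eφ : (fun x => φ x - ψ x) = ph A (fun _ => 0) ζ := by
      funext x; simp only [φ, ψ, ph, PP, ζ]; ring_nf
    have P0 : PP (fun _ => 0) ζ = ζ := by funext x; simp [PP]
    have g1 := ph_NN (A := A) (BS.cst 0) bζ 3
    have g2 := ph_nr (A := A) (by omega) (BS.cst 0) bζ 4
    rw [P0] at g1 g2
    rw [eφ] at g
    have g3 : NN 3 ζ ≤ S4 * δ := (NN_le_nr (by norm_num) ζ).trans hζ
    have bδ : BS (fun x => Ga A e z₁ x - Ga A e z₂ x) := (Ga_BS h₁.e h₁.z).sub (Ga_BS h₂.e h₂.z)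
    have g4 : NN 3 (fun x => Ga A e z₁ x - Ga A e z₂ x) ≤
        (40 * S4 * (A:ℝ)⁻¹ + 5 * A * D * (A * P * 4 * η) * A * S4) * δ := by
      refine (NN_shift ((gam_BS bφ _).sub (gam_BS bψ (4*A+34))) (A+8) 3).trans (g.trans ?_)
      push_cast
      have u1 : NN 3 (ph A (fun _ => 0) ζ) ≤ (A:ℝ) * (A:ℝ)⁻¹^3 * (S4 * δ) :=
        g1.trans (mul_le_mul_of_nonneg_left g3 (by positivity))
      have u2 : nr 4 (ph A (fun _ => 0) ζ) ≤ A * (S4 * δ) :=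
        g2.trans (mul_le_mul_of_nonneg_left hζ A0.le)
      have u3 : (nr 5 φ + nr 5 ψ) * nr 4 (ph A (fun _ => 0) ζ) ≤ (A * P * 4 * η) * (A * (S4 * δ)) :=
        mul_le_mul (by linarith) u2 (nr_nonneg _ _) (by positivity)
      calc _ ≤ (5 * A) * (8 * ((A:ℝ) * (A:ℝ)⁻¹^3 * (S4 * δ)) + D * ((A * P * 4 * η) * (A * (S4 * δ)))) := by
            have := nr_nonneg 5 φ; have := nr_nonneg 5 ψ
            have := nr_nonneg 4 (ph A (fun _ => 0) ζ); have := NN_nonneg 3 (ph A (fun _ => 0) ζ)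
            gcongr
        _ = _ := by field_simp; ring
    have wb1 := Gw_BS (A := A) h₁.e h₁.z
    have wb2 := Gw_BS (A := A) h₂.e h₂.z
    set w₁ := fun x => Ga A e z₁ x - Ga A e z₁ 0
    set w₂ := fun x => Ga A e z₂ x - Ga A e z₂ 0
    have bd := wb1.sub wb2
    obtain ⟨c1, c2⟩ := cut3 _ bd (by simp [w₁, w₂]) (fun x hx => by
      simp only [w₁, w₂]; rw [wper e z₁ h₁ x hx, wper e z₂ h₂ x hx])
    have c3 : NN 3 (fun x => w₁ x - w₂ x) ≤ NN 3 (fun x => Ga A e z₁ x - Ga A e z₂ x) := by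
      have := NN_subc bδ (Ga A e z₁ 0 - Ga A e z₂ 0) (show 0 < 3 by norm_num)
      convert this using 2; funext x; simp only [w₁, w₂]; ring
    obtain ⟨-, c4⟩ := cut4 _ wb2 (sub_self _) (fun x hx => by simp only [w₂]; rw [wper e z₂ h₂ x hx])
    have c5 := NN_subc (Ga_BS (A := A) h₂.e h₂.z) (Ga A e z₂ 0) (show 0 < 4 by norm_num)
    have c6 : nr 5 (fun x => rt1 x * w₂ x) ≤ K * ((1 + 5 * G) * η) :=
      c4.trans (mul_le_mul_of_nonneg_left (c5.trans (small4 e z₂ h₂)) hK)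
    have m1 : nr 4 z₁ ≤ 1 := ((nr_mono (by norm_num) _).trans h₁.nz).trans e2
    have m2 : nr 4 z₂ ≤ 1 := ((nr_mono (by norm_num) _).trans h₂.nz).trans e2
    have d1 := soft4 _ z₁ (rt1_BS.mul bd) h₁.z m1
    have d2 := diff4 _ z₁ z₂ (rt1_BS.mul wb2) h₁.z h₂.z m1 m2
    have d3 := nr_sub ((rt_BS.mul bd).sub ((rt1_BS.mul bd).comp1 h₁.z))
      (((rt1_BS.mul wb2).comp1 h₁.z).sub ((rt1_BS.mul wb2).comp1 h₂.z)) 4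
    have d4 := nr_sub (rt_BS.mul bd) ((rt1_BS.mul bd).comp1 h₁.z) 4
    have ee : (fun x => Zn (Ga A e z₁) z₁ x - Zn (Ga A e z₂) z₂ x) = fun x =>
        (rt x * (w₁ x - w₂ x) - rt1 (x + z₁ x) * (w₁ (x + z₁ x) - w₂ (x + z₁ x)))
        - (rt1 (x + z₁ x) * w₂ (x + z₁ x) - rt1 (x + z₂ x) * w₂ (x + z₂ x)) := by
      funext x; simp only [Zn, w₁, w₂]; ring
    rw [ee]
    refine d3.trans ?_
    have x1 := c3.trans g4
    have x2 : nr 4 (fun x => rt x * (w₁ x - w₂ x)) ≤ K3 * _ := c1.trans (mul_le_mul_of_nonneg_left x1 hK3)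
    have x3 := d1.trans (mul_le_mul_of_nonneg_left (c2.trans (mul_le_mul_of_nonneg_left x1 hK3)) hS4)
    have x4 : N4 * (nr 5 (fun x => rt1 x * w₂ x) * δ) ≤ N4 * (K * ((1 + 5 * G) * η) * δ) := by gcongr
    have x5 := d2.trans x4
    have y1 : K3 * (1 + S4) * (40 * S4 * (A:ℝ)⁻¹) ≤ 1/8 := by
      have : 320 * (K3 * (1 + S4) * S4) ≤ A := by linarith
      have := mul_le_mul_of_nonneg_right this i0.le
      rw [inv1] at this; linarith
    have y2 := mul_le_mul_of_nonneg_right y1 δ0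
    have y3 := mul_le_mul_of_nonneg_right e7 δ0
    have y4 := mul_le_mul_of_nonneg_right e6 δ0
    have y5 := add_le_add (d4.trans (add_le_add x2 x3)) x5
    refine y5.trans ?_
    linarith

lemma nr_cst (s : ℕ) (c : ℝ) : nr s (fun _ : ℝ => c) ≤ s * |c| := nr_le_mul fun j _ => NN_le fun x => by
  rcases j with _ | j <;> simp [iteratedDeriv_const]

lemma hi {A : ℕ} {η : ℝ} (cd : CD A η) (HB : ∀ e z, OK A η e z →
    nr 5 (fun x => rt1 x * (Ga A e z x - Ga A e z 0)) ≤ 1/4) (t : ℕ) (M : ℝ) :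
    ∃ C ≥ 0, ∀ e z, OK A η e z → nr (t+6) e ≤ M → nr (t+5) z ≤ M →
      NN (t+5) (Zn (Ga A e z) z) ≤ 1/2 * NN (t+5) z + C := by
  have A3 : (1000:ℝ) ≤ A := by exact_mod_cast cd.A1
  have A0 : (0:ℝ) < A := by linarith
  obtain ⟨G, hG, soft⟩ := Ga_soft A (t+5) (by have := cd.A1; omega) |M|
  obtain ⟨T, hT, top⟩ := Ga_top A (t+3) (by have := cd.A1; omega) |M|
  obtain ⟨E, hE, psh⟩ := Psharp (t+3) |M|
  have co : (1 + 2^(t+5)) * (2 * (4*A+34) * 4^(t+5) * (A * ((A:ℝ)⁻¹)^(t+5))) ≤ 1/4 := by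
    have h1 : (4*A+34 : ℝ) ≤ 5 * A := by linarith
    have h2 : (1:ℝ) ≤ 2^(t+5) := one_le_pow₀ (by norm_num)
    have i0 : (0:ℝ) < (A:ℝ)⁻¹ := by positivity
    have iA : (A:ℝ)⁻¹ ≤ 1/1000 := by
      rw [inv_le_comm₀ A0 (by norm_num)]; norm_num; exact cd.A1
    have h3 : (8 * (A:ℝ)⁻¹)^t ≤ 1 := pow_le_one₀ (by positivity) (by linarith)
    have h4 : (A:ℝ)⁻¹^3 ≤ (1/1000)^3 := pow_le_pow_left₀ i0.le iA 3
    calc (1 + 2^(t+5)) * (2 * (4*A+34) * 4^(t+5) * (A * ((A:ℝ)⁻¹)^(t+5)))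
        ≤ (2^(t+5) + 2^(t+5)) * (2 * (5 * A) * 4^(t+5) * (A * ((A:ℝ)⁻¹)^(t+5))) := by gcongr
      _ = 655360 * (A:ℝ)⁻¹^3 * (8 * (A:ℝ)⁻¹)^t := by
        have : (8:ℝ)^t = 2^t * 4^t := by rw [← mul_pow]; norm_num
        rw [mul_pow, this, pow_add, pow_add, pow_add]; field_simp; norm_num
      _ ≤ 655360 * (1/1000)^3 * 1 := by gcongr
      _ ≤ 1/4 := by norm_num
  set W := (1 + ((t+5:ℕ):ℝ)) * (G * (|M| + |M|)) with hW
  have W0 : 0 ≤ W := by positivity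
  set R1 := NN (t+5) rt * W + 2^(t+5) * (nr (t+5) rt * W)
  set R2 := NN (t+5) rt1 * W + 2^(t+5) * (nr (t+5) rt1 * W)
  set R3 := ((t+5:ℕ):ℝ) * 2^(t+5) * (nr (t+5) rt1 * W)
  set B := T * |M| + T * (|M| + |M|)^2
  have r1 := NN_nonneg (t+5) rt; have r2 := nr_nonneg (t+5) rt
  have r3 := NN_nonneg (t+5) rt1; have r4 := nr_nonneg (t+5) rt1
  refine ⟨R1 + 2^(t+5) * R2 + E * (R3 * |M|) + (1 + 2^(t+5)) * B, by positivity, fun e z h he hz => ?_⟩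
  have he' : nr (t+5) e ≤ |M| := ((nr_mono (by omega) e).trans he).trans (le_abs_self _)
  have hz' : nr (t+5) z ≤ |M| := hz.trans (le_abs_self _)
  have s1 := soft e z h.e h.z he' hz'
  have bG := Ga_BS (A := A) h.e h.z
  have s2 := top e z h.e h.z he' hz' (((NN_le_nr (by norm_num) _).trans h.ne).trans cd.le) (h.ph1 cd)
  rw [show t + 3 + 2 = t + 5 from rfl] at s2
  have bw := Gw_BS (A := A) h.e h.z
  have HB := HB e z h
  have s3 := NN_subc bG (Ga A e z 0) (show 0 < t+5 by omega)
  have s4 : nr (t+5) (fun x => Ga A e z x - Ga A e z 0) ≤ W := by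
    have a1 := nr_sub bG (BS.cst (Ga A e z 0)) (t+5)
    have a2 := nr_cst (t+5) (Ga A e z 0)
    have a3 := (bG.le0 0).trans (NN_le_nr (show 0 < t+5 by omega) _)
    have a4 : nr (t+5) (Ga A e z) ≤ G * (|M| + |M|) := s1.trans (by gcongr)
    have a5 := mul_le_mul_of_nonneg_left (a3.trans a4) (show (0:ℝ) ≤ ((t+5:ℕ):ℝ) by positivity)
    rw [hW]; linarith
  set w := fun x => Ga A e z x - Ga A e z 0 with hw
  have w0 : NN 0 w ≤ W := (NN_le_nr (by omega) _).trans s4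
  have wn := NN_nonneg (t+5) w
  have m1 : NN (t+5) (fun x => rt x * w x) ≤ NN (t+5) w + R1 := by
    refine (NN_mul_top rt_BS bw (by omega)).trans ?_
    have b1 := mul_le_mul_of_nonneg_right rt_N wn
    have b2 := mul_le_mul_of_nonneg_left w0 r1
    have b3 := mul_le_mul_of_nonneg_left (mul_le_mul_of_nonneg_left s4 r2) (show (0:ℝ) ≤ 2^(t+5) by positivity)
    simp only [R1]; linarith
  have m2 : NN (t+5) (fun x => rt1 x * w x) ≤ NN (t+5) w + R2 := by
    refine (NN_mul_top rt1_BS bw (by omega)).trans ?_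
    have b1 := mul_le_mul_of_nonneg_right rt1_N wn
    have b2 := mul_le_mul_of_nonneg_left w0 r3
    have b3 := mul_le_mul_of_nonneg_left (mul_le_mul_of_nonneg_left s4 r4) (show (0:ℝ) ≤ 2^(t+5) by positivity)
    simp only [R2]; linarith
  have m3 : nr (t+5) (fun x => rt1 x * w x) ≤ R3 := (nr_mul rt1_BS bw _).trans
    (mul_le_mul_of_nonneg_left (mul_le_mul_of_nonneg_left s4 r4) (by positivity))
  have m4 := psh _ z (rt1_BS.mul bw) h.z hz'
  rw [show t + 3 + 2 = t + 5 from rfl] at m4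
  have m5 := NN_sub (rt_BS.mul bw) ((rt1_BS.mul bw).comp1 h.z) (t+5)
  have zn := NN_nonneg (t+5) z
  have p1 : (1 + NN 1 z)^(t+5) ≤ 2^(t+5) := by
    refine pow_le_pow_left₀ (by linarith [NN_nonneg 1 z]) ?_ _
    have := ((NN_le_nr (by norm_num : 1 < 5) z).trans h.nz).trans cd.le
    linarith
  have p2 := mul_le_mul p1 m2 (NN_nonneg _ _) (by positivity)
  have p3 := mul_le_mul_of_nonneg_right ((NN_le_nr (by norm_num : 1 < 5) _).trans HB) zn
  have p4 := mul_le_mul_of_nonneg_left (mul_le_mul m3 hz' (nr_nonneg _ _) (by positivity)) hE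
  have p5 : NN (t+5) w ≤ 2 * (4*A+34) * 4^(t+5) * (A * ((A:ℝ)⁻¹)^(t+5)) * NN (t+5) z + B := by
    refine s3.trans (s2.trans ?_)
    have c1 := mul_le_mul_of_nonneg_left ((NN_le_nr (show t+5 < t+6 by omega) e).trans
      (he.trans (le_abs_self _))) hT
    have c2 : T * (nr (t+5) e + nr (t+5) z)^2 ≤ T * (|M| + |M|)^2 := by
      have := nr_nonneg (t+5) e; have := nr_nonneg (t+5) z
      gcongr
    simp only [B]; linarith
  have p6 := mul_le_mul_of_nonneg_left p5 (show (0:ℝ) ≤ 1 + 2^(t+5) by positivity)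
  have p7 := mul_le_mul_of_nonneg_right co zn
  have p8 : NN (t+5) (Zn (Ga A e z) z) ≤ NN (t+5) w + R1 + (2^(t+5) * (NN (t+5) w + R2)
     + 1/4 * NN (t+5) z + E * (R3 * |M|)) :=
    m5.trans (add_le_add m1 (m4.trans (add_le_add (add_le_add p2 p3) p4)))
  refine p8.trans ?_
  linarith

lemma picard : ∃ (A : ℕ) (η : ℝ), CD A η ∧ ∃ δ > 0, ∃ C ≥ 0, δ ≤ η ∧
    (∀ e, BS e → S1p e → nr 5 e ≤ δ → ∃ z, OK A η e z ∧ Zn (Ga A e z) z = z ∧ nr 5 z ≤ C * nr 5 e) ∧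
    ∀ s M, ∃ C', ∀ e z, OK A η e z → Zn (Ga A e z) z = z → nr s e ≤ M → nr s z ≤ C' := by
  obtain ⟨A, η, cd, C, hC, ball, con⟩ := core
  have hi := hi cd fun e z h => (ball e z h).2
  have η0 := cd.p
  refine ⟨A, η, cd, η / (2 * C + 1), by positivity, 2 * C, by positivity, div_le_self η0.le (by linarith), ?_, ?_⟩
  · intro e he se hδ
    rw [le_div_iff₀ (by positivity)] at hδ
    have ne0 := nr_nonneg 5 e
    have hη : nr 5 e ≤ η := by nlinarith
    let z : ℕ → ℝ → ℝ := fun k => Nat.rec (fun _ => 0) (fun _ z => Zn (Ga A e z) z) k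
    have zs : ∀ k, z (k+1) = Zn (Ga A e (z k)) (z k) := fun _ => rfl
    have z0 : z 0 = fun _ => 0 := rfl
    clear_value z
    have ok : ∀ k, OK A η e (z k) := by
      intro k
      induction k with
      | zero => rw [z0]; exact ⟨he, BS.cst 0, se, fun _ _ => rfl, hη, by rw [nr_zero]; exact η0.le⟩
      | succ k ih =>
        rw [zs]
        refine ⟨he, Zn_BS ih.e ih.z, se, Zn_S _ ih.sz, hη, (ball _ _ ih).1.trans ?_⟩
        linarith [ih.nz]
    have bd : ∀ t, ∃ M, ∀ k, nr (t+5) (z k) ≤ M := by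
      intro t
      induction t with
      | zero => exact ⟨η, fun k => (ok k).nz⟩
      | succ t ih =>
        obtain ⟨M, hM⟩ := ih
        obtain ⟨D, hD, h⟩ := hi t (max M (nr (t+6) e))
        refine ⟨M + 2 * D, fun k => ?_⟩
        rw [show t + 1 + 5 = (t + 5) + 1 by ring, nr_succ]
        refine add_le_add (hM k) ?_
        induction k with
        | zero => rw [z0, NN_zero]; positivity
        | succ k ih =>
          rw [zs]
          have := h e (z k) (ok k) (le_max_right _ _) ((hM k).trans (le_max_left _ _))
          linarith
    set D := nr 4 (fun x => z 1 x - z 0 x)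
    have D0 : 0 ≤ D := nr_nonneg _ _
    have st : ∀ k, nr 4 (fun x => z (k+1) x - z k x) ≤ D * (1/2)^k := by
      intro k
      induction k with
      | zero => simp [D]
      | succ k ih =>
        have := con e _ _ (ok (k+1)) (ok k)
        rw [← zs, ← zs] at this
        rw [pow_succ]; linarith
    have tel : ∀ j k x, |z (k+j) x - z k x| ≤ 2 * D * (1/2)^k * (1 - (1/2)^j) := by
      intro j k x
      induction j with
      | zero => simp
      | succ j ih =>
        have h1 := ((((ok (k+j+1)).z.sub (ok (k+j)).z).le0 x).trans (NN_le_nr (by norm_num) _)).trans (st (k+j))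
        have h2 := abs_sub_le (z (k+j+1) x) (z (k+j) x) (z k x)
        rw [← add_assoc, pow_succ]
        rw [pow_add] at h1
        linarith
    obtain ⟨Z, hZ, lim⟩ := limit_lemma (fun k => (ok k).z.sm) (fun s => by
      obtain ⟨M, hM⟩ := bd (s+1)
      exact ⟨M, fun k x => ((ok k).z.le s x).trans ((NN_le_nr (by omega) _).trans (hM k))⟩) (by
      intro ε hε
      obtain ⟨N, hN⟩ := exists_pow_lt_of_lt_one (show 0 < ε / (2 * D * 2 + 1) by positivity)
        (show (1/2:ℝ) < 1 by norm_num)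
      rw [lt_div_iff₀ (by positivity)] at hN
      have hb : ∀ k ≥ N, ∀ x, |z k x - z N x| ≤ 2 * D * (1/2)^N := by
        intro k hk x
        obtain ⟨j, rfl⟩ := Nat.exists_eq_add_of_le hk
        refine (tel j N x).trans (mul_le_of_le_one_right (by positivity) ?_)
        linarith [show (0:ℝ) ≤ (1/2)^j by positivity]
      refine ⟨N, fun k hk m hm x => ?_⟩
      have h1 := hb k hk x
      have h2 := hb m hm x
      rw [abs_sub_comm] at h2
      have := abs_sub_le (z k x) (z N x) (z m x)
      have : (0:ℝ) ≤ (1/2)^N := by positivity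
      linarith)
    have bZ : BS Z := BS.mk hZ fun s => by
      obtain ⟨N, hN⟩ := lim s 1 one_pos
      refine ⟨NN s (z N) + 1, fun x => ?_⟩
      have h1 := hN N le_rfl x
      have h2 := (ok N).z.le s x
      have := abs_sub_abs_le_abs_sub (iteratedDeriv s Z x) (iteratedDeriv s (z N) x)
      rw [abs_sub_comm] at h1; linarith
    have nl : ∀ s, ∀ ε > 0, ∃ N, ∀ k ≥ N, NN s (fun x => z k x - Z x) ≤ ε := by
      intro s ε hε
      obtain ⟨N, hN⟩ := lim s ε hε
      refine ⟨N, fun k hk => NN_le fun x => ?_⟩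
      rw [show iteratedDeriv s (fun x => z k x - Z x) x = _ from
        iteratedDeriv_sub ((ok k).z.sm.at s x) (bZ.sm.at s x)]
      exact hN k hk x
    have nl5 : ∀ ε > 0, ∃ k, nr 5 (fun x => z k x - Z x) ≤ 5 * ε ∧ ∀ x, |z (k+1) x - Z x| ≤ ε := by
      intro ε hε
      choose N hN using fun s => nl s ε hε
      refine ⟨∑ s ∈ Finset.range 5, N s, ?_, fun x => ?_⟩
      · refine (nr_le_mul fun j hj => hN j _ ?_).trans (by norm_num)
        exact Finset.single_le_sum (fun _ _ => Nat.zero_le _) (Finset.mem_range.2 hj)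
      · refine (((ok _).z.sub bZ).le0 x).trans (hN 0 _ ?_)
        exact (Finset.single_le_sum (f := N) (fun _ _ => Nat.zero_le _)
          (Finset.mem_range.2 (by norm_num : 0 < 5))).trans (Nat.le_succ _)
    have okZ : OK A η e Z := by
      refine ⟨he, bZ, se, fun x hx => ?_, hη, ?_⟩
      · refine abs_eq_zero.1 (le_antisymm (le_of_forall_pos_le_add fun ε hε => ?_) (abs_nonneg _))
        obtain ⟨k, -, hk⟩ := nl5 ε hε
        have := hk x
        rw [(ok (k+1)).sz x hx] at this
        simpa using this
      · refine le_of_forall_pos_le_add fun ε hε => ?_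
        obtain ⟨k, hk, -⟩ := nl5 (ε/5) (by positivity)
        have h1 := nr_sub (ok k).z ((ok k).z.sub bZ) 5
        simp only [sub_sub_cancel] at h1
        linarith [(ok k).nz, show (fun x => Z x) = Z from rfl]
    have fx : Zn (Ga A e Z) Z = Z := by
      funext x
      refine sub_eq_zero.1 (abs_eq_zero.1 (le_antisymm (le_of_forall_pos_le_add fun ε hε => ?_) (abs_nonneg _)))
      obtain ⟨k, h1, h2⟩ := nl5 (ε/4) (by positivity)
      have h3 := con e _ _ (ok k) okZ
      rw [← zs] at h3
      have bn : BS (Zn (Ga A e Z) Z) := Zn_BS he bZ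
      have h4 := (((ok (k+1)).z.sub bn).le0 x).trans (NN_le_nr (by norm_num : 0 < 4) _)
      have h5 := nr_mono (by norm_num : 4 ≤ 5) (fun x => z k x - Z x)
      have h6 := abs_sub_le (Zn (Ga A e Z) Z x) (z (k+1) x) (Z x)
      rw [abs_sub_comm _ (z (k+1) x)] at h6
      linarith [h2 x]
    refine ⟨Z, okZ, fx, ?_⟩
    have := (ball e Z okZ).1
    rw [fx] at this; linarith
  · intro s M
    have key : ∀ t, ∃ C', ∀ e z, OK A η e z → Zn (Ga A e z) z = z → nr (t+5) e ≤ M → nr (t+5) z ≤ C' := by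
      intro t
      induction t with
      | zero => exact ⟨η, fun e z h _ _ => h.nz⟩
      | succ t ih =>
        obtain ⟨C', h'⟩ := ih
        obtain ⟨D, hD, h⟩ := hi t (max M C')
        refine ⟨C' + 2 * D, fun e z ho hf he => ?_⟩
        rw [show t + 1 + 5 = (t + 5) + 1 by ring] at he ⊢
        have h1 := h' e z ho hf ((nr_mono (by omega) e).trans he)
        have h2 := h e z ho (he.trans (le_max_left _ _)) (h1.trans (le_max_right _ _))
        rw [hf] at h2
        rw [nr_succ]; linarith
    rcases Nat.lt_or_ge s 5 with hs | hs
    · exact ⟨η, fun e z h _ _ => (nr_mono hs.le z).trans h.nz⟩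
    · obtain ⟨t, rfl⟩ := Nat.exists_eq_add_of_le hs
      rw [add_comm 5 t]; exact key t

lemma inv_smooth {U : Set ℝ} [OrdConnected U] (hU : IsOpen U) {f : ℝ → ℝ}
    (hf : ∀ x ∈ U, ContDiffAt ℝ (⊤:ℕ∞) f x) (hf' : ∀ x ∈ U, 0 < deriv f x)
    (sj : ∀ x, ∃ y ∈ U, f y = x) :
    StrictMonoOn f U ∧ ∃ g : ℝ → ℝ, Sm g ∧ (∀ x, g x ∈ U ∧ f (g x) = x) ∧ ∀ y ∈ U, g (f y) = y := by
  have hm : StrictMonoOn f U := by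
    refine strictMonoOn_of_deriv_pos (convex_iff_ordConnected.2 inferInstance)
      (fun x hx => (hf x hx).continuousAt.continuousWithinAt) ?_
    rw [hU.interior_eq]; exact hf'
  refine ⟨hm, ?_⟩
  let F : U → ℝ := fun x => f x
  have hF : StrictMono F := fun x y h => hm x.2 y.2 h
  have hs : Function.Surjective F := fun x => by
    obtain ⟨y, hy, h⟩ := sj x; exact ⟨⟨y, hy⟩, h⟩
  let e := hF.orderIsoOfSurjective F hs
  have e1 : ∀ x, f (e.symm x : ℝ) = x := fun x => e.apply_symm_apply x
  have ec : Continuous fun x => (e.symm x : ℝ) := continuous_subtype_val.comp e.symm.continuous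
  refine ⟨fun x => e.symm x, ?_, fun x => ⟨(e.symm x).2, e1 x⟩, fun y hy => ?_⟩
  · refine contDiff_iff_contDiffAt.2 fun x => ?_
    have ha := hf _ (e.symm x).2
    have hd : HasFDerivAt f ((ContinuousLinearEquiv.unitsEquivAut ℝ (Units.mk0 _ (hf' _ (e.symm x).2).ne') :
        ℝ ≃L[ℝ] ℝ) : ℝ →L[ℝ] ℝ) (e.symm x : ℝ) := by
      have h0 := (ha.differentiableAt (by simp)).hasDerivAt.hasFDerivAt
      have e2 : ((ContinuousLinearEquiv.unitsEquivAut ℝ (Units.mk0 _ (hf' _ (e.symm x).2).ne') :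
        ℝ ≃L[ℝ] ℝ) : ℝ →L[ℝ] ℝ) = ContinuousLinearMap.toSpanSingleton ℝ (deriv f (e.symm x : ℝ)) := by
        ext; simp
      rw [e2]; exact h0
    have hn : ((⊤:ℕ∞) : WithTop ℕ∞) ≠ 0 := by simp
    have h1 := ha.to_localInverse hd hn
    rw [e1] at h1
    refine h1.congr_of_eventuallyEq ?_
    have h2 := (ha.hasStrictFDerivAt' hd hn).eventually_left_inverse
    have h3 := (ec.continuousAt (x := x)).eventually h2
    filter_upwards [h3] with x' h4
    rw [e1] at h4
    exact h4.symm
  · exact congrArg Subtype.val (e.symm_apply_apply ⟨y, hy⟩)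

/-- increasing smooth diffeomorphism of the line -/
def DF (f : Equiv.Perm ℝ) : Prop := Sm f ∧ ∀ x, 0 < deriv f x

lemma DF.one : DF 1 := ⟨contDiff_id, fun x => by
  have : deriv (fun y : ℝ => y) x = 1 := deriv_id x
  show 0 < deriv (fun y : ℝ => y) x
  rw [this]; norm_num⟩

lemma DF.mul {f g : Equiv.Perm ℝ} (hf : DF f) (hg : DF g) : DF (f * g) := by
  refine ⟨hf.1.comp hg.1, fun x => ?_⟩
  have := (hf.1.d (g x)).hasDerivAt.comp x (hg.1.d x).hasDerivAt
  rw [show ((f * g : Equiv.Perm ℝ) : ℝ → ℝ) = f ∘ g from rfl, this.deriv]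
  exact mul_pos (hf.2 _) (hg.2 _)

lemma DF.inv {f : Equiv.Perm ℝ} (hf : DF f) : DF f⁻¹ := by
  obtain ⟨-, g, h1, h2, -⟩ := inv_smooth (U := univ) isOpen_univ (f := f) (fun x _ => hf.1.contDiffAt)
    (fun x _ => hf.2 x) (fun x => ⟨f⁻¹ x, trivial, f.apply_symm_apply x⟩)
  have : ((f⁻¹ : Equiv.Perm ℝ) : ℝ → ℝ) = g := by
    funext x; rw [Equiv.Perm.inv_eq_iff_eq]; exact (h2 x).2.symm
  have hs : Sm (f⁻¹ : Equiv.Perm ℝ) := this ▸ h1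
  refine ⟨hs, fun x => ?_⟩
  have h3 := (hf.1.d (f⁻¹ x)).hasDerivAt.comp x (hs.d x).hasDerivAt
  have h4 : (f ∘ (f⁻¹ : Equiv.Perm ℝ)) = fun x => x := by funext x; exact f.apply_symm_apply x
  rw [h4] at h3
  have h5 := h3.unique (hasDerivAt_id x)
  by_contra h
  nlinarith [hf.2 (f⁻¹ x)]

lemma DF.mono {f : Equiv.Perm ℝ} (hf : DF f) : StrictMono f := strictMono_of_deriv_pos hf.2

/-- displacement -/
def dsp (f : Equiv.Perm ℝ) (x : ℝ) : ℝ := f x - x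
lemma dsp_eq (f : Equiv.Perm ℝ) (x : ℝ) : f x = x + dsp f x := by unfold dsp; ring
lemma DF.dsm {f : Equiv.Perm ℝ} (hf : DF f) : Sm (dsp f) := hf.1.sub contDiff_id
lemma DF.dpos {f : Equiv.Perm ℝ} (hf : DF f) (x : ℝ) : 0 < 1 + deriv (dsp f) x := by
  have h := hf.2 x
  rw [show (f : ℝ → ℝ) = fun x => x + dsp f x from funext (dsp_eq f),
    deriv_fun_add differentiableAt_fun_id (hf.dsm.d x), deriv_id''] at h
  exact h

open Classical in
def mkP (u : ℝ → ℝ) : Equiv.Perm ℝ :=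
  if h : Function.Bijective (fun x => x + u x) then Equiv.ofBijective _ h else 1

lemma mkP_spec {u : ℝ → ℝ} (hu : Sm u) (hp : ∀ x, 0 < 1 + deriv u x) {C : ℝ} (hb : ∀ x, |u x| ≤ C) :
    DF (mkP u) ∧ (∀ x, mkP u x = x + u x) ∧ dsp (mkP u) = u := by
  have hs : Sm (fun x => x + u x) := contDiff_id.add hu
  have hd : ∀ x, 0 < deriv (fun x => x + u x) x := fun x => by
    rw [deriv_fun_add differentiableAt_fun_id (hu.d x), deriv_id'']; exact hp x
  have hbij : Function.Bijective (fun x => x + u x) := by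
    refine ⟨(strictMono_of_deriv_pos hd).injective, hs.continuous.surjective ?_ ?_⟩
    · exact tendsto_atTop_mono (fun x => (by linarith [neg_le_of_abs_le (hb x)] : x + (-C) ≤ x + u x))
        (tendsto_atTop_add_const_right _ _ tendsto_id)
    · exact tendsto_atBot_mono (fun x => (by linarith [le_of_abs_le (hb x)] : x + u x ≤ x + C))
        (tendsto_atBot_add_const_right _ _ tendsto_id)
  have e : ∀ x, mkP u x = x + u x := fun x => by rw [mkP, dif_pos hbij]; rfl
  have e' : (mkP u : ℝ → ℝ) = fun x => x + u x := funext e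
  refine ⟨⟨by rw [e']; exact hs, by rw [e']; exact hd⟩, e, ?_⟩
  funext x; rw [dsp, e]; ring

/-- support in `[-B,B]` -/
def Sup (B : ℝ) (f : Equiv.Perm ℝ) : Prop := ∀ x, B ≤ |x| → f x = x
lemma Sup.one (B : ℝ) : Sup B 1 := fun _ _ => rfl
lemma Sup.mul {B : ℝ} {f g : Equiv.Perm ℝ} (hf : Sup B f) (hg : Sup B g) : Sup B (f * g) := fun x hx => by
  rw [Equiv.Perm.mul_apply, hg x hx, hf x hx]
lemma Sup.inv {B : ℝ} {f : Equiv.Perm ℝ} (hf : Sup B f) : Sup B f⁻¹ := fun x hx => by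
  rw [Equiv.Perm.inv_eq_iff_eq, hf x hx]

lemma Sm.bdd_of {u : ℝ → ℝ} (hu : Sm u) {B : ℝ} (h : ∀ x, B < |x| → u x = 0) : ∃ C : ℝ, ∀ x, |u x| ≤ C := by
  simpa using (BS.of_supp hu h).bd 0

/-- affine map near p, identity far away -/
def ctr (lam p R x : ℝ) : ℝ := (lam - 1) * (x - p) * st (2 - ((x - p)/R)^2)

lemma ctr_spec {lam : ℝ} (h0 : 0 < lam) (h1 : lam < 1) (p : ℝ) {R : ℝ} (hR : 0 < R) :
    ∃ f : Equiv.Perm ℝ, DF f ∧ (∀ x, |x - p| ≤ R → f x = p + lam * (x - p)) ∧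
      ∀ x, 2 * R ≤ |x - p| → f x = x := by
  have hs : Sm (ctr lam p R) := by
    have : Sm (fun x : ℝ => 2 - ((x - p)/R)^2) := by
      unfold Sm; fun_prop
    exact ContDiff.mul (by fun_prop) (st_sm.comp this)
  have hz : ∀ x, 2 * R ≤ |x - p| → ctr lam p R x = 0 := fun x hx => by
    rw [ctr, st0, mul_zero]
    have : 2 ≤ |(x-p)/R| := by rw [abs_div, abs_of_pos hR, le_div_iff₀ hR]; exact hx
    rw [← sq_abs]; nlinarith
  obtain ⟨C, hC⟩ := hs.bdd_of (B := 2 * R + |p|) (fun x hx => hz x (by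
    have := abs_add_le (x - p) p; rw [sub_add_cancel] at this; linarith))
  have hd : ∀ x, 0 < 1 + deriv (ctr lam p R) x := by
    intro x
    have a1 : HasDerivAt (fun x : ℝ => 2 - ((x - p)/R)^2) (-(2 * ((x-p)/R) * (1/R))) x := by
      have := ((((hasDerivAt_id x).sub_const p).div_const R).pow 2).const_sub 2
      simpa using this
    have a2 := (st_sm.d (2 - ((x - p)/R)^2)).hasDerivAt.comp x a1
    have a3 := (((hasDerivAt_id x).sub_const p).const_mul (lam - 1)).mul a2
    have a4 : deriv (ctr lam p R) x = _ := a3.deriv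
    rw [a4]
    have b1 : 0 ≤ deriv st (2 - ((x - p)/R)^2) := st_mono.deriv_nonneg
    have b2 := st_nn (2 - ((x - p)/R)^2)
    have b3 := st_le (2 - ((x - p)/R)^2)
    simp only [Function.comp, id]
    have : (lam - 1) * (x - p) * (deriv st (2 - ((x - p)/R)^2) * -(2 * ((x-p)/R) * (1/R)))
      = (1 - lam) * (deriv st (2 - ((x - p)/R)^2) * (2 * ((x-p)/R)^2)) := by field_simp; ring
    rw [this]
    have b4 : 0 ≤ (1 - lam) * (deriv st (2 - ((x - p)/R)^2) * (2 * ((x-p)/R)^2)) :=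
      mul_nonneg (by linarith) (by positivity)
    nlinarith
  obtain ⟨d1, d2, -⟩ := mkP_spec hs hd hC
  refine ⟨_, d1, fun x hx => ?_, fun x hx => by rw [d2, hz x hx, add_zero]⟩
  rw [d2, ctr, st1]; · ring
  have : |(x-p)/R| ≤ 1 := by rw [abs_div, abs_of_pos hR, div_le_one hR]; exact hx
  rw [← sq_abs]; nlinarith [abs_nonneg ((x-p)/R)]


def Xi (y : ℝ) : ℝ := y + st (y - 1) * (2 + Real.exp (1/(3-y)) - y)
  - st (-y - 1) * (2 + Real.exp (1/(3+y)) + y)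

lemma Xi_odd (y : ℝ) : Xi (-y) = - Xi y := by
  unfold Xi; rw [neg_neg, sub_neg_eq_add, ← sub_eq_add_neg 3 y]; ring_nf
lemma Xi_top {y : ℝ} (h : 2 ≤ y) : Xi y = 2 + Real.exp (1/(3-y)) := by
  unfold Xi; rw [st1 (by linarith), st0 (by linarith)]; ring
lemma Xi_mid {y : ℝ} (h : |y| ≤ 1) : Xi y = y := by
  obtain ⟨h1, h2⟩ := abs_le.1 h
  unfold Xi; rw [st0 (by linarith), st0 (by linarith)]; ring

lemma Xi_hd {y : ℝ} (h : y ∈ Ioo (-3:ℝ) 3) : HasDerivAt Xi (1 + (deriv st (y-1) * (2 + Real.exp (1/(3-y)) - y)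
    + st (y-1) * (Real.exp (1/(3-y)) * (1/(3-y)^2) - 1))
    + (deriv st (-y-1) * (2 + Real.exp (1/(3+y)) + y)
    + st (-y-1) * (Real.exp (1/(3+y)) * (1/(3+y)^2) - 1))) y := by
  have n1 : (3 - y) ≠ 0 := by linarith [h.2]
  have n2 : (3 + y) ≠ 0 := by linarith [h.1]
  have a1 : HasDerivAt (fun y : ℝ => y - 1) 1 y := (hasDerivAt_id y).sub_const 1
  have a2 : HasDerivAt (fun y : ℝ => -y - 1) (-1) y := (hasDerivAt_id y).neg.sub_const 1
  have b1 := (st_sm.d (y-1)).hasDerivAt.comp y a1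
  have b2 := (st_sm.d (-y-1)).hasDerivAt.comp y a2
  have c1 : HasDerivAt (fun y : ℝ => 1/(3-y)) (1/(3-y)^2) y := by
    have := ((hasDerivAt_id y).const_sub 3).inv n1
    simp only [one_div]; exact this.congr_deriv (by simp)
  have c2 : HasDerivAt (fun y : ℝ => 1/(3+y)) (-(1/(3+y)^2)) y := by
    have := ((hasDerivAt_id y).const_add 3).inv n2
    simp only [one_div]; exact this.congr_deriv (by simp [neg_div])
  have d1 := (c1.exp.const_add 2).sub (hasDerivAt_id y)
  have d2 := (c2.exp.const_add 2).add (hasDerivAt_id y)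
  have := ((hasDerivAt_id y).add (b1.mul d1)).sub (b2.mul d2)
  refine this.congr_deriv ?_
  simp only [Function.comp]
  simp; ring_nf

lemma Xi_sm {y : ℝ} (h : y ∈ Ioo (-3:ℝ) 3) : ContDiffAt ℝ (⊤:ℕ∞) Xi y := by
  have n1 : (3 - y) ≠ 0 := by linarith [h.2]
  have n2 : (3 + y) ≠ 0 := by linarith [h.1]
  have a1 : ContDiffAt ℝ (⊤:ℕ∞) (fun y : ℝ => st (y - 1)) y :=
    (st_sm.comp (contDiff_id.sub contDiff_const)).contDiffAt
  have a2 : ContDiffAt ℝ (⊤:ℕ∞) (fun y : ℝ => st (-y - 1)) y :=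
    (st_sm.comp (contDiff_id.neg.sub contDiff_const)).contDiffAt
  have b1 : ContDiffAt ℝ (⊤:ℕ∞) (fun y : ℝ => 2 + Real.exp (1/(3-y)) - y) y := by fun_prop (disch := assumption)
  have b2 : ContDiffAt ℝ (⊤:ℕ∞) (fun y : ℝ => 2 + Real.exp (1/(3+y)) + y) y := by fun_prop (disch := assumption)
  exact (contDiffAt_id.add (a1.mul b1)).sub (a2.mul b2)

lemma Xi_pos {y : ℝ} (h : y ∈ Ioo (-3:ℝ) 3) : 0 < deriv Xi y := by
  rw [(Xi_hd h).deriv]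
  have n1 : 0 < (3 - y) := by linarith [h.2]
  have n2 : 0 < (3 + y) := by linarith [h.1]
  have e1 : 1 < Real.exp (1/(3-y)) := Real.one_lt_exp_iff.2 (by positivity)
  have e2 : 1 < Real.exp (1/(3+y)) := Real.one_lt_exp_iff.2 (by positivity)
  have s1 : 0 ≤ deriv st (y-1) := st_mono.deriv_nonneg
  have s2 : 0 ≤ deriv st (-y-1) := st_mono.deriv_nonneg
  have p1 : 0 ≤ deriv st (y-1) * (2 + Real.exp (1/(3-y)) - y) := mul_nonneg s1 (by linarith)
  have p2 : 0 ≤ deriv st (-y-1) * (2 + Real.exp (1/(3+y)) + y) := mul_nonneg s2 (by linarith)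
  have q1 : 0 < Real.exp (1/(3-y)) * (1/(3-y)^2) := by positivity
  have q2 : 0 < Real.exp (1/(3+y)) * (1/(3+y)^2) := by positivity
  have key : ∀ a q : ℝ, 0 ≤ a → a ≤ 1 → 0 < q → 0 < 1 + a * (q - 1) := fun a q h0 h1 hq => by
    rcases h1.eq_or_lt with rfl | h1
    · linarith
    · nlinarith [mul_nonneg h0 hq.le]
  rcases le_total y 0 with h0 | h0
  · rw [st0 (show y - 1 ≤ 0 by linarith)]
    have := key _ _ (st_nn (-y-1)) (st_le (-y-1)) q2
    linarith
  · rw [st0 (show -y - 1 ≤ 0 by linarith)]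
    have := key _ _ (st_nn (y-1)) (st_le (y-1)) q1
    linarith

lemma Xi_end {X : ℝ} (h : Real.exp 1 ≤ X) : 2 ≤ 3 - 1 / Real.log X ∧ 3 - 1/Real.log X < 3 ∧
    Xi (3 - 1 / Real.log X) = 2 + X := by
  have p : 0 < X := (Real.exp_pos 1).trans_le h
  have hl : 1 ≤ Real.log X := by rwa [Real.le_log_iff_exp_le p]
  have h2 : 1 / Real.log X ≤ 1 := by rw [div_le_one (by linarith)]; exact hl
  have h3 : 0 < 1 / Real.log X := by positivity
  refine ⟨by linarith, by linarith, ?_⟩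
  rw [Xi_top (by linarith), sub_sub_cancel, one_div_one_div, Real.exp_log p]

lemma Xi_surj (x : ℝ) : ∃ y ∈ Ioo (-3:ℝ) 3, Xi y = x := by
  have key : ∀ x ≥ 0, ∃ y ∈ Ioo (-3:ℝ) 3, Xi y = x := by
    intro x hx
    rcases le_total (Real.exp 1) (x - 2) with h | h
    · obtain ⟨h1, h2, h3⟩ := Xi_end h
      exact ⟨_, ⟨by linarith, h2⟩, by rw [h3]; ring⟩
    · have hc : ContinuousOn Xi (Icc 0 2) := fun y hy =>
        (Xi_sm ⟨by linarith [hy.1], by linarith [hy.2]⟩).continuousAt.continuousWithinAt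
      have := intermediate_value_Icc (by norm_num : (0:ℝ) ≤ 2) hc
      obtain ⟨y, hy, h⟩ := this (show x ∈ Icc (Xi 0) (Xi 2) from ⟨by rw [Xi_mid (by norm_num)]; exact hx, by
        rw [Xi_top le_rfl]; norm_num; linarith⟩)
      exact ⟨y, ⟨by linarith [hy.1], by linarith [hy.2]⟩, h⟩
  rcases le_total 0 x with h | h
  · exact key x h
  · obtain ⟨y, hy, h⟩ := key (-x) (by linarith)
    exact ⟨-y, ⟨by linarith [hy.2], by linarith [hy.1]⟩, by rw [Xi_odd, h, neg_neg]⟩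

lemma Th_ex : StrictMonoOn Xi (Ioo (-3) 3) ∧ ∃ g : ℝ → ℝ, Sm g ∧
    (∀ x, g x ∈ Ioo (-3:ℝ) 3 ∧ Xi (g x) = x) ∧ ∀ y ∈ Ioo (-3:ℝ) 3, g (Xi y) = y :=
  (inv_smooth isOpen_Ioo (fun _ h => Xi_sm h) (fun _ h => Xi_pos h) Xi_surj)
def Th : ℝ → ℝ := Th_ex.2.choose
lemma Xi_mono : StrictMonoOn Xi (Ioo (-3) 3) := Th_ex.1
lemma Th_sm : Sm Th := Th_ex.2.choose_spec.1
lemma Th_mem (x : ℝ) : Th x ∈ Ioo (-3:ℝ) 3 := (Th_ex.2.choose_spec.2.1 x).1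
lemma Xi_Th (x : ℝ) : Xi (Th x) = x := (Th_ex.2.choose_spec.2.1 x).2
lemma Th_Xi {y : ℝ} (h : y ∈ Ioo (-3:ℝ) 3) : Th (Xi y) = y := Th_ex.2.choose_spec.2.2 y h
lemma Th_mono : StrictMono Th := fun x y h => by
  rw [← Xi_mono.lt_iff_lt (Th_mem x) (Th_mem y), Xi_Th, Xi_Th]; exact h
lemma Th_odd (x : ℝ) : Th (-x) = - Th x := by
  have h := Th_mem x
  rw [← Th_Xi (y := - Th x) ⟨by linarith [h.2], by linarith [h.1]⟩, Xi_odd, Xi_Th]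
lemma Th_mid {x : ℝ} (h : |x| ≤ 1) : Th x = x := by
  obtain ⟨h1, h2⟩ := abs_le.1 h
  conv_lhs => rw [← Xi_mid h]
  exact Th_Xi ⟨by linarith, by linarith⟩
lemma Th_end {X : ℝ} (h : Real.exp 1 ≤ X) : Th (2 + X) = 3 - 1 / Real.log X := by
  obtain ⟨h1, h2, h3⟩ := Xi_end h
  rw [← h3, Th_Xi ⟨by linarith, h2⟩]

def ex : ℝ ≃ Subtype (fun y : ℝ => y ∈ Ioo (-3:ℝ) 3) where
  toFun x := ⟨Th x, Th_mem x⟩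
  invFun y := Xi y
  left_inv := Xi_Th
  right_inv y := Subtype.ext (Th_Xi y.2)

open Classical in
def CT (f : Equiv.Perm ℝ) : Equiv.Perm ℝ := f.extendDomain ex
lemma CT_mul (f g : Equiv.Perm ℝ) : CT (f * g) = CT f * CT g := (Equiv.Perm.extendDomain_mul _ _ _).symm
lemma CT_inv (f : Equiv.Perm ℝ) : CT f⁻¹ = (CT f)⁻¹ := (Equiv.Perm.extendDomain_inv _ _).symm
lemma CT_in (f : Equiv.Perm ℝ) {y : ℝ} (h : y ∈ Ioo (-3:ℝ) 3) : CT f y = Th (f (Xi y)) := by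
  unfold CT; rw [Equiv.Perm.extendDomain_apply_subtype _ _ h]; rfl
lemma CT_out (f : Equiv.Perm ℝ) {y : ℝ} (h : y ∉ Ioo (-3:ℝ) 3) : CT f y = y :=
  Equiv.Perm.extendDomain_apply_not_subtype _ _ h
lemma CT_sup (f : Equiv.Perm ℝ) : Sup 3 (CT f) := fun x hx => CT_out f fun h => by
  rw [le_abs'] at hx; rcases hx with hx | hx <;> linarith [h.1, h.2]
/-- elements supported in the middle are unchanged -/
lemma CT_id {f : Equiv.Perm ℝ} (h : Sup 1 f) : CT f = f := by
  have h0 : ∀ x, |x| < 1 → |f x| < 1 := fun x hx => by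
    by_contra h1
    have := h _ (not_lt.1 h1)
    rw [EmbeddingLike.apply_eq_iff_eq] at this
    rw [this] at h1; exact h1 hx
  ext y
  by_cases hy : y ∈ Ioo (-3:ℝ) 3
  · rw [CT_in f hy]
    rcases lt_or_ge |y| 1 with h1 | h1
    · rw [Xi_mid h1.le, Th_mid (h0 y h1).le]
    · rw [h y h1, h _ _, Th_Xi hy]
      rcases le_abs'.1 h1 with h2 | h2
      · have := Xi_mono.monotoneOn hy (show (-1:ℝ) ∈ Ioo (-3:ℝ) 3 by norm_num) h2
        rw [Xi_mid (show |(-1:ℝ)| ≤ 1 by norm_num)] at this; rw [le_abs']; left; exact this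
      · have := Xi_mono.monotoneOn (show (1:ℝ) ∈ Ioo (-3:ℝ) 3 by norm_num) hy h2
        rw [Xi_mid (show |(1:ℝ)| ≤ 1 by norm_num)] at this; rw [le_abs']; right; exact this
  · rw [CT_out f hy, h]
    by_contra h1
    exact hy ⟨by linarith [(abs_lt.1 (not_le.1 h1)).1], by linarith [(abs_lt.1 (not_le.1 h1)).2]⟩


lemma cut_ex {a b : ℝ} (h : a < b) : ∃ m : ℝ → ℝ, Sm m ∧ (∀ x, |x| ≤ a → m x = 1) ∧
    (∀ x, b ≤ |x| → m x = 0) ∧ ∀ x, 0 ≤ m x ∧ m x ≤ 1 := by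
  have hp : 0 < b - a := by linarith
  refine ⟨fun x => st ((b - x)/(b-a)) * st ((b + x)/(b-a)), ?_, fun x hx => ?_, fun x hx => ?_, fun x => ?_⟩
  · have h1 : Sm fun x : ℝ => (b - x)/(b-a) := by unfold Sm; fun_prop
    have h2 : Sm fun x : ℝ => (b + x)/(b-a) := by unfold Sm; fun_prop
    exact (st_sm.comp h1).mul (st_sm.comp h2)
  · obtain ⟨h1, h2⟩ := abs_le.1 hx
    simp only
    rw [st1, st1, one_mul] <;> rw [le_div_iff₀ hp] <;> linarith
  · simp only
    rcases le_abs'.1 hx with h1 | h1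
    · rw [st0 (x := (b+x)/(b-a)), mul_zero]; exact div_nonpos_of_nonpos_of_nonneg (by linarith) hp.le
    · rw [st0 (x := (b-x)/(b-a)), zero_mul]; exact div_nonpos_of_nonpos_of_nonneg (by linarith) hp.le
  · exact ⟨mul_nonneg (st_nn _) (st_nn _), mul_le_one₀ (st_le _) (st_nn _) (st_le _)⟩

lemma loc_sm {m g : ℝ → ℝ} {a b : ℝ} (h : a < b) (hm : Sm m) (hz : ∀ x, a ≤ |x| → m x = 0)
    (hg : ∀ x, |x| < b → ContDiffAt ℝ (⊤:ℕ∞) g x) : Sm (fun x => m x * g x) := by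
  refine contDiff_iff_contDiffAt.2 fun x => ?_
  rcases lt_or_ge |x| b with h1 | h1
  · exact hm.contDiffAt.mul (hg x h1)
  · have : (fun x => m x * g x) =ᶠ[𝓝 x] fun _ => 0 := by
      filter_upwards [(isOpen_lt continuous_const continuous_abs).mem_nhds (show a < |x| by linarith)] with y hy
      rw [hz y (le_of_lt hy), zero_mul]
    exact contDiffAt_const.congr_of_eventuallyEq this

def Eh (z : ℝ) : ℝ := expNegInvGlue z * st (2 - 3 * z)
def zc (z : ℝ) : ℝ := z * th z
def ell (c z : ℝ) : ℝ := Real.log (1 + c * Eh z)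
def Psi (c z : ℝ) : ℝ := zc z * zc z * ell c z * (1 + zc z * ell c z)⁻¹

lemma Eh_sm : Sm Eh := by
  have h1 : Sm fun x : ℝ => 2 - 3 * x := by unfold Sm; fun_prop
  exact expNegInvGlue.contDiff.mul (st_sm.comp h1)
lemma Eh_nn (z : ℝ) : 0 ≤ Eh z := mul_nonneg (expNegInvGlue.nonneg z) (st_nn _)
lemma Eh_np {z : ℝ} (h : z ≤ 0) : Eh z = 0 := by rw [Eh, expNegInvGlue.zero_of_nonpos h, zero_mul]
lemma Eh_big {z : ℝ} (h : 2/3 ≤ z) : Eh z = 0 := by rw [Eh, st0 (by linarith), mul_zero]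
lemma Eh_le (z : ℝ) : Eh z ≤ 1/4 := by
  rcases le_or_gt z 0 with h | h
  · rw [Eh_np h]; norm_num
  rcases le_or_gt (2/3) z with h2 | h2
  · rw [Eh_big h2]; norm_num
  have : expNegInvGlue z ≤ 1/4 := by
    rw [expNegInvGlue, if_neg (not_le.2 h), Real.exp_neg, one_div]
    refine inv_anti₀ (by norm_num) ?_
    have h3 : 3/2 ≤ z⁻¹ := by rw [le_inv_comm₀ (by norm_num) h]; norm_num; linarith
    have := Real.exp_one_gt_d9
    have h4 : Real.exp 1 * (1/2 + 1) ≤ Real.exp z⁻¹ := by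
      calc _ ≤ Real.exp 1 * Real.exp (1/2) := by
            gcongr; exact Real.add_one_le_exp _
        _ = Real.exp (3/2) := by rw [← Real.exp_add]; norm_num
        _ ≤ _ := Real.exp_le_exp.2 h3
    linarith
  calc Eh z ≤ 1/4 * 1 := mul_le_mul this (st_le _) (st_nn _) (by norm_num)
    _ = _ := mul_one _

lemma Eh_BS : BS Eh := BS.of_supp Eh_sm (B := 1) fun z hz => by
  rcases le_or_gt z 0 with h | h
  · exact Eh_np h
  · rw [abs_of_pos h] at hz; exact Eh_big (by linarith)
lemma zc_BS : BS zc := BS.of_supp (contDiff_id.mul th_sm) (B := 2) fun z hz => by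
  rw [zc, th0 hz.le, mul_zero]

lemma cE {c : ℝ} (hc : |c| ≤ 1) (z : ℝ) : |c * Eh z| ≤ 1/4 := by
  rw [abs_mul, abs_of_nonneg (Eh_nn z)]; nlinarith [Eh_le z, Eh_nn z, abs_nonneg c]
lemma ell_b {c : ℝ} (hc : |c| ≤ 1) (z : ℝ) : |ell c z| ≤ 1/3 := by
  obtain ⟨h1, h2⟩ := abs_le.1 (cE hc z)
  have p : 0 < 1 + c * Eh z := by linarith
  rw [abs_le, ell]
  constructor
  · have := Real.one_sub_inv_le_log_of_pos p
    have : (1 + c * Eh z)⁻¹ ≤ 4/3 := by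
      rw [inv_le_comm₀ p (by norm_num)]; norm_num; linarith
    linarith
  · have := Real.log_le_sub_one_of_pos p; linarith
lemma ell_np {c z : ℝ} (h : Eh z = 0) : ell c z = 0 := by simp [ell, h]
lemma zell {c : ℝ} (hc : |c| ≤ 1) (z : ℝ) : 1/2 ≤ 1 + zc z * ell c z := by
  rcases le_or_gt z 0 with h | h
  · rw [ell_np (Eh_np h)]; norm_num
  rcases le_or_gt (2/3) z with h2 | h2
  · rw [ell_np (Eh_big h2)]; norm_num
  have h3 := abs_le.1 (ell_b hc z)
  rw [zc, th1 (by rw [abs_of_pos h]; linarith), mul_one]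
  nlinarith

section
variable {ι : Type*} {l : Filter ι} {r : ℕ}
lemma ell_EB {c : ι → ℝ} (hc : ∀ i, |c i| ≤ 1) : EB l r (fun i => ell (c i)) := by
  have hE : ∀ r, EB l r (fun i x => c i * Eh x) := fun r =>
    (EB.const ⟨1, Eventually.of_forall hc⟩).mul (Eh_BS.eb r)
  have hlow : ∀ i z, 1/2 ≤ 1 + c i * Eh z := fun i z => by linarith [(abs_le.1 (cE (hc i) z)).1]
  have hs : ∀ i, Sm (fun x => 1 + c i * Eh x) := fun i => contDiff_const.add ((hE 0).1 i)
  have hS : ∀ i, Sm (ell (c i)) := fun i => (hs i).log fun x => by linarith [hlow i x]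
  have h0 : ∃ C : ℝ, ∀ᶠ i in l, ∀ x, |ell (c i) x| ≤ C := ⟨1/3, Eventually.of_forall fun i x => ell_b (hc i) x⟩
  rcases r with _ | r
  · exact EB.of_zero hS h0
  · refine EB.of_deriv hS h0 ?_
    have h1 := EB.inv (l := l) (u := fun i x => 1 + c i * Eh x) (c := 1/2) (by norm_num)
      ((EB.cst 1).add (hE r)) (fun i x => by linarith [hlow i x])
      (Eventually.of_forall fun i x => (hlow i x).trans (le_abs_self _))
    convert (hE (r+1)).deriv.mul h1 using 2 with i
    funext x
    have h2 := ((((hE 0).1 i).d x).hasDerivAt.const_add 1).log (by linarith [hlow i x])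
    rw [show ell (c i) = fun x => Real.log (1 + c i * Eh x) from rfl, h2.deriv]
    rfl

lemma Psi_EB {c : ι → ℝ} (hc : ∀ i, |c i| ≤ 1) : EB l r (fun i => Psi (c i)) := by
  have hz : EB l r (fun _ => zc) := zc_BS.eb r
  have he := ell_EB (l := l) (r := r) hc
  exact ((hz.mul hz).mul he).mul (EB.inv (c := 1/2) (by norm_num) ((EB.cst 1).add (hz.mul he))
    (fun i x => by linarith [zell (hc i) x])
    (Eventually.of_forall fun i x => (zell (hc i) x).trans (le_abs_self _)))
end

lemma Psi_np {c z : ℝ} (h : z ≤ 0) : Psi c z = 0 := by rw [Psi, ell_np (Eh_np h)]; simp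
lemma Psi_big {c z : ℝ} (h : 2/3 ≤ z) : Psi c z = 0 := by rw [Psi, ell_np (Eh_big h)]; simp

lemma Th_Psi {c z : ℝ} (hc : |c| ≤ 1) (h0 : 0 < z) (h1 : z ≤ 1/3) :
    Th (2 + Real.exp (1/z) + c) = 3 - z + Psi c z := by
  have hE : Eh z = Real.exp (-z⁻¹) := by
    rw [Eh, expNegInvGlue, if_neg (not_le.2 h0), st1 (by linarith), mul_one]
  have p := (abs_le.1 (cE hc z)).1
  have e1 : Real.exp (1/z) + c = Real.exp (1/z) * (1 + c * Eh z) := by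
    rw [hE, mul_add, mul_one, mul_comm c, ← mul_assoc, ← Real.exp_add]; simp
  have e3 : Real.exp 3 ≤ Real.exp (1/z) := Real.exp_le_exp.2 (by rw [le_div_iff₀ h0]; linarith)
  have e4 : Real.exp 1 + 1 ≤ Real.exp 3 := by
    have : Real.exp 3 = Real.exp 1 * Real.exp 2 := by rw [← Real.exp_add]; norm_num
    rw [this]; nlinarith [Real.add_one_le_exp 1, Real.add_one_le_exp 2]
  rw [add_assoc, Th_end (by linarith [(abs_le.1 hc).1]), e1, Real.log_mul (Real.exp_pos _).ne' (by linarith),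
    Real.log_exp]
  have hz : zc z = z := by rw [zc, th1 (by rw [abs_of_pos h0]; linarith), mul_one]
  have hl := zell hc z
  rw [Psi, hz, show Real.log (1 + c * Eh z) = ell c z from rfl]
  rw [hz] at hl
  have : 1/z + ell c z = (1 + z * ell c z)/z := by field_simp
  rw [this]
  field_simp
  ring


lemma CT_EB {ι : Type*} {l : Filter ι} {r : ℕ} {f : ι → Equiv.Perm ℝ} {u : ι → ℝ → ℝ} {c d : ι → ℝ}
    {X1 C : ℝ} (hf : ∀ i x, f i x = x + u i x) (hu : EB l r u) (hC : ∀ i x, |u i x| ≤ C)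
    (hc : ∀ i, |c i| ≤ 1) (hd : ∀ i, |d i| ≤ 1) (hR : ∀ i x, X1 ≤ x → u i x = c i)
    (hL : ∀ i x, x ≤ -X1 → u i x = d i) : EB l r (fun i => dsp (CT (f i))) := by
  set X := |X1| + 2 + Real.exp 3 with hX
  have e3 := Real.exp_pos 3
  have y1 : 3 - 1/3 ≤ Th X := by
    have := Th_end (X := Real.exp 3) (Real.exp_le_exp.2 (by norm_num))
    rw [Real.log_exp] at this; rw [← this]
    exact Th_mono.monotone (by rw [hX]; linarith [abs_nonneg X1])
  have y2 : Th X < Th (X+1) := Th_mono (by linarith)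
  have y3 : Th (X+1) < Th (X+2) := Th_mono (by linarith)
  have y4 := (Th_mem (X+2)).2
  obtain ⟨m, m1, m2, m3, -⟩ := cut_ex y2
  obtain ⟨n, n1, n2, n3, -⟩ := cut_ex y3
  obtain ⟨k, k1, k2, k3, -⟩ := cut_ex (show X + 1 + C < X + 2 + C by linarith)
  set ξ : ℝ → ℝ := fun y => n y * (Xi y - y) with hξ
  have ξs : BS ξ := BS.of_supp (loc_sm y4 n1 n3 fun x hx => (Xi_sm ⟨by linarith [(abs_lt.1 hx).1],
    (abs_lt.1 hx).2⟩).sub contDiffAt_id) (B := Th (X+2)) fun x hx => by rw [hξ]; simp [n3 x hx.le]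
  have ks : BS (fun x => k x * Th x) := BS.of_supp (k1.mul Th_sm) (B := X+2+C) fun x hx => by
    simp [k3 x hx.le]
  have ms : BS m := BS.of_supp m1 (B := Th (X+1)) fun x hx => m3 x hx.le
  have mys : BS (fun y => m y * y) := BS.of_supp (m1.mul contDiff_id) (B := Th (X+1)) fun x hx => by
    simp [m3 x hx.le]
  have hP := (Psi_EB (l := l) (r := r) hc).affine (-1) 3
  have hN := (Psi_EB (l := l) (r := r) (c := fun i => - d i) (fun i => by rw [abs_neg]; exact hd i)).affine 1 3
  have hM : EB l r (fun i y => k (y + (ξ y + u i (y + ξ y))) * Th (y + (ξ y + u i (y + ξ y)))) :=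
    (ks.eb r).comp1 ((ξs.eb r).add (hu.comp1 (ξs.eb r)))
  have hT := ((((ms.eb r).mul hM).sub (mys.eb r)).add (((EB.cst 1).sub (ms.eb r)).mul (hP.sub hN)))
  convert hT using 2 with i
  funext y
  have A : |y| ≤ Th (X+1) → dsp (CT (f i)) y =
      k (y + (ξ y + u i (y + ξ y))) * Th (y + (ξ y + u i (y + ξ y))) - y := by
    intro hy
    obtain ⟨q1, q2⟩ := abs_le.1 hy
    have hm : y ∈ Ioo (-3:ℝ) 3 := ⟨by linarith, by linarith⟩
    have e1 : y + ξ y = Xi y := by simp only [hξ]; rw [n2 y hy]; ring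
    have e2 : y + (ξ y + u i (y + ξ y)) = f i (Xi y) := by rw [hf, ← e1]; ring
    have b1 : |Xi y| ≤ X + 1 := by
      have t1 := Xi_mono.monotoneOn hm (Th_mem (X+1)) q2
      have hm' : -Th (X+1) ∈ Ioo (-3:ℝ) 3 := ⟨by linarith, by linarith⟩
      have t2 := Xi_mono.monotoneOn hm' hm q1
      rw [Xi_odd] at t2
      rw [Xi_Th] at t1 t2
      exact abs_le.2 ⟨t2, t1⟩
    rw [e2, k2, one_mul, dsp, CT_in _ hm]
    rw [hf]; exact (abs_add_le _ _).trans (add_le_add b1 (hC i _))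
  have B : Th X ≤ y → dsp (CT (f i)) y = Psi (c i) (3 - y) := by
    intro hy
    rcases lt_or_ge y 3 with h | h
    · have hm : y ∈ Ioo (-3:ℝ) 3 := ⟨by linarith, by linarith⟩
      have b1 : X ≤ Xi y := by
        have := Xi_mono.monotoneOn (Th_mem X) hm hy; rwa [Xi_Th] at this
      rw [dsp, CT_in _ hm, hf, hR i _ (by linarith [le_abs_self X1]), Xi_top (by linarith),
        Th_Psi (hc i) (by linarith) (by linarith)]
      ring
    · rw [dsp, CT_out _ (fun hm => by linarith [hm.2]), Psi_np (by linarith), sub_self]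
  have B' : y ≤ - Th X → dsp (CT (f i)) y = - Psi (- d i) (3 + y) := by
    intro hy
    rcases lt_or_ge (-3) y with h | h
    · have hm : y ∈ Ioo (-3:ℝ) 3 := ⟨by linarith, by linarith⟩
      have hm' : -y ∈ Ioo (-3:ℝ) 3 := ⟨by linarith, by linarith⟩
      have b1 : X ≤ Xi (-y) := by
        have := Xi_mono.monotoneOn (Th_mem X) hm' (by linarith); rwa [Xi_Th] at this
      have e1 : Xi y = - Xi (-y) := by rw [Xi_odd, neg_neg]
      rw [dsp, CT_in _ hm, hf, e1, hL i _ (by linarith [le_abs_self X1]),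
        show -Xi (-y) + d i = - (Xi (-y) + (-d i)) by ring, Th_odd, Xi_top (by linarith), sub_neg_eq_add,
        Th_Psi (by rw [abs_neg]; exact hd i) (by linarith) (by linarith)]
      ring
    · rw [dsp, CT_out _ (fun hm => by linarith [hm.1]), Psi_np (by linarith), sub_self, neg_zero]
  have B2 : Th X ≤ |y| → dsp (CT (f i)) y = Psi (c i) (-1 * y + 3) - Psi (- d i) (1 * y + 3) := by
    intro hy
    rw [show -1 * y + 3 = 3 - y by ring, show 1 * y + 3 = 3 + y by ring]
    rcases le_abs'.1 hy with h | h
    · rw [B' h, Psi_big (c := c i) (by linarith)]; ring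
    · rw [B h, Psi_big (c := - d i) (by linarith)]; ring
  rcases le_total |y| (Th X) with h | h
  · rw [A (h.trans y2.le), m2 y h]; ring
  · rcases le_total |y| (Th (X+1)) with h' | h'
    · have := A h'
      rw [eq_sub_iff_add_eq] at this
      rw [← B2 h, ← this]; ring
    · rw [← B2 h, m3 y h']; ring

lemma CT_DF {f : Equiv.Perm ℝ} (hf : DF f) (hs : Sm (dsp (CT f))) : DF (CT f) := by
  have e : (CT f : ℝ → ℝ) = fun x => x + dsp (CT f) x := funext (dsp_eq _)
  have hS : Sm (CT f) := by rw [e]; exact contDiff_id.add hs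
  refine ⟨hS, fun y => ?_⟩
  by_cases hy : y ∈ Ioo (-3:ℝ) 3
  · have h1 := (Xi_sm hy).differentiableAt (by simp)
    have h2 := (Th_sm.d (f (Xi y))).hasDerivAt.comp y ((hf.1.d (Xi y)).hasDerivAt.comp y h1.hasDerivAt)
    have h3 : (CT f : ℝ → ℝ) =ᶠ[𝓝 y] Th ∘ (f ∘ Xi) := by
      filter_upwards [isOpen_Ioo.mem_nhds hy] with x hx
      exact CT_in f hx
    rw [h3.deriv_eq, h2.deriv]
    refine mul_pos ?_ (mul_pos (hf.2 _) (Xi_pos hy))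
    have h4 := ((Xi_sm (Th_mem (f (Xi y)))).differentiableAt (by simp)).hasDerivAt.comp _ (Th_sm.d (f (Xi y))).hasDerivAt
    have h5 : Xi ∘ Th = fun x => x := funext Xi_Th
    rw [h5] at h4
    have h6 := h4.unique (hasDerivAt_id _)
    have := Xi_pos (Th_mem (f (Xi y)))
    by_contra h
    nlinarith
  · have hz : ∀ x, 3 < |x| → deriv (dsp (CT f)) x = 0 := fun x hx => by
      have := iter_zero_of_zero (isOpen_lt continuous_const continuous_abs) (U := {x : ℝ | 3 < |x|})
        (u := dsp (CT f)) (fun x hx => by rw [dsp, CT_sup f x (le_of_lt hx), sub_self]) 1 x hx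
      simpa using this
    have h0 : deriv (dsp (CT f)) y = 0 := by
      have hc : IsClosed {x | deriv (dsp (CT f)) x = 0} :=
        isClosed_eq hs.deriv.continuous continuous_const
      have : y ∈ closure {x : ℝ | 3 < |x|} := by
        rw [mem_Ioo, not_and_or, not_lt, not_lt] at hy
        rcases hy with h | h
        · have : closure (Iio (-3:ℝ)) ⊆ closure {x : ℝ | 3 < |x|} := closure_mono fun x hx => by
            show 3 < |x|; rw [lt_abs]; right; linarith [mem_Iio.1 hx]
          exact this (by rw [closure_Iio]; exact h)
        · have : closure (Ioi (3:ℝ)) ⊆ closure {x : ℝ | 3 < |x|} := closure_mono fun x hx => by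
            show 3 < |x|; rw [lt_abs]; left; exact hx
          exact this (by rw [closure_Ioi]; exact h)
      exact hc.closure_subset_iff.2 (fun x hx => hz x hx) this
    rw [e, deriv_fun_add differentiableAt_fun_id (hs.d y), h0, deriv_id'']; norm_num


lemma Xi_ge {y : ℝ} (h : y ∈ Ioo (-3:ℝ) 3) : 1/4 ≤ deriv Xi y := by
  rw [(Xi_hd h).deriv]
  have n1 : 0 < (3 - y) := by linarith [h.2]
  have n2 : 0 < (3 + y) := by linarith [h.1]
  have e1 : 1 < Real.exp (1/(3-y)) := Real.one_lt_exp_iff.2 (by positivity)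
  have e2 : 1 < Real.exp (1/(3+y)) := Real.one_lt_exp_iff.2 (by positivity)
  have s1 : 0 ≤ deriv st (y-1) := st_mono.deriv_nonneg
  have s2 : 0 ≤ deriv st (-y-1) := st_mono.deriv_nonneg
  have p1 : 0 ≤ deriv st (y-1) * (2 + Real.exp (1/(3-y)) - y) := mul_nonneg s1 (by linarith)
  have p2 : 0 ≤ deriv st (-y-1) * (2 + Real.exp (1/(3+y)) + y) := mul_nonneg s2 (by linarith)
  have key : ∀ t E, 0 < t → 1 < E → 1/4 ≤ 1 + st (2 - t) * (E * (1/t^2) - 1) := fun t E ht hE => by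
    rcases le_total 2 t with h2 | h2
    · rw [st0 (by linarith)]; norm_num
    · have : 1/4 ≤ 1/t^2 := one_div_le_one_div_of_le (by positivity) (by nlinarith)
      nlinarith [st_nn (2-t), st_le (2-t), mul_le_mul hE.le this (by norm_num) (by linarith)]
  rcases le_total y 0 with h0 | h0
  · rw [st0 (show y - 1 ≤ 0 by linarith)]
    have := key _ _ n2 e2
    rw [show 2 - (3 + y) = -y - 1 by ring] at this
    linarith
  · rw [st0 (show -y - 1 ≤ 0 by linarith)]
    have := key _ _ n1 e1
    rw [show 2 - (3 - y) = y - 1 by ring] at this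
    linarith

lemma Th_lip (x y : ℝ) : |Th y - Th x| ≤ 4 * |y - x| := by
  have hb : ∀ x, ‖deriv Th x‖ ≤ 4 := fun x => by
    have h4 := ((Xi_sm (Th_mem x)).differentiableAt (by simp)).hasDerivAt.comp x (Th_sm.d x).hasDerivAt
    have h5 : Xi ∘ Th = fun x => x := funext Xi_Th
    rw [h5] at h4
    have h6 := h4.unique (hasDerivAt_id _)
    have h7 := Xi_ge (Th_mem x)
    have h8 : 0 ≤ deriv Th x := Th_mono.monotone.deriv_nonneg
    rw [Real.norm_of_nonneg h8]
    nlinarith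
  exact Convex.norm_image_sub_le_of_norm_deriv_le (fun x _ => Th_sm.d x) (fun x _ => hb x) convex_univ
    (mem_univ x) (mem_univ y)

lemma CT_C0 {f : Equiv.Perm ℝ} {ε : ℝ} (h : ∀ x, |dsp f x| ≤ ε) (y : ℝ) : |dsp (CT f) y| ≤ 4 * ε := by
  by_cases hy : y ∈ Ioo (-3:ℝ) 3
  · have := Th_lip (Xi y) (f (Xi y))
    rw [Th_Xi hy] at this
    rw [dsp, CT_in f hy]
    exact this.trans (by have := h (Xi y); unfold dsp at this; linarith)
  · rw [dsp, CT_out f hy, sub_self, abs_zero]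
    linarith [(abs_nonneg _).trans (h 0)]

lemma st_BS : BS st := by
  have hd : BS (deriv st) := BS.of_supp st_sm.deriv (B := 1) fun x hx => by
    rcases lt_abs.1 hx with h | h
    · have : st =ᶠ[𝓝 x] fun _ => 1 := by
        filter_upwards [lt_mem_nhds h] with y hy using st1 (le_of_lt hy)
      rw [this.deriv_eq]; simp
    · have : st =ᶠ[𝓝 x] fun _ => 0 := by
        filter_upwards [gt_mem_nhds (show x < 0 by linarith)] with y hy using st0 (le_of_lt hy)
      rw [this.deriv_eq]; simp
  refine BS.mk st_sm fun s => ?_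
  rcases s with _ | s
  · exact ⟨1, fun x => by simpa [abs_of_nonneg (st_nn x)] using st_le x⟩
  · rw [iteratedDeriv_succ']; exact hd.bd s

lemma EB_of_nr {ι : Type*} {l : Filter ι} {r : ℕ} {u : ι → ℝ → ℝ} (hu : ∀ i, BS (u i))
    (h : ∃ C : ℝ, ∀ᶠ i in l, nr (r+1) (u i) ≤ C) : EB l r u := by
  obtain ⟨C, hC⟩ := h
  exact ⟨fun i => (hu i).sm, fun s hs => ⟨C, hC.mono fun i hi x =>
    ((hu i).le s x).trans ((NN_le_nr (by omega) _).trans hi)⟩⟩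

def eta (x : ℝ) : ℝ := st (-1 * x + 4)
def rho (x : ℝ) : ℝ := st (1 * x + 1)
lemma eta_BS : BS eta := st_BS.affine (-1) 4
lemma rho_BS : BS rho := st_BS.affine 1 1
lemma eta1 {x : ℝ} (h : x ≤ 3) : eta x = 1 := st1 (by linarith)
lemma eta0 {x : ℝ} (h : 4 ≤ x) : eta x = 0 := st0 (by linarith)
lemma rho1 {x : ℝ} (h : 0 ≤ x) : rho x = 1 := st1 (by linarith)
lemma rho0 {x : ℝ} (h : x ≤ -1) : rho x = 0 := st0 (by linarith)

def ga (A : ℕ) (e z : ℝ → ℝ) (x : ℝ) : ℝ := Ga A e z x - Ga A e z 0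
def uy (A : ℕ) (e z : ℝ → ℝ) (x : ℝ) : ℝ := Ga A e z 0 + eta x * ga A e z x
def uy' (A : ℕ) (e z : ℝ → ℝ) (x : ℝ) : ℝ := rho x * (eta x * ga A e z x)

abbrev Tr : Equiv.Perm ℝ := Equiv.addRight (1:ℝ)

section
variable {A : ℕ} {η : ℝ} {e z : ℝ → ℝ}

lemma Ga_left (cd : CD A η) (h : OK A η e z) {x : ℝ} (hx : x ≤ -(2*A+8)) : Ga A e z x = 0 :=
  gam_left (A := A) (ph_S (by have := cd.A1; omega) h.se h.sz) (by linarith) _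

lemma Ga_rel (cd : CD A η) (h : OK A η e z) {x : ℝ} (hx : x ≤ 8) :
    Ga A e z x = ph A e z (x + (A+8)) + Ga A e z (x + ph A e z (x + (A+8)) - 1) := by
  unfold Ga
  rw [gam_fix (h.phb cd) (ph_S (by have := cd.A1; omega) h.se h.sz) (by linarith)]
  ring_nf

lemma line_id (cd : CD A η) (h : OK A η e z) (hz : Zn (Ga A e z) z = z)
    {y y' q F : Equiv.Perm ℝ} (hy : ∀ x, y x = x + uy A e z x) (hy' : ∀ x, y' x = x + uy' A e z x)
    (hq : ∀ x, q x = x + z x) (hF : ∀ x, F x = x + ph A e z (x + (A+8)))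
    (my' : StrictMono y') (mq : StrictMono q) :
    (y⁻¹ * Tr * y * Tr⁻¹) * (y'⁻¹ * Tr * y' * Tr⁻¹)⁻¹ = F⁻¹ * q := by
  have ph0 : ∀ t, -8 ≤ t → ph A e z (t + (A+8)) = 0 := fun t ht => by
    refine ph_S (by have := cd.A1; omega) h.se h.sz _ ?_
    rw [abs_of_nonneg] <;> linarith [(Nat.cast_nonneg A : (0:ℝ) ≤ A)]
  have w0 : ga A e z 0 = 0 := sub_self _
  have wp : ∀ x, -8 ≤ x → x ≤ 8 → ga A e z x = ga A e z (x-1) := fun x h1 h2 => by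
    unfold ga; rw [h.per cd h1 h2]
  have q0 : ∀ x, 1 ≤ |x| → q x = x := fun x hx => by rw [hq, h.sz x hx, add_zero]
  have key1 : ∀ x ≤ 5/2, y' (q x - 1) + 1 = y' x := by
    intro x hx
    have hq3 : q x ≤ 5/2 := by
      have := mq.monotone hx; rwa [q0 (5/2) (by norm_num)] at this
    rw [hy', hy', uy', uy', eta1 (by linarith), eta1 (by linarith)]
    rcases lt_or_ge |x| (3/2) with h1 | h1
    · have e1 := congrFun hz x
      obtain ⟨a1, a2⟩ := abs_lt.1 h1
      have b1 := mq a1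
      have b2 := mq a2
      rw [q0 (-(3/2)) (by norm_num)] at b1
      rw [q0 (3/2) (by norm_num)] at b2
      have hqa : |q x| ≤ 3/2 := abs_le.2 ⟨b1.le, b2.le⟩
      unfold Zn at e1
      rw [← hq, rt, rt1, th1 h1.le, th1 hqa] at e1
      rw [← wp (q x) (by linarith) (by linarith)]
      have e2 : rho (q x - 1) = st (q x) := by unfold rho; congr 1; ring
      have e3 : rho x = st (x+1) := by unfold rho; congr 1; ring
      rw [e2, e3]
      unfold ga
      linear_combination - e1 + hq x
    · rw [q0 x (by linarith)]
      rcases le_abs'.1 h1 with h2 | h2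
      · rw [rho0 (by linarith), rho0 (by linarith)]; ring
      · rw [rho1 (by linarith), rho1 (by linarith), wp x (by linarith) (by linarith)]; ring
  have key2 : ∀ t ≤ 3, y t = y (F t - 1) + 1 := by
    intro t ht
    have hFt : F t - 1 ≤ 3 := by
      rcases le_total (-8) t with h1 | h1
      · rw [hF, ph0 t h1]; linarith
      · rw [hF]; linarith [(abs_le.1 (h.phb cd (t + (A+8)))).2]
    rw [hy, hy, uy, uy, eta1 ht, eta1 hFt]
    unfold ga
    have := Ga_rel cd h (show t ≤ 8 by linarith)
    rw [← hF] at this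
    linear_combination this - hF t
  have hc : ∀ x, 0 ≤ x → y x = y' x + Ga A e z 0 := fun x hx => by
    rw [hy, hy', uy, uy', rho1 hx]; ring
  have ya : ∀ a, y' (y'⁻¹ a) = a := fun a => y'.apply_symm_apply a
  have main : Tr * y * y'⁻¹ * Tr⁻¹ * y' = y * F⁻¹ * q := by
    ext x
    show y (y'⁻¹ (y' x + (-1))) + 1 = y (F⁻¹ (q x))
    rcases le_total x (5/2) with hx | hx
    · have e1 : y'⁻¹ (y' x + (-1)) = q x - 1 := by
        rw [Equiv.Perm.inv_eq_iff_eq, ← key1 x hx]; ring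
      have hq3 : q x ≤ 5/2 := by
        have := mq.monotone hx; rwa [q0 (5/2) (by norm_num)] at this
      have e2 : F (F⁻¹ (q x)) = q x := F.apply_symm_apply _
      have ht : F⁻¹ (q x) ≤ 3 := by
        by_contra h1
        have h2 := hF (F⁻¹ (q x))
        rw [ph0 _ (by linarith), e2] at h2
        linarith
      rw [e1, key2 _ ht, e2]
    · have e1 : q x = x := q0 x (by rw [le_abs']; right; linarith)
      have e2 : F⁻¹ x = x := by rw [Equiv.Perm.inv_eq_iff_eq, hF, ph0 x (by linarith), add_zero]
      rw [e1, e2, hc x (by linarith)]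
      have m1 : y' 1 = 1 := by
        rw [hy', uy', wp 1 (by norm_num) (by norm_num), sub_self, w0]; ring
      have m0 : y' 0 = 0 := by rw [hy', uy', w0]; ring
      have p0 : 0 ≤ y'⁻¹ (y' x + (-1)) := by
        rw [← my'.le_iff_le, m0, ya]
        have := my'.monotone (show 1 ≤ x by linarith)
        linarith
      rw [hc _ p0, ya]; ring
  have := congrArg (fun g => y⁻¹ * g) main
  simp only [← mul_assoc, inv_mul_cancel, one_mul] at this
  rw [← this]
  group

end

lemma mul_c1 {a g : ℝ → ℝ} {E N : ℝ} (ha : Sm a) (hg : Sm g) (E0 : 0 ≤ E)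
    (h1 : ∀ x, |a x| ≤ E ∧ |deriv a x| ≤ E) (h2 : ∀ x, |g x| ≤ N ∧ |deriv g x| ≤ N) (x : ℝ) :
    |a x * g x| ≤ 2 * E * N ∧ |deriv (fun x => a x * g x) x| ≤ 2 * E * N := by
  have N0 : 0 ≤ N := (abs_nonneg _).trans (h2 x).1
  have b : ∀ p q : ℝ, |p| ≤ E → |q| ≤ N → |p * q| ≤ E * N := fun p q hp hq => by
    rw [abs_mul]; exact mul_le_mul hp hq (abs_nonneg _) E0
  constructor
  · have := b _ _ (h1 x).1 (h2 x).1
    nlinarith [mul_nonneg E0 N0]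
  · rw [deriv_fun_mul (ha.d x) (hg.d x)]
    have e1 := b _ _ (h1 x).2 (h2 x).1
    have e2 := b _ _ (h1 x).1 (h2 x).2
    linarith [abs_add_le (deriv a x * g x) (a x * deriv g x)]

lemma uy_BS {A : ℕ} {e z : ℝ → ℝ} (he : BS e) (hz : BS z) : BS (uy A e z) :=
  (BS.cst _).add (eta_BS.mul (Gw_BS he hz))
lemma uy'_BS {A : ℕ} {e z : ℝ → ℝ} (he : BS e) (hz : BS z) : BS (uy' A e z) :=
  rho_BS.mul (eta_BS.mul (Gw_BS he hz))

def adm (δ : ℝ) (e : ℝ → ℝ) : Prop := BS e ∧ S1p e ∧ nr 5 e ≤ δ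

lemma lin0 : ∃ (A : ℕ) (η : ℝ), CD A η ∧ ∃ δ > 0, ∃ C ≥ (0:ℝ), ∃ Z : (ℝ → ℝ) → ℝ → ℝ,
    δ ≤ 1/2 ∧
    (∀ e, adm δ e → OK A η e (Z e) ∧ Zn (Ga A e (Z e)) (Z e) = Z e ∧ |Ga A e (Z e) 0| ≤ 1 ∧
      (∀ x, |Z e x| ≤ C * nr 5 e ∧ |uy A e (Z e) x| ≤ C * nr 5 e ∧ |uy' A e (Z e) x| ≤ C * nr 5 e) ∧
      (∀ x, |deriv (Z e) x| ≤ 1/2 ∧ |deriv (uy A e (Z e)) x| ≤ 1/2 ∧ |deriv (uy' A e (Z e)) x| ≤ 1/2)) ∧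
    ∀ s M, ∃ C', ∀ e, adm δ e → nr s e ≤ M →
      nr s (Z e) ≤ C' ∧ nr s (uy A e (Z e)) ≤ C' ∧ nr s (uy' A e (Z e)) ≤ C' := by
  obtain ⟨A, η, cd, δ0, hδ0, C, hC, hle, ex, hi⟩ := picard
  have hA : 1 ≤ A := by have := cd.A1; omega
  have η1 : η ≤ 1/2 := by
    have h1 := cd.sm
    have h2 : (1000:ℝ) ≤ A := by exact_mod_cast cd.A1
    nlinarith [cd.p]
  obtain ⟨C1, hC1, soft⟩ := Ga_soft A 5 hA η
  obtain ⟨E, E1, hE⟩ : ∃ E : ℝ, 1 ≤ E ∧ ∀ x, (|eta x| ≤ E ∧ |deriv eta x| ≤ E) ∧ |rho x| ≤ E ∧ |deriv rho x| ≤ E := by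
    have n1 := NN_nonneg 0 eta
    have n2 := NN_nonneg 1 eta
    have n3 := NN_nonneg 0 rho
    have n4 := NN_nonneg 1 rho
    refine ⟨1 + NN 0 eta + NN 1 eta + NN 0 rho + NN 1 rho, by linarith, fun x => ?_⟩
    have := eta_BS.le0 x
    have := eta_BS.le1 x
    have := rho_BS.le0 x
    have := rho_BS.le1 x
    refine ⟨⟨?_, ?_⟩, ?_, ?_⟩ <;> linarith
  set L := C1 * (1 + C) with hL
  have L0 : 0 ≤ L := by positivity
  set CC := C + L + 8 * E * E * L + 4 * E * L with hCC
  have CC0 : 0 ≤ CC := by positivity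
  choose! Z hZ using ex
  have main : ∀ e, adm (min δ0 (1 / (2 * (CC + 1)))) e → OK A η e (Z e) ∧ Zn (Ga A e (Z e)) (Z e) = Z e ∧ |Ga A e (Z e) 0| ≤ 1 ∧
      (∀ x, |Z e x| ≤ CC * nr 5 e ∧ |uy A e (Z e) x| ≤ CC * nr 5 e ∧ |uy' A e (Z e) x| ≤ CC * nr 5 e) ∧
      (∀ x, |deriv (Z e) x| ≤ 1/2 ∧ |deriv (uy A e (Z e)) x| ≤ 1/2 ∧ |deriv (uy' A e (Z e)) x| ≤ 1/2) := by
    rintro e ⟨he, se, hn⟩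
    have n1 := hn.trans (min_le_left _ _)
    have n2 := hn.trans (min_le_right _ _)
    rw [le_div_iff₀ (by positivity)] at n2
    obtain ⟨ok, fx, nz⟩ := hZ e he se n1
    have ne0 := nr_nonneg 5 e
    have hG := soft e (Z e) he ok.z ok.ne ok.nz
    have hG2 : nr 5 (Ga A e (Z e)) ≤ L * nr 5 e := hG.trans (by rw [hL, mul_assoc]; gcongr; linarith)
    set N := L * nr 5 e with hN
    have N0 : 0 ≤ N := by positivity
    have BG := Ga_BS (A := A) he ok.z
    have g0 : ∀ x, |Ga A e (Z e) x| ≤ N := fun x =>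
      (BG.le0 x).trans ((NN_le_nr (by norm_num) _).trans hG2)
    have g1 : ∀ x, |deriv (Ga A e (Z e)) x| ≤ N := fun x =>
      (BG.le1 x).trans ((NN_le_nr (by norm_num) _).trans hG2)
    have w1 : ∀ x, |ga A e (Z e) x| ≤ 2 * N ∧ |deriv (ga A e (Z e)) x| ≤ 2 * N := fun x => by
      constructor
      · unfold ga; linarith [abs_sub (Ga A e (Z e) x) (Ga A e (Z e) 0), g0 x, g0 0]
      · have : deriv (ga A e (Z e)) x = deriv (Ga A e (Z e)) x := by
          unfold ga; rw [deriv_sub_const]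
        rw [this]; linarith [g1 x]
    have E0 : 0 ≤ E := by linarith
    have w2 := mul_c1 eta_BS.sm (Gw_BS (A := A) he ok.z).sm E0 (fun x => (hE x).1) w1
    have w3 := mul_c1 rho_BS.sm (eta_BS.mul (Gw_BS (A := A) he ok.z)).sm E0 (fun x => (hE x).2) w2
    have k1 : CC * nr 5 e = C * nr 5 e + N + 8 * E * E * N + 4 * E * N := by rw [hCC, hN]; ring
    have p1 : 0 ≤ 8 * E * E * N := by positivity
    have p2 : 0 ≤ 4 * E * N := by positivity
    have p3 : 0 ≤ C * nr 5 e := by positivity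
    have k2 : CC * nr 5 e ≤ 1/2 := by nlinarith
    refine ⟨ok, fx, (g0 0).trans (by linarith), fun x => ⟨?_, ?_, ?_⟩, fun x => ⟨?_, ?_, ?_⟩⟩
    · have := (ok.z.le0 x).trans ((NN_le_nr (by norm_num : 0 < 5) _).trans nz); linarith
    · have := (w2 x).1
      have h3 : |uy A e (Z e) x| ≤ |Ga A e (Z e) 0| + |eta x * ga A e (Z e) x| := abs_add_le _ _
      have h4 : |eta x * ga A e (Z e) x| ≤ 2 * E * (2 * N) := this
      linarith [g0 0]
    · have h4 : |uy' A e (Z e) x| ≤ 2 * E * (2 * E * (2 * N)) := (w3 x).1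
      linarith
    · exact (ok.z.le1 x).trans ((NN_le_nr (by norm_num : 1 < 5) _).trans (ok.nz.trans η1))
    · have : deriv (uy A e (Z e)) x = deriv (fun x => eta x * (Ga A e (Z e) x - Ga A e (Z e) 0)) x := by
        unfold uy ga; rw [deriv_const_add]
      rw [this]; linarith [(w2 x).2]
    · have h4 : |deriv (uy' A e (Z e)) x| ≤ 2 * E * (2 * E * (2 * N)) := (w3 x).2
      linarith
  refine ⟨A, η, cd, min δ0 (1 / (2 * (CC + 1))), by positivity, CC, CC0, Z, ?_, main, ?_⟩
  · refine (min_le_right _ _).trans ?_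
    rw [div_le_div_iff₀ (by positivity) (by norm_num)]; linarith
  · intro s M
    obtain ⟨C', h'⟩ := hi s M
    obtain ⟨D, hD, sf⟩ := Ga_soft A s hA (max M C')
    set K1 := D * (M + C') + s with hK1
    set K2 := s * 2^s * (nr s eta * K1) with hK2
    refine ⟨max C' (max (s + K2) (s * 2^s * (nr s rho * K2))) , fun e ha hM => ?_⟩
    obtain ⟨ok, fx, g1, -, -⟩ := main e ha
    have z1 := h' e (Z e) ok fx hM
    have z2 := sf e (Z e) ok.e ok.z (hM.trans (le_max_left _ _)) (z1.trans (le_max_right _ _))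
    have c1 : nr s (fun _ : ℝ => Ga A e (Z e) 0) ≤ s := (nr_cst s _).trans (by nlinarith [(Nat.cast_nonneg s : (0:ℝ) ≤ s)])
    have z3 : nr s (fun x => Ga A e (Z e) x - Ga A e (Z e) 0) ≤ K1 := by
      have := nr_sub (Ga_BS (A := A) ok.e ok.z) (BS.cst (Ga A e (Z e) 0)) s
      have h5 : D * (nr s e + nr s (Z e)) ≤ D * (M + C') := by gcongr
      linarith
    have z4 : nr s (fun x => eta x * (Ga A e (Z e) x - Ga A e (Z e) 0)) ≤ K2 := by
      refine (nr_mul eta_BS (Gw_BS (A := A) ok.e ok.z) s).trans ?_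
      rw [hK2]; have := nr_nonneg s eta; gcongr
    have z5 : nr s (uy A e (Z e)) ≤ s + K2 := by
      have := nr_add (BS.cst (Ga A e (Z e) 0)) (eta_BS.mul (Gw_BS (A := A) ok.e ok.z)) s
      exact this.trans (by linarith)
    have z6 : nr s (uy' A e (Z e)) ≤ s * 2^s * (nr s rho * K2) := by
      refine (nr_mul rho_BS (eta_BS.mul (Gw_BS (A := A) ok.e ok.z)) s).trans ?_
      have := nr_nonneg s rho; gcongr
    exact ⟨z1.trans (le_max_left _ _), z5.trans ((le_max_left _ _).trans (le_max_right _ _)),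
      z6.trans ((le_max_right _ _).trans (le_max_right _ _))⟩

def WW {G : Type*} [Group G] (T D y y' q : G) : G :=
  D⁻¹ * ((y⁻¹ * T * y * T⁻¹) * (y'⁻¹ * T * y' * T⁻¹)⁻¹) * D * (D⁻¹ * q⁻¹ * D * q)

lemma CT_WW (T D y y' q : Equiv.Perm ℝ) : CT (WW T D y y' q) = WW (CT T) (CT D) (CT y) (CT y') (CT q) := by
  simp only [WW, CT_mul, CT_inv]

lemma D_ex {A : ℕ} (hA : 1000 ≤ A) : ∃ D : Equiv.Perm ℝ, DF D ∧
    (∀ x, |x| ≤ 1 → D x = A * x - (A+8)) ∧ Sup (6*A+50) D := by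
  have hA' : (1000:ℝ) ≤ A := by exact_mod_cast hA
  obtain ⟨g, hg, h1, h2⟩ := ctr_spec (lam := 1/(A:ℝ)) (by positivity)
    (by rw [div_lt_one (by positivity)]; linarith) (((A:ℝ)+8)/(A-1)) (R := 3*A+20) (by positivity)
  set p := ((A:ℝ)+8)/(A-1) with hp
  have hpe : p * (A-1) = A + 8 := by rw [hp]; field_simp [show (A:ℝ) - 1 ≠ 0 by linarith]
  have hp2 : p ≤ 2 := by nlinarith
  have hp0 : 0 ≤ p := by nlinarith
  refine ⟨g⁻¹, hg.inv, fun x hx => ?_, Sup.inv fun x hx => h2 x ?_⟩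
  · obtain ⟨a1, a2⟩ := abs_le.1 hx
    rw [Equiv.Perm.inv_eq_iff_eq, h1]
    · have : (A:ℝ) ≠ 0 := by positivity
      clear_value p; field_simp; linear_combination -hpe
    · rw [abs_le]; constructor <;> nlinarith
  · have := abs_sub_abs_le_abs_sub x p
    rw [abs_of_nonneg hp0] at this; linarith

lemma F_id {A : ℕ} (hA : 1000 ≤ A) {D f q : Equiv.Perm ℝ} {e z : ℝ → ℝ} (hD : DF D)
    (h1 : ∀ x, |x| ≤ 1 → D x = A * x - (A+8)) (he : S1p e) (hz : S1p z) (hf : ∀ x, f x = x + e x)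
    (hq : ∀ x, q x = x + z x) (mm : StrictMono (q * f)) (x : ℝ) :
    (D * (q * f) * D⁻¹) x = x + ph A e z (x + (A+8)) := by
  have hA' : (1000:ℝ) ≤ A := by exact_mod_cast hA
  have hqf : ∀ t, (q * f) t = t + PP e z t := fun t => by
    show q (f t) = _
    rw [hq, hf, PP]; ring
  have fix : ∀ t, 1 ≤ |t| → (q * f) t = t := fun t ht => by
    rw [hqf, PP_S he hz t ht, add_zero]
  obtain ⟨t, rfl⟩ := D.surjective x
  show D ((q * f) (D.symm (D t))) = _
  rw [D.symm_apply_apply]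
  rcases le_total |t| 1 with ht | ht
  · have ht' : |(q * f) t| ≤ 1 := by
      obtain ⟨a1, a2⟩ := abs_le.1 ht
      have b1 := mm.monotone a1
      have b2 := mm.monotone a2
      rw [fix (-1) (by norm_num)] at b1
      rw [fix 1 (by norm_num)] at b2
      exact abs_le.2 ⟨b1, b2⟩
    rw [h1 _ ht', h1 _ ht, hqf, ph]
    have : (A:ℝ)⁻¹ * (A * t - (A+8) + (A+8)) = t := by field_simp; ring
    rw [this]; ring
  · rw [fix t ht, ph_S (by omega) he hz, add_zero]
    rcases le_abs.1 ht with h | h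
    · have := hD.mono.monotone h
      rw [h1 1 (by norm_num)] at this
      rw [le_abs]; left; linarith
    · have := hD.mono.monotone (show t ≤ -1 by linarith)
      rw [h1 (-1) (by norm_num)] at this
      rw [le_abs]; right; linarith

def Cl (s : ℕ) (ε : ℝ) (f : Equiv.Perm ℝ) : Prop := ∀ j ≤ s, ∀ x, |iteratedDeriv j (dsp f) x| ≤ ε

lemma Cl.nr {s : ℕ} {ε : ℝ} {f : Equiv.Perm ℝ} (h : Cl s ε f) : nr (s+1) (dsp f) ≤ ((s+1:ℕ):ℝ) * ε :=
  nr_le_mul fun j hj => NN_le (h j (by omega))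

def adf (δ : ℝ) (f : Equiv.Perm ℝ) : Prop := DF f ∧ Sup 1 f ∧ nr 5 (dsp f) ≤ δ

lemma dsp_S1 {f : Equiv.Perm ℝ} (h : Sup 1 f) : S1p (dsp f) := fun x hx => by rw [dsp, h x hx, sub_self]
lemma Sup.bs {B : ℝ} {f : Equiv.Perm ℝ} (hf : DF f) (h : Sup B f) : BS (dsp f) :=
  BS.of_supp hf.dsm (B := B) fun x hx => by rw [dsp, h x hx.le, sub_self]

lemma adf.adm {δ : ℝ} {f : Equiv.Perm ℝ} (h : adf δ f) : adm δ (dsp f) :=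
  ⟨Sup.bs h.1 h.2.1, dsp_S1 h.2.1, h.2.2⟩

lemma CTsm {f : Equiv.Perm ℝ} {u : ℝ → ℝ} {c d X1 : ℝ} (hf : ∀ x, f x = x + u x) (hu : BS u)
    (hc : |c| ≤ 1) (hd : |d| ≤ 1) (hR : ∀ x, X1 ≤ x → u x = c) (hL : ∀ x, x ≤ -X1 → u x = d) :
    Sm (dsp (CT f)) := by
  obtain ⟨C, hC⟩ := hu.bd 0
  exact (CT_EB (ι := Unit) (l := ⊤) (r := 0) (f := fun _ => f) (u := fun _ => u) (c := fun _ => c) (d := fun _ => d)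
    (X1 := X1) (C := C)
    (fun _ => hf) (hu.eb 0) (fun _ x => by simpa using hC x) (fun _ => hc) (fun _ => hd) (fun _ => hR) fun _ => hL).1 ()

lemma nl_ex {ι : Type*} {g : ι → ℝ} {s : ℕ} {f : ι → Equiv.Perm ℝ} (g0 : ∀ i, 0 ≤ g i)
    (h : NL (comap g (𝓝 0)) s (fun i => dsp (f i))) {ε : ℝ} (hε : 0 < ε) :
    ∃ δ > 0, ∀ i, g i ≤ δ → Cl s ε (f i) := by
  have h1 : ∀ᶠ i in comap g (𝓝 0), ∀ j ∈ Finset.range (s+1), ∀ x, |iteratedDeriv j (dsp (f i)) x| ≤ ε := by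
    rw [Filter.eventually_all_finset]
    exact fun j hj => h.2 j (by simpa [Nat.lt_succ_iff] using hj) ε hε
  rw [eventually_comap, Metric.eventually_nhds_iff] at h1
  obtain ⟨δ, hδ, h2⟩ := h1
  refine ⟨δ/2, by positivity, fun i hi j hj x => h2 (y := g i) ?_ i rfl j (by simpa [Nat.lt_succ_iff] using hj) x⟩
  rw [Real.dist_eq, sub_zero, abs_of_nonneg (g0 i)]; linarith

lemma core_loc : ∃ T D : Equiv.Perm ℝ, DF T ∧ Sup 3 T ∧ DF D ∧ Sup 3 D ∧ ∃ δ > 0,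
    ∃ Y : Fin 3 → Equiv.Perm ℝ → Equiv.Perm ℝ,
      (∀ f, adf δ f → (∀ k, DF (Y k f) ∧ Sup 3 (Y k f)) ∧ f⁻¹ = WW T D (Y 0 f) (Y 1 f) (Y 2 f)) ∧
      ∀ s : ℕ, ∀ ε > 0, ∃ δ' > 0, ∀ f, adf δ f → Cl (s+7) δ' f → ∀ k, Cl s ε (Y k f) := by
  obtain ⟨A, η, cd, δ, hδ, C, hC, Z, δ2, hZ, hi⟩ := lin0
  have hA1 := cd.A1
  have hA' : (1000:ℝ) ≤ A := by exact_mod_cast cd.A1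
  obtain ⟨D, hD, D1, DS⟩ := D_ex cd.A1
  have hTr : DF Tr := by
    have e : (Tr : ℝ → ℝ) = fun x => x + 1 := rfl
    refine ⟨by rw [e]; exact contDiff_id.add contDiff_const, fun x => ?_⟩
    rw [e]; simp
  have sT : Sm (dsp (CT Tr)) := CTsm (u := fun _ => 1) (c := 1) (d := 1) (X1 := 0) (fun x => rfl) (BS.cst 1)
    (by norm_num) (by norm_num) (fun _ _ => rfl) fun _ _ => rfl
  have D0 : ∀ x : ℝ, 6*(A:ℝ)+50 ≤ |x| → dsp D x = 0 := fun x hx => by rw [dsp, DS x hx, sub_self]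
  have sD : Sm (dsp (CT D)) := CTsm (u := dsp D) (c := 0) (d := 0) (X1 := 6*A+50) (dsp_eq D) (Sup.bs hD DS)
    (by norm_num) (by norm_num) (fun x hx => D0 x (le_abs.2 (Or.inl hx))) fun x hx => D0 x (le_abs.2 (Or.inr (by linarith)))
  let U : Fin 3 → (ℝ → ℝ) → ℝ → ℝ := ![fun e => uy A e (Z e), fun e => uy' A e (Z e), Z]
  have UB : ∀ k e, adm δ e → BS (U k e) := fun k e he => by
    have ok := (hZ e he).1
    fin_cases k
    exacts [uy_BS ok.e ok.z, uy'_BS ok.e ok.z, ok.z]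
  have U0 : ∀ k e, adm δ e → ∀ x, |U k e x| ≤ C * nr 5 e := fun k e he x => by
    have h := (hZ e he).2.2.2.1 x
    fin_cases k
    exacts [h.2.1, h.2.2, h.1]
  have U1 : ∀ k e, adm δ e → ∀ x, 0 < 1 + deriv (U k e) x := fun k e he x => by
    have h := (hZ e he).2.2.2.2 x
    have : |deriv (U k e) x| ≤ 1/2 := by
      fin_cases k
      exacts [h.2.1, h.2.2, h.1]
    linarith [(abs_le.1 this).1]
  have Us : ∀ s M, ∃ C', ∀ k e, adm δ e → nr s e ≤ M → nr s (U k e) ≤ C' := fun s M => by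
    obtain ⟨C', h⟩ := hi s M
    refine ⟨C', fun k e he hm => ?_⟩
    have h := h e he hm
    fin_cases k
    exacts [h.2.1, h.2.2, h.1]
  have UR : ∀ k e, adm δ e → ∃ c : ℝ, |c| ≤ 1 ∧ ∀ x : ℝ, 2*(A:ℝ)+10 ≤ x → U k e x = c := fun k e he => by
    have ok := (hZ e he).1
    fin_cases k
    · exact ⟨Ga A e (Z e) 0, (hZ e he).2.2.1, fun x hx => by
        show uy A e (Z e) x = _
        rw [uy, eta0 (by linarith)]; ring⟩
    · exact ⟨0, by norm_num, fun x hx => by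
        show uy' A e (Z e) x = _
        rw [uy', eta0 (by linarith)]; ring⟩
    · exact ⟨0, by norm_num, fun x hx => ok.sz x (le_abs.2 (Or.inl (by linarith)))⟩
  have UL : ∀ k e, adm δ e → ∀ x : ℝ, x ≤ -(2*(A:ℝ)+10) → U k e x = 0 := fun k e he x hx => by
    have ok := (hZ e he).1
    fin_cases k
    · show uy A e (Z e) x = _
      rw [uy, ga, Ga_left cd ok (x := x) (by linarith), eta1 (by linarith)]; ring
    · show uy' A e (Z e) x = _
      rw [uy', rho0 (by linarith)]; ring
    · exact ok.sz x (le_abs.2 (Or.inr (by linarith)))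
  choose! c c1 hcR using UR
  have mk : ∀ k e, adm δ e → _ := fun k e he => mkP_spec (UB k e he).sm (U1 k e he) (U0 k e he)
  have sY : ∀ k e, adm δ e → Sm (dsp (CT (mkP (U k e)))) := fun k e he =>
    CTsm (mk k e he).2.1 (UB k e he) (c1 k e he) (by norm_num : |(0:ℝ)| ≤ 1) (hcR k e he) (UL k e he)
  refine ⟨CT Tr, CT D, CT_DF hTr sT, CT_sup _, CT_DF hD sD, CT_sup _, δ, hδ,
    fun k f => CT (mkP (U k (dsp f))), fun f hf => ⟨fun k => ⟨CT_DF (mk k _ hf.adm).1 (sY k _ hf.adm), CT_sup _⟩, ?_⟩, ?_⟩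
  · obtain ⟨ok, fx, -, -, -⟩ := hZ _ hf.adm
    have m0 := mk 0 _ hf.adm
    have m1 := mk 1 _ hf.adm
    have m2 := mk 2 _ hf.adm
    have L := line_id cd ok fx m0.2.1 m1.2.1 m2.2.1
      (F_id hA1 hD D1 ok.se ok.sz (dsp_eq f) m2.2.1 (m2.1.mul hf.1).mono) m1.1.mono m2.1.mono
    have key : f⁻¹ = WW Tr D (mkP (U 0 (dsp f))) (mkP (U 1 (dsp f))) (mkP (U 2 (dsp f))) := by
      unfold WW; rw [L]; group
    exact (CT_id hf.2.1.inv).symm.trans ((congrArg CT key).trans (CT_WW _ _ _ _ _))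
  · intro s ε hε
    let g : {f // adf δ f} → ℝ := fun i => nr (s+7+1) (dsp i)
    have key : ∀ k, NL (comap g (𝓝 0)) s (fun i => dsp (CT (mkP (U k (dsp i.1))))) := fun k => by
      have ev : ∀ ε > 0, ∀ᶠ i in comap g (𝓝 0), g i < ε := fun ε he => by
        rw [eventually_comap]
        filter_upwards [Iio_mem_nhds he] with b hb i hi
        rw [hi]; exact hb
      refine EB.nl (CT_EB (fun i => (mk k _ i.2.adm).2.1) (EB_of_nr (fun i => UB k _ i.2.adm) ?_)
        (C := C * δ) (fun i x => (U0 k _ i.2.adm x).trans (by have := i.2.2.2; gcongr))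
        (fun i => c1 k _ i.2.adm) (fun i => (by norm_num : |(0:ℝ)| ≤ 1)) (fun i => hcR k _ i.2.adm)
        (fun i => UL k _ i.2.adm)) ?_
      · obtain ⟨C', h⟩ := Us (s+1+1) 1
        exact ⟨C', (ev 1 one_pos).mono fun i hi => h k _ i.2.adm ((nr_mono (by omega) _).trans hi.le)⟩
      · intro ε he
        refine (ev (ε / (4 * (C+1))) (by positivity)).mono fun i hi x => ?_
        rw [lt_div_iff₀ (by positivity)] at hi
        have h5 : nr 5 (dsp i.1) ≤ g i := nr_mono (by omega) _
        have g0 : 0 ≤ g i := nr_nonneg _ _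
        refine (CT_C0 (ε := C * g i) (fun x => ?_) x).trans (by nlinarith)
        rw [(mk k _ i.2.adm).2.2]
        exact (U0 k _ i.2.adm x).trans (by gcongr)
    choose δ' hδ' H using fun k => nl_ex (fun i => nr_nonneg _ _) (key k) hε
    refine ⟨min (δ' 0) (min (δ' 1) (δ' 2)) / ((s+7+1 : ℕ):ℝ), div_pos (lt_min (hδ' 0) (lt_min (hδ' 1) (hδ' 2))) (by positivity), fun f hf hc k => H k ⟨f, hf⟩ ?_⟩
    refine (Cl.nr hc).trans ?_
    rw [mul_div_cancel₀ _ (by positivity)]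
    fin_cases k
    exacts [min_le_left _ _, (min_le_right _ _).trans (min_le_left _ _), (min_le_right _ _).trans (min_le_right _ _)]

def SL (s : Equiv.Perm ℝ) : ℕ → (ℕ → Equiv.Perm ℝ) → Equiv.Perm ℝ
  | 0, _ => 1
  | K+1, x => x 0 * (s * SL s K (fun i => x (i+1)) * s⁻¹)

def SI (f : Equiv.Perm ℝ) : Prop := ∀ x, x ∉ Ioo (-3:ℝ) 9 → f x = x

structure Shf (s : Equiv.Perm ℝ) : Prop where
  df : DF s
  sp : Sup 33 s
  l : s (-3) = 6
  r : s 9 = 9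

lemma Shf_ex : ∃ s, Shf s := by
  obtain ⟨f, h1, h2, h3⟩ := ctr_spec (lam := 1/4) (by norm_num) (by norm_num) 9 (R := 12) (by norm_num)
  refine ⟨f, h1, fun x hx => h3 x ?_, ?_, ?_⟩
  · have := abs_sub_abs_le_abs_sub x 9
    rw [abs_of_nonneg (by norm_num : (0:ℝ) ≤ 9)] at this; linarith
  · rw [h2 _ (by norm_num [abs_le])]; norm_num
  · rw [h2 _ (by norm_num [abs_le])]; norm_num

section
variable {s : Equiv.Perm ℝ}

lemma Sup.si {f : Equiv.Perm ℝ} (h : Sup 3 f) : SI f := fun x hx => h x (by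
  rw [le_abs]; by_contra h1; push Not at h1
  exact hx ⟨by linarith, by linarith⟩)

lemma SI.conj (hs : Shf s) {f : Equiv.Perm ℝ} (h : SI f) {x : ℝ} (hx : x ∉ Ioo (6:ℝ) 9) :
    (s * f * s⁻¹) x = x := by
  show s (f (s.symm x)) = x
  rw [h, s.apply_symm_apply]
  rintro ⟨h1, h2⟩
  have e1 := hs.df.mono h1
  have e2 := hs.df.mono h2
  rw [hs.l, s.apply_symm_apply] at e1
  rw [hs.r, s.apply_symm_apply] at e2
  exact hx ⟨e1, e2⟩

lemma SI.mul {f g : Equiv.Perm ℝ} (h : SI f) (h' : SI g) : SI (f * g) := fun x hx => by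
  show f (g x) = x
  rw [h' x hx, h x hx]

lemma SI.conj' (hs : Shf s) {f : Equiv.Perm ℝ} (h : SI f) : SI (s * f * s⁻¹) := fun _ hx =>
  h.conj hs fun h' => hx ⟨by linarith [h'.1], h'.2⟩

lemma SL_si (hs : Shf s) (K : ℕ) {x : ℕ → Equiv.Perm ℝ} (hx : ∀ i, Sup 3 (x i)) : SI (SL s K x) := by
  induction K generalizing x with
  | zero => exact fun _ _ => rfl
  | succ K ih => exact (hx 0).si.mul ((ih fun i => hx _).conj' hs)

lemma SL_df (hs : Shf s) (K : ℕ) {x : ℕ → Equiv.Perm ℝ} (hx : ∀ i, DF (x i)) : DF (SL s K x) := by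
  induction K generalizing x with
  | zero => exact DF.one
  | succ K ih => exact (hx 0).mul ((hs.df.mul (ih fun i => hx _)).mul hs.df.inv)

lemma SL_one (K : ℕ) : SL s K 1 = 1 := by
  induction K with
  | zero => rfl
  | succ K ih =>
    have : (fun i => (1 : ℕ → Equiv.Perm ℝ) (i+1)) = 1 := rfl
    rw [SL, this, ih]; simp

lemma SL_mul (hs : Shf s) (K : ℕ) {x y : ℕ → Equiv.Perm ℝ} (hx : ∀ i, Sup 3 (x i)) (hy : ∀ i, Sup 3 (y i)) :
    SL s K (x * y) = SL s K x * SL s K y := by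
  induction K generalizing x y with
  | zero => rfl
  | succ K ih =>
    have e : (fun i => (x * y) (i+1)) = (fun i => x (i+1)) * fun i => y (i+1) := rfl
    rw [SL, SL, SL, e, ih (fun i => hx _) fun i => hy _]
    set X := SL s K fun i => x (i+1)
    set Y := SL s K fun i => y (i+1)
    have hX : SI X := SL_si hs K fun i => hx _
    have dj : (y 0).Disjoint (s * X * s⁻¹) := fun t => by
      by_cases ht : t ∈ Ioo (6:ℝ) 9
      · left; exact hy 0 t (le_abs.2 (Or.inl (by linarith [ht.1])))
      · right; exact hX.conj hs ht
    have c := dj.commute.eq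
    show x 0 * y 0 * _ = _
    calc x 0 * y 0 * (s * (X * Y) * s⁻¹) = x 0 * (y 0 * (s * X * s⁻¹)) * (s * Y * s⁻¹) := by group
      _ = _ := by rw [c]; group

lemma SL_last (K : ℕ) {x : ℕ → Equiv.Perm ℝ} (h : x K = 1) : SL s (K+1) x = SL s K x := by
  induction K generalizing x with
  | zero => simp [SL, h]
  | succ K ih =>
    rw [SL, ih (x := fun i => x (i+1)) h]; rfl

def G3 : Subgroup (ℕ → Equiv.Perm ℝ) where
  carrier := {x | ∀ i, Sup 3 (x i)}
  mul_mem' := fun h h' i => (h i).mul (h' i)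
  one_mem' := fun _ => Sup.one 3
  inv_mem' := fun h i => (h i).inv

def SLh (hs : Shf s) (K : ℕ) : G3 →* Equiv.Perm ℝ where
  toFun x := SL s K x
  map_one' := SL_one K
  map_mul' x y := SL_mul hs K x.2 y.2

lemma map_WW {G H : Type*} [Group G] [Group H] (φ : G →* H) (T D y y' q : G) :
    φ (WW T D y y' q) = WW (φ T) (φ D) (φ y) (φ y') (φ q) := by
  simp only [WW, map_mul, map_inv]

def Wd {G : Type*} [Group G] (a : Fin 4 → G) (b : Fin 3 → G) : G :=
  ((a 0)⁻¹ * b 0 * a 0 * (b 0)⁻¹ * (b 0 * WW (b 1) (b 2) (a 1) (a 2) (a 3) * (b 0)⁻¹))⁻¹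

def mac (s T D : Equiv.Perm ℝ) (K : ℕ) : Fin 3 → Equiv.Perm ℝ := ![s, SL s K fun _ => T, SL s K fun _ => D]

lemma slot_word (hs : Shf s) {T D : Equiv.Perm ℝ} (hT : Sup 3 T) (hD : Sup 3 D) {K : ℕ}
    {P : ℕ → Equiv.Perm ℝ} {Y : Fin 3 → ℕ → Equiv.Perm ℝ} (hP : ∀ i, Sup 3 (P i)) (hY : ∀ k i, Sup 3 (Y k i))
    (h : ∀ i, P i = WW T D (Y 0 i) (Y 1 i) (Y 2 i) * P (i+1)) (hl : P K = 1) :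
    (P 0)⁻¹ = Wd ![SL s K fun i => (P i)⁻¹, SL s K (Y 0), SL s K (Y 1), SL s K (Y 2)] (mac s T D K) := by
  let tP : G3 := ⟨P, hP⟩
  let tQ : G3 := ⟨fun i => P (i+1), fun i => hP _⟩
  let tY : Fin 3 → G3 := fun k => ⟨Y k, hY k⟩
  let tT : G3 := ⟨fun _ => T, fun _ => hT⟩
  let tD : G3 := ⟨fun _ => D, fun _ => hD⟩
  have e1 : tP = WW tT tD (tY 0) (tY 1) (tY 2) * tQ := Subtype.ext (funext h)
  have e2 := congrArg (SLh hs K) e1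
  rw [map_mul, map_WW] at e2
  have e3 : (SLh hs K) tP⁻¹ = ((SLh hs K) tP)⁻¹ := map_inv _ _
  have e4 : SLh hs K tP = P 0 * (s * SLh hs K tQ * s⁻¹) := by
    show SL s K P = P 0 * (s * SL s K (fun i => P (i+1)) * s⁻¹)
    rw [← SL_last K hl, SL]
  show _ = ((SLh hs K tP⁻¹)⁻¹ * s * (SLh hs K tP⁻¹) * s⁻¹ *
    (s * WW (SLh hs K tT) (SLh hs K tD) (SLh hs K (tY 0)) (SLh hs K (tY 1)) (SLh hs K (tY 2)) * s⁻¹))⁻¹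
  rw [e3]
  set W := WW (SLh hs K tT) (SLh hs K tD) (SLh hs K (tY 0)) (SLh hs K (tY 1)) (SLh hs K (tY 2))
  set H := SLh hs K tP
  set Q := SLh hs K tQ
  have e5 : P 0 = H * (s * Q⁻¹ * s⁻¹) := by rw [e4]; group
  rw [e5, e2]; group

end

lemma WW_one {G : Type*} [Group G] (T D : G) : WW T D 1 1 1 = 1 := by simp [WW]

lemma Cl.mono {s t : ℕ} {ε ε' : ℝ} {f : Equiv.Perm ℝ} (h : Cl t ε f) (hs : s ≤ t) (he : ε ≤ ε') : Cl s ε' f :=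
  fun j hj x => (h j (hj.trans hs) x).trans he

lemma SI.sup {f : Equiv.Perm ℝ} (h : SI f) : Sup 33 f := fun x hx => h x fun h' => by
  rcases le_abs.1 hx with h1 | h1 <;> linarith [h'.1, h'.2]

lemma Sup.mono {B B' : ℝ} {f : Equiv.Perm ℝ} (h : Sup B f) (hb : B ≤ B') : Sup B' f := fun x hx => h x (hb.trans hx)

lemma deriv_low {p : Equiv.Perm ℝ} (hp : DF p) {B : ℝ} (sp : Sup B p) : ∃ c > 0, c ≤ 1 ∧ ∀ x, c ≤ 1 + deriv (dsp p) x := by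
  obtain ⟨m, -, hm⟩ := (isCompact_Icc (a := -|B|) (b := |B|)).exists_isMinOn ⟨0, by simp⟩
    (hp.dsm.deriv.continuous.continuousOn)
  have m0 := hp.dpos m
  refine ⟨min 1 (1 + deriv (dsp p) m), lt_min one_pos m0, min_le_left _ _, fun x => ?_⟩
  rcases le_or_gt |x| |B| with h | h
  · have : deriv (dsp p) m ≤ deriv (dsp p) x := hm (abs_le.1 h)
    exact (min_le_right _ _).trans (by linarith)
  · have h1 : dsp p =ᶠ[𝓝 x] fun _ => 0 := by
      filter_upwards [(isOpen_lt continuous_const continuous_abs).mem_nhds h] with y hy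
      rw [dsp, sp y ((le_abs_self B).trans (le_of_lt hy)), sub_self]
    rw [h1.deriv_eq]; simp

lemma EB_nr {ι : Type*} {r : ℕ} {u : ι → ℝ → ℝ} (h : EB ⊤ r u) : ∃ C : ℝ, 0 ≤ C ∧ ∀ i, nr (r+1) (u i) ≤ C := by
  choose! C hC using h.2
  refine ⟨∑ j ∈ Finset.range (r+1), |C j|, Finset.sum_nonneg fun _ _ => abs_nonneg _, fun i => ?_⟩
  refine Finset.sum_le_sum fun j hj => NN_le fun x => ?_
  exact (eventually_top.1 (hC j (by simpa [Nat.lt_succ_iff] using hj)) i x).trans (le_abs_self _)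

/-- time slices -/
lemma slices {p : Equiv.Perm ℝ} (hp : DF p) (sp : Sup 1 p) : ∃ (pt : Icc (0:ℝ) 1 → Equiv.Perm ℝ) (C : ℝ), 0 ≤ C ∧
    (∀ t, DF (pt t) ∧ Sup 1 (pt t)) ∧ pt ⟨0, by simp⟩ = 1 ∧ pt ⟨1, by simp⟩ = p ∧
    ∀ t t', nr 5 (dsp (pt t' * (pt t)⁻¹)) ≤ |t'.1 - t.1| * C := by
  have hv := Sup.bs hp sp
  set v := dsp p with hvd
  obtain ⟨c, c0, c1, hc⟩ := deriv_low hp sp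
  have dl : ∀ (t : Icc (0:ℝ) 1) x, deriv (fun x => t.1 * v x) x = t.1 * deriv v x := fun t x => by
    rw [deriv_const_mul _ (hv.sm.d x)]
  have lo : ∀ (t : Icc (0:ℝ) 1) x, c ≤ 1 + deriv (fun x => t.1 * v x) x := fun t x => by
    rw [dl]
    have h0 := t.2.1
    have h1 := t.2.2
    nlinarith [hc x, mul_le_mul_of_nonneg_left (hc x) h0]
  have bd : ∀ t : Icc (0:ℝ) 1, ∀ x, |t.1 * v x| ≤ NN 0 v := fun t x => by
    rw [abs_mul, abs_of_nonneg t.2.1]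
    exact (mul_le_of_le_one_left (abs_nonneg _) t.2.2).trans (hv.le0 x)
  have mk : ∀ t : Icc (0:ℝ) 1, _ := fun t => mkP_spec (u := fun x => t.1 * v x) (contDiff_const.mul hv.sm)
    (fun x => c0.trans_le (lo t x)) (bd t)
  set pt : Icc (0:ℝ) 1 → Equiv.Perm ℝ := fun t => mkP (fun x => t.1 * v x) with hpt
  have ebv : EB (⊤ : Filter (Icc (0:ℝ) 1)) 4 (fun _ => v) := by
    refine ⟨fun _ => hv.sm, fun j _ => ⟨NN j v, Eventually.of_forall fun _ x => hv.le j x⟩⟩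
  have eba : EB (⊤ : Filter (Icc (0:ℝ) 1)) 4 (fun t => dsp (pt t)⁻¹) := by
    refine EB.div (a := fun t x => t.1 * v x) (b := fun _ _ => 0) c0
      ((EB.const ⟨1, Eventually.of_forall fun t => by rw [abs_of_nonneg t.2.1]; exact t.2.2⟩).mul ebv) (EB.cst 0)
      (fun t => (mk t).1.inv.dsm) (fun t x => c0.trans_le (lo t x)) (Eventually.of_forall lo) (fun t x => ?_)
    rw [← dsp_eq]
    have := (mk t).2.1 ((pt t)⁻¹ x)
    have e : mkP (fun x => t.1 * v x) ((pt t)⁻¹ x) = x := (pt t).apply_symm_apply x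
    rw [e] at this
    show (pt t)⁻¹ x - x + t.1 * v ((pt t)⁻¹ x) = 0
    linarith
  obtain ⟨C, C0, hC⟩ := EB_nr (ebv.comp1 eba)
  refine ⟨pt, C, C0, fun t => ⟨(mk t).1, fun x hx => ?_⟩, ?_, ?_, fun t t' => ?_⟩
  · rw [(mk t).2.1, show v x = 0 from dsp_S1 sp x hx]; ring
  · ext x; rw [(mk _).2.1]; simp
  · ext x; rw [(mk _).2.1, dsp_eq p x]; ring
  · have e : dsp (pt t' * (pt t)⁻¹) = fun x => (t'.1 - t.1) * v (x + dsp (pt t)⁻¹ x) := by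
      funext x
      rw [← dsp_eq]
      have h1 := (mk t).2.1 ((pt t)⁻¹ x)
      have e : mkP (fun x => t.1 * v x) ((pt t)⁻¹ x) = x := (pt t).apply_symm_apply x
      rw [e] at h1
      show pt t' ((pt t)⁻¹ x) - x = _
      rw [(mk t').2.1]
      linarith
    rw [e]
    refine le_trans ?_ (mul_le_mul_of_nonneg_left (hC t) (abs_nonneg _))
    unfold nr
    rw [Finset.mul_sum]
    have hb : BS (fun x => v (x + dsp (pt t)⁻¹ x)) := hv.comp1 (Sup.bs (mk t).1.inv
      (Sup.inv (B := 1) fun x hx => by rw [(mk t).2.1, show v x = 0 from dsp_S1 sp x hx]; ring))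
    refine Finset.sum_le_sum fun j _ => NN_le fun x => ?_
    rw [iteratedDeriv_const_mul_field, abs_mul]
    exact mul_le_mul_of_nonneg_left (hb.le j x) (abs_nonneg _)

/-- the local theorem -/
lemma local_thm : ∃ m : ℕ → Fin 3 → Equiv.Perm ℝ, (∀ K k, DF (m K k) ∧ Sup 33 (m K k)) ∧
    (∀ p, DF p → Sup 1 p → ∃ K0, ∀ K ≥ K0, ∃ a : Fin 4 → Equiv.Perm ℝ, (∀ k, DF (a k) ∧ Sup 33 (a k)) ∧ p = Wd a (m K)) ∧
    ∀ s : ℕ, ∀ ε > 0, ∃ δ > 0, ∀ p, DF p → Sup 1 p → Cl (s+7) δ p → ∃ a : Fin 4 → Equiv.Perm ℝ,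
      (∀ k, DF (a k) ∧ Sup 33 (a k) ∧ Cl s ε (a k)) ∧ ∀ K, 1 ≤ K → p = Wd a (m K) := by
  obtain ⟨T, D, hT, sT, hD, sD, δ, δ0, Y, hY, hsm⟩ := core_loc
  obtain ⟨s, hs⟩ := Shf_ex
  refine ⟨mac s T D, fun K k => ?_, fun p hp sp => ?_, fun r ε hε => ?_⟩
  · fin_cases k
    exacts [⟨hs.df, hs.sp⟩, ⟨SL_df hs K fun _ => hT, (SL_si hs K fun _ => sT).sup⟩,
      ⟨SL_df hs K fun _ => hD, (SL_si hs K fun _ => sD).sup⟩]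
  · obtain ⟨pt, C, C0, h1, h2, h3, h4⟩ := slices hp sp
    obtain ⟨K0, hK0⟩ := exists_nat_gt (C / δ)
    refine ⟨K0 + 1, fun K hK => ?_⟩
    have Kp : (0:ℝ) < K := by exact_mod_cast (by omega : 0 < K)
    have hCK : C / K ≤ δ := by
      rw [div_le_iff₀ Kp]
      rw [div_lt_iff₀ δ0] at hK0
      have : (K0:ℝ) ≤ K := by exact_mod_cast (by omega : K0 ≤ K)
      nlinarith
    let t : ℕ → Icc (0:ℝ) 1 := fun i => ⟨min 1 (i / K), le_min zero_le_one (by positivity), min_le_left _ _⟩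
    have tl : ∀ i, K ≤ i → t i = ⟨1, by simp⟩ := fun i hi => Subtype.ext (min_eq_left (by
      rw [le_div_iff₀ Kp, one_mul]; exact_mod_cast hi))
    have t0 : t 0 = ⟨0, by simp⟩ := Subtype.ext (by simp [t])
    have td : ∀ i, i < K → |(t (i+1)).1 - (t i).1| = 1 / K := fun i hi => by
      have e1 : (t i).1 = i / K := min_eq_right (by rw [div_le_iff₀ Kp, one_mul]; exact_mod_cast hi.le)
      have e2 : (t (i+1)).1 = ((i+1:ℕ):ℝ) / K := min_eq_right (by rw [div_le_iff₀ Kp, one_mul]; exact_mod_cast hi)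
      rw [e1, e2, ← sub_div]; push_cast
      rw [add_sub_cancel_left, abs_of_nonneg (by positivity)]
    let f : ℕ → Equiv.Perm ℝ := fun i => pt (t (i+1)) * (pt (t i))⁻¹
    have hf : ∀ i, i < K → adf δ (f i) := fun i hi =>
      ⟨(h1 _).1.mul (h1 _).1.inv, (h1 _).2.mul (h1 _).2.inv, (h4 _ _).trans (by rw [td i hi, one_div_mul_eq_div]; exact hCK)⟩
    let P : ℕ → Equiv.Perm ℝ := fun i => pt (t i) * p⁻¹
    have PD : ∀ i, DF (P i) := fun i => (h1 _).1.mul hp.inv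
    have PS : ∀ i, Sup 3 (P i) := fun i => ((h1 _).2.mul sp.inv).mono (by norm_num)
    let X : Fin 3 → ℕ → Equiv.Perm ℝ := fun k i => if i < K then Y k (f i) else 1
    have hX : ∀ k i, DF (X k i) ∧ Sup 3 (X k i) := fun k i => by
      by_cases h : i < K
      · simp only [X, if_pos h]; exact (hY _ (hf i h)).1 k
      · simp only [X, if_neg h]; exact ⟨DF.one, Sup.one _⟩
    have key := slot_word hs sT sD (K := K) (P := P) (Y := X) PS (fun k i => (hX k i).2) (fun i => ?_) ?_
    · have : (P 0)⁻¹ = p := by simp only [P, t0, h2]; simp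
      rw [this] at key
      refine ⟨_, fun k => ?_, key⟩
      fin_cases k
      exacts [⟨SL_df hs K fun i => (PD i).inv, (SL_si hs K fun i => (PS i).inv).sup⟩,
        ⟨SL_df hs K fun i => (hX 0 i).1, (SL_si hs K fun i => (hX 0 i).2).sup⟩,
        ⟨SL_df hs K fun i => (hX 1 i).1, (SL_si hs K fun i => (hX 1 i).2).sup⟩,
        ⟨SL_df hs K fun i => (hX 2 i).1, (SL_si hs K fun i => (hX 2 i).2).sup⟩]
    · by_cases h : i < K
      · simp only [X, if_pos h]
        rw [← (hY _ (hf i h)).2]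
        simp only [f, P]; group
      · simp only [X, if_neg h, WW_one, one_mul, P]
        rw [tl i (by omega), tl (i+1) (by omega)]
    · simp only [P]; rw [tl K le_rfl, h3, mul_inv_cancel]
  · obtain ⟨δ1, hδ1, H⟩ := hsm r ε hε
    refine ⟨min (min δ1 ε) (δ / ((r+7+1:ℕ):ℝ)), by positivity, fun p hp sp hc => ?_⟩
    have ha : adf δ p := by
      refine ⟨hp, sp, (nr_mono (by omega) _).trans ((Cl.nr (hc.mono le_rfl (min_le_right _ _))).trans ?_)⟩
      rw [mul_div_cancel₀ _ (by positivity)]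
    have hc1 := H p ha (hc.mono le_rfl ((min_le_left _ _).trans (min_le_left _ _)))
    obtain ⟨y1, y2⟩ := hY p ha
    refine ⟨![p, Y 0 p, Y 1 p, Y 2 p], fun k => ?_, fun K hK => ?_⟩
    · fin_cases k
      · exact ⟨hp, sp.mono (by norm_num), hc.mono (by omega) ((min_le_left _ _).trans (min_le_right _ _))⟩
      · exact ⟨(y1 0).1, (y1 0).2.mono (by norm_num), hc1 0⟩
      · exact ⟨(y1 1).1, (y1 1).2.mono (by norm_num), hc1 1⟩
      · exact ⟨(y1 2).1, (y1 2).2.mono (by norm_num), hc1 2⟩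
    · have sl : ∀ f : Equiv.Perm ℝ, SL s K (fun i => if i = 0 then f else 1) = f := fun f => by
        obtain ⟨K, rfl⟩ : ∃ k, K = k + 1 := ⟨K - 1, by omega⟩
        have : (fun i => (fun i => if i = 0 then f else 1 : ℕ → Equiv.Perm ℝ) (i+1)) = 1 := by
          funext i; simp
        rw [SL, this, SL_one]; simp
      have key := slot_word hs sT sD (K := K) (P := fun i => if i = 0 then p⁻¹ else 1)
        (Y := fun k i => if i = 0 then Y k p else 1) (fun i => ?_) (fun k i => ?_) (fun i => ?_) ?_
      · have e : (fun i => (if i = 0 then p⁻¹ else 1)⁻¹ : ℕ → Equiv.Perm ℝ) = fun i => if i = 0 then p else 1 := by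
          funext i; split_ifs <;> simp
        rw [e] at key
        simp only [sl] at key
        simpa using key
      · split_ifs
        exacts [sp.inv.mono (by norm_num), Sup.one _]
      · split_ifs
        exacts [(y1 k).2, Sup.one _]
      · rcases i with _ | i
        · simp [y2]
        · simp [WW_one]
      · simp; omega

def EQ : Subgroup (Equiv.Perm ℝ) where
  carrier := {f | ∀ x, f (x + 1) = f x + 1}
  mul_mem' := fun {f g} hf hg x => by
    show f (g (x+1)) = f (g x) + 1
    rw [hg, hf]
  one_mem' := fun _ => rfl
  inv_mem' := fun {f} hf x => by
    rw [Equiv.Perm.inv_eq_iff_eq, hf]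
    congr 1; exact (f.apply_symm_apply x).symm

lemma EQ_int {f : Equiv.Perm ℝ} (hf : f ∈ EQ) (n : ℤ) (x : ℝ) : f (x + n) = f x + n := by
  have hf' : ∀ x, f (x + 1) = f x + 1 := hf
  induction n using Int.induction_on generalizing x with
  | zero => simp
  | succ n ih => push_cast at ih ⊢; rw [← add_assoc, hf', ih]; ring
  | pred n ih =>
    push_cast at ih ⊢
    have := hf' (x + (-(n:ℝ) - 1))
    have e : x + (-(n:ℝ) - 1) + 1 = x + -n := by ring
    rw [e, ih] at this; linarith

lemma EQ_ext {f g : Equiv.Perm ℝ} (hf : f ∈ EQ) (hg : g ∈ EQ)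
    (h : ∀ x, x ∈ Ico (-1/2:ℝ) (1/2) → f x = g x) : f = g := by
  ext x
  have h1 := Int.floor_le (x + 1/2)
  have h2 := Int.lt_floor_add_one (x + 1/2)
  have h3 := h (x - ⌊x + 1/2⌋) ⟨by linarith, by linarith⟩
  have e1 := EQ_int hf ⌊x + 1/2⌋ (x - ⌊x + 1/2⌋)
  have e2 := EQ_int hg ⌊x + 1/2⌋ (x - ⌊x + 1/2⌋)
  rw [sub_add_cancel] at e1 e2
  rw [e1, e2, h3]

lemma EQ_per {f : Equiv.Perm ℝ} (hf : f ∈ EQ) : Function.Periodic (fun x : ℝ => ((f x : ℝ) : S1)) 1 := fun x => by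
  show ((f (x+1) : ℝ) : S1) = _
  rw [show f (x+1) = f x + 1 from hf x]
  exact AddCircle.coe_add_period 1 (f x)

def prjf (f : EQ) : S1 → S1 := (EQ_per f.2).lift
lemma prjf_coe (f : EQ) (x : ℝ) : prjf f (x : S1) = ((f.1 x : ℝ) : S1) := (EQ_per f.2).lift_coe x

lemma prjf_inv (f g : EQ) (h : f * g = 1) (x : S1) : prjf f (prjf g x) = x := by
  induction x using QuotientAddGroup.induction_on with
  | H x =>
    have := congrArg (fun k : EQ => k.1 x) h
    rw [prjf_coe, prjf_coe]
    congr 1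

def prj : EQ →* Equiv.Perm S1 where
  toFun f := ⟨prjf f, prjf f⁻¹, prjf_inv _ _ (inv_mul_cancel f), prjf_inv _ _ (mul_inv_cancel f)⟩
  map_one' := by
    ext x
    induction x using QuotientAddGroup.induction_on with
    | H x => exact prjf_coe 1 x
  map_mul' f g := by
    ext x
    induction x using QuotientAddGroup.induction_on with
    | H x =>
      show prjf (f * g) (x : S1) = prjf f (prjf g (x : S1))
      rw [prjf_coe, prjf_coe, prjf_coe]; rfl

lemma prj_coe (f : EQ) (x : ℝ) : prj f (x : S1) = ((f.1 x : ℝ) : S1) := prjf_coe f x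

lemma prj_lift (f : EQ) (h : DF f.1) : IsLift (prj f) f.1 := ⟨h.1, f.2, h.2, prj_coe f⟩

lemma prj_eq {f : EQ} {F : Equiv.Perm S1} (h : ∀ x : ℝ, F (x : S1) = ((f.1 x : ℝ) : S1)) : F = prj f := by
  ext x
  induction x using QuotientAddGroup.induction_on with
  | H x => rw [prj_coe]; exact h x

lemma lift_perm {F : Equiv.Perm S1} {L : ℝ → ℝ} (h : IsLift F L) :
    ∃ f : EQ, DF f.1 ∧ (∀ x, f.1 x = L x) ∧ F = prj f := by
  have hs : Sm (fun x => L x - x) := h.1.sub contDiff_id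
  have hp : Function.Periodic (fun x => L x - x) 1 := fun x => by
    show L (x+1) - (x+1) = L x - x
    rw [h.2.1]; ring
  have hb := BS.of_periodic hs hp
  have m := mkP_spec hs (fun x => by
    rw [deriv_fun_sub ((show Sm L from h.1).d x) differentiableAt_fun_id, deriv_id'']
    have := h.2.2.1 x
    linarith) hb.le0
  have e : ∀ x, mkP (fun x => L x - x) x = L x := fun x => by rw [m.2.1]; ring
  have hE : mkP (fun x => L x - x) ∈ EQ := fun x => by rw [e, e, h.2.1]
  exact ⟨⟨_, hE⟩, m.1, e, prj_eq fun x => by rw [h.2.2.2]; congr 1; exact (e x).symm⟩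

def HI : Subgroup (Equiv.Perm ℝ) where
  carrier := {f | ∀ x, x ∉ Ioo (-1/2:ℝ) (1/2) → f x = x}
  mul_mem' := fun {f g} hf hg x hx => by
    show f (g x) = x
    rw [hg x hx, hf x hx]
  one_mem' := fun _ _ => rfl
  inv_mem' := fun {f} hf x hx => by rw [Equiv.Perm.inv_eq_iff_eq, hf x hx]

lemma HI_mem {f : Equiv.Perm ℝ} (hf : f ∈ HI) {x : ℝ} (hx : x ∈ Ico (-1/2:ℝ) (1/2)) : f x ∈ Ico (-1/2:ℝ) (1/2) := by
  by_contra h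
  have h1 := hf (f x) fun h' => h ⟨h'.1.le, h'.2⟩
  rw [f.injective h1] at h
  exact h hx

def pf (f : ℝ → ℝ) (x : ℝ) : ℝ := f (x - ⌊x + 1/2⌋) + ⌊x + 1/2⌋

lemma pf_dom (f : ℝ → ℝ) {y : ℝ} (hy : y ∈ Ico (-1/2:ℝ) (1/2)) (n : ℤ) : pf f (y + n) = f y + n := by
  have : ⌊y + n + 1/2⌋ = n := Int.floor_eq_iff.2 ⟨by linarith [hy.1], by linarith [hy.2]⟩
  rw [pf, this, add_sub_cancel_right]

lemma dom_ex (x : ℝ) : ∃ y ∈ Ico (-1/2:ℝ) (1/2), ∃ n : ℤ, x = y + n := by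
  have h1 := Int.floor_le (x + 1/2)
  have h2 := Int.lt_floor_add_one (x + 1/2)
  exact ⟨x - ⌊x + 1/2⌋, ⟨by linarith, by linarith⟩, ⌊x + 1/2⌋, by ring⟩

lemma pf_pf {f g : Equiv.Perm ℝ} (hg : g ∈ HI) (x : ℝ) : pf f (pf g x) = pf (f * g : Equiv.Perm ℝ) x := by
  obtain ⟨y, hy, n, rfl⟩ := dom_ex x
  rw [pf_dom _ hy, pf_dom _ (HI_mem hg hy), pf_dom _ hy]; rfl

lemma pf_one (x : ℝ) : pf (1 : Equiv.Perm ℝ) x = x := by simp [pf]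

def perP (f : HI) : Equiv.Perm ℝ where
  toFun := pf f.1
  invFun := pf (f⁻¹).1
  left_inv x := by
    rw [pf_pf f.2]
    have : ((f⁻¹).1 * f.1 : Equiv.Perm ℝ) = 1 := congrArg Subtype.val (inv_mul_cancel f)
    rw [this, pf_one]
  right_inv x := by
    rw [pf_pf (f⁻¹).2]
    have : (f.1 * (f⁻¹).1 : Equiv.Perm ℝ) = 1 := congrArg Subtype.val (mul_inv_cancel f)
    rw [this, pf_one]

lemma perP_dom (f : HI) {y : ℝ} (hy : y ∈ Ico (-1/2:ℝ) (1/2)) (n : ℤ) : perP f (y + n) = f.1 y + n := pf_dom _ hy n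
lemma perP_dom0 (f : HI) {y : ℝ} (hy : y ∈ Ico (-1/2:ℝ) (1/2)) : perP f y = f.1 y := by
  simpa using perP_dom f hy 0

lemma perP_EQ (f : HI) : perP f ∈ EQ := fun x => by
  obtain ⟨y, hy, n, rfl⟩ := dom_ex x
  have := perP_dom f hy (n+1)
  push_cast at this
  rw [← add_assoc] at this
  rw [this, perP_dom f hy]; ring

def Pr : HI →* EQ where
  toFun f := ⟨perP f, perP_EQ f⟩
  map_one' := Subtype.ext (Equiv.ext pf_one)
  map_mul' f g := Subtype.ext (Equiv.ext fun x => (pf_pf g.2 x).symm)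

lemma Pr_dom0 (f : HI) {y : ℝ} (hy : y ∈ Ico (-1/2:ℝ) (1/2)) : (Pr f).1 y = f.1 y := perP_dom0 f hy
lemma Pr_dom (f : HI) {y : ℝ} (hy : y ∈ Ico (-1/2:ℝ) (1/2)) (n : ℤ) : (Pr f).1 (y + n) = f.1 y + n := perP_dom f hy n

/-- fixes the complement of an open interval -/
def Fx (a b : ℝ) (f : Equiv.Perm ℝ) : Prop := ∀ x, x ∉ Ioo a b → f x = x

lemma Pr_conj {f f' : HI} {g : EQ} {a b : ℝ} (hf : Fx a b f.1) (mg : StrictMono g.1)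
    (ga : -1/2 ≤ g.1 a) (gb : g.1 b ≤ 1/2) (ha : -1/2 ≤ a) (hb : b ≤ 1/2)
    (e : f'.1 = g.1 * f.1 * (g.1)⁻¹) : Pr f' = g * Pr f * g⁻¹ := by
  refine Subtype.ext (EQ_ext (Pr f').2 (g * Pr f * g⁻¹).2 fun x hx => ?_)
  rw [Pr_dom0 _ hx, e]
  show g.1 (f.1 (g.1.symm x)) = g.1 ((Pr f).1 (g.1.symm x))
  congr 1
  set y := g.1.symm x with hy
  have gy : g.1 y = x := g.1.apply_symm_apply x
  by_cases h : y ∈ Ioo a b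
  · rw [Pr_dom0 _ ⟨by linarith [h.1], by linarith [h.2]⟩]
  · rw [hf y h]
    obtain ⟨t, ht, n, htn⟩ := dom_ex y
    rw [htn, Pr_dom _ ht]
    by_cases h2 : t ∈ Ioo a b
    · have e1 := EQ_int g.2 n t
      rw [← htn, gy] at e1
      have b1 := mg h2.1
      have b2 := mg h2.2
      have n0 : n = 0 := by
        have l1 : (n:ℝ) < 1 := by linarith [hx.1, hx.2]
        have l2 : (-1:ℝ) < n := by linarith [hx.1, hx.2]
        have l1' : n < 1 := by exact_mod_cast l1
        have l2' : -1 < n := by exact_mod_cast l2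
        omega
      exfalso; apply h
      rw [htn, n0]; simpa using h2
    · rw [hf t h2]

lemma Pr_DF {f : HI} (h : DF f.1) {w : ℝ} (hw : w < 1/2) (hs : Sup w f.1) : DF (Pr f).1 := by
  have key : ∀ x, ∃ n : ℤ, ((Pr f).1 : ℝ → ℝ) =ᶠ[𝓝 x] (fun t => f.1 (t - n) + n) := fun x => by
    obtain ⟨y, hy, n, rfl⟩ := dom_ex x
    refine ⟨n, ?_⟩
    have hw' : 0 < 1/2 - w := by linarith
    rcases lt_or_ge (-1/2) y with h1 | h1
    · filter_upwards [Ioo_mem_nhds (show -1/2 + (n:ℝ) < y + n by linarith) (show y + n < 1/2 + (n:ℝ) by linarith [hy.2])] with t ht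
      have := Pr_dom f (y := t - n) ⟨by linarith [ht.1], by linarith [ht.2]⟩ n
      rwa [sub_add_cancel] at this
    · have : y = -1/2 := le_antisymm h1 hy.1
      subst this
      filter_upwards [Ioo_mem_nhds (show -1/2 + (n:ℝ) - min (1/2 - w) (1/2) < -1/2 + n by have : 0 < min (1/2-w) (1/2) := by positivity
                                                                                          linarith) (show -1/2 + (n:ℝ) < 1/2 + (n:ℝ) by linarith)] with t ht
      rcases le_or_gt (-1/2) (t - n) with h2 | h2
      · have := Pr_dom f (y := t - n) ⟨h2, by linarith [ht.2]⟩ n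
        rwa [sub_add_cancel] at this
      · have m1 := min_le_left (1/2 - w) (1/2)
        have m2 := min_le_right (1/2 - w) (1/2)
        have := Pr_dom f (y := t - n + 1) ⟨by linarith [ht.1], by linarith⟩ (n - 1)
        have e : t - n + 1 + ((n - 1 : ℤ):ℝ) = t := by push_cast; ring
        rw [e] at this
        rw [this, hs _ (le_abs.2 (Or.inl (by linarith [ht.1]))), hs _ (le_abs.2 (Or.inr (by linarith)))]
        push_cast; ring
  constructor
  · refine contDiff_iff_contDiffAt.2 fun x => ?_
    obtain ⟨n, hn⟩ := key x
    refine ContDiffAt.congr_of_eventuallyEq ?_ hn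
    exact ((h.1.comp (contDiff_id.sub contDiff_const)).add contDiff_const).contDiffAt
  · intro x
    obtain ⟨n, hn⟩ := key x
    rw [hn.deriv_eq, deriv_add_const, deriv_comp_sub_const]
    exact h.2 _


structure Dyn (f : EQ) (lam : ℝ) : Prop where
  df : DF f.1
  l0 : 0 < lam
  l1 : lam < 1
  lin : ∀ x, |x| ≤ 1/100 → f.1 x = lam * x
  r : f.1 (1/2) = 1/2
  l : f.1 (-1/2) = -1/2
  lt : ∀ x, 0 < x → x < 1/2 → f.1 x < x
  gt : ∀ x, -1/2 < x → x < 0 → x < f.1 x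

lemma coe_S1_iff {x y : ℝ} : (x : S1) = (y : S1) ↔ ∃ n : ℤ, x = y + n := by
  rw [← sub_eq_zero, ← AddCircle.coe_sub, AddCircle.coe_eq_zero_iff]
  constructor
  · rintro ⟨n, h⟩; exact ⟨n, by simp at h; linarith⟩
  · rintro ⟨n, h⟩; exact ⟨n, by simp [h]⟩

lemma int_small {n : ℤ} (h1 : (n:ℝ) < 1) (h2 : -1 < (n:ℝ)) : n = 0 := by
  have l1' : n < 1 := by exact_mod_cast h1
  have l2' : -1 < n := by exact_mod_cast h2
  omega

lemma dyn_ex {F₁ : Equiv.Perm S1} (h : F1Hyp F₁) : ∃ f lam, Dyn f lam ∧ F₁ = prj f := by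
  obtain ⟨hfix, L, hL, -, hd0, -, a, b, hab⟩ := h
  obtain ⟨n, hn⟩ : ∃ n : ℤ, L 0 = 0 + n := by
    rw [← coe_S1_iff, ← hL.2.2.2]; exact (hfix _).2 (Or.inl rfl)
  have hL2 : IsLift F₁ (fun x => L x - n) := by
    refine ⟨hL.1.sub contDiff_const, fun x => by beta_reduce; rw [hL.2.1]; ring, fun x => ?_, fun x => ?_⟩
    · rw [deriv_sub_const]; exact hL.2.2.1 x
    · rw [hL.2.2.2, coe_S1_iff]; exact ⟨n, by ring⟩
  obtain ⟨f, fd, fe, ff⟩ := lift_perm hL2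
  have mf := fd.mono
  have f0 : f.1 0 = 0 := by rw [fe, hn]; ring
  have fx : ∀ x, f.1 x = x → ∃ m : ℤ, x = m ∨ x = 1/2 + m := fun x hx => by
    have h1 : F₁ (x : S1) = x := by rw [ff, prj_coe, hx]
    rcases (hfix _).1 h1 with h2 | h2
    · obtain ⟨m, hm⟩ := coe_S1_iff.1 h2; exact ⟨m, Or.inl (by linarith)⟩
    · obtain ⟨m, hm⟩ := coe_S1_iff.1 h2; exact ⟨m, Or.inr hm⟩
  have f1 : f.1 1 = 1 := by have := f.2 0; rw [f0] at this; simpa using this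
  have fr : f.1 (1/2) = 1/2 := by
    have h1 : ((f.1 (1/2) : ℝ) : S1) = ((1/2:ℝ) : S1) := by
      rw [← prj_coe, ← ff]; exact (hfix _).2 (Or.inr rfl)
    obtain ⟨m, hm⟩ := coe_S1_iff.1 h1
    have b1 := mf (show (0:ℝ) < 1/2 by norm_num)
    have b2 := mf (show (1/2:ℝ) < 1 by norm_num)
    rw [f0] at b1; rw [f1] at b2
    have : m = 0 := int_small (by linarith) (by linarith)
    rw [hm, this]; simp
  have fl : f.1 (-1/2) = -1/2 := by
    have h1 := f.2 (-1/2)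
    rw [show (-1/2 + 1 : ℝ) = 1/2 by norm_num, fr] at h1
    linarith
  have hlin : ∀ x, |x| ≤ 1/100 → f.1 x = a * x := fun x hx => by
    have := abs_le.1 hx
    rw [fe, hab x ⟨by linarith, by linarith⟩]
    have h0 := hab 0 ⟨by norm_num, by norm_num⟩
    linarith
  have ha : deriv L 0 = a := by
    have : L =ᶠ[𝓝 0] fun x => a * x + b := by
      filter_upwards [Ioo_mem_nhds (show (-1/100:ℝ) < 0 by norm_num) (show (0:ℝ) < 1/100 by norm_num)] with x hx
      exact hab x ⟨hx.1.le, hx.2.le⟩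
    rw [this.deriv_eq]; simp
  have a0 : 0 < a := ha ▸ hL.2.2.1 0
  have a1 : a < 1 := ha ▸ hd0
  have nf : ∀ x, f.1 x = x → x ≠ 0 → -1/2 < x → x < 1/2 → False := fun x hx h0 h1 h2 => by
    obtain ⟨m, hm | hm⟩ := fx x hx
    · have : m = 0 := int_small (by linarith) (by linarith)
      rw [this] at hm; simp at hm; exact h0 hm
    · have b1 : (m:ℝ) < 0 := by linarith
      have b2 : (-1:ℝ) < m := by linarith
      have b1' : m < 0 := by exact_mod_cast b1
      have b2' : -1 < m := by exact_mod_cast b2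
      omega
  have fc : Continuous f.1 := fd.1.continuous
  refine ⟨f, a, ⟨fd, a0, a1, hlin, fr, fl, fun x h0 h2 => ?_, fun x h1 h0 => ?_⟩, ff⟩
  · by_contra hc
    push Not at hc
    obtain ⟨y, hy, e⟩ := (isPreconnected_Ioo (a := (0:ℝ)) (b := 1/2)).intermediate_value₂ (f := f.1) (g := id)
      (a := 1/100) (b := x) ⟨by norm_num, by norm_num⟩ ⟨h0, h2⟩ fc.continuousOn continuousOn_id
      (by rw [hlin _ (by norm_num [abs_le])]; simp only [id]; linarith) hc
    exact nf y e hy.1.ne' (by linarith [hy.1]) hy.2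
  · by_contra hc
    push Not at hc
    obtain ⟨y, hy, e⟩ := (isPreconnected_Ioo (a := (-1/2:ℝ)) (b := 0)).intermediate_value₂ (f := f.1) (g := id)
      (a := x) (b := -1/100) ⟨h1, h0⟩ ⟨by norm_num, by norm_num⟩ fc.continuousOn continuousOn_id hc
      (by rw [hlin _ (by norm_num [abs_le])]; simp only [id]; linarith)
    exact nf y e hy.2.ne hy.1 (by linarith [hy.2])

lemma pow_tendsto {f : Equiv.Perm ℝ} (hf : Continuous f) {a : ℝ}
    (ha : ∀ x, 0 < x → x ≤ a → 0 < f x ∧ f x < x) (h0 : 0 < a) :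
    ∀ w > 0, ∃ m, ∀ k ≥ m, (f ^ k) a ≤ w := by
  have st : ∀ k, 0 < (f ^ k) a ∧ (f ^ k) a ≤ a := fun k => by
    induction k with
    | zero => simpa using h0
    | succ k ih =>
      rw [pow_succ', Equiv.Perm.mul_apply]
      have := ha _ ih.1 ih.2
      exact ⟨this.1, this.2.le.trans ih.2⟩
  have an : Antitone fun k => (f ^ k) a := antitone_nat_of_succ_le fun k => by
    rw [pow_succ', Equiv.Perm.mul_apply]; exact (ha _ (st k).1 (st k).2).2.le
  have bb : BddBelow (range fun k => (f ^ k) a) := ⟨0, by rintro _ ⟨k, rfl⟩; exact (st k).1.le⟩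
  have tl := tendsto_atTop_ciInf an bb
  set c := ⨅ k, (f ^ k) a
  have tl2 : Tendsto (fun k => (f ^ (k+1)) a) atTop (𝓝 (f c)) := by
    simp only [pow_succ', Equiv.Perm.mul_apply]
    exact (hf.tendsto c).comp tl
  have e : f c = c := tendsto_nhds_unique tl2 ((tendsto_add_atTop_iff_nat 1).2 tl)
  have c0 : 0 ≤ c := le_ciInf fun k => (st k).1.le
  have ca : c ≤ a := ciInf_le_of_le bb 0 (by simp)
  have : c = 0 := by
    by_contra h
    have := ha c (lt_of_le_of_ne c0 (Ne.symm h)) ca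
    linarith [this.2]
  rw [this] at tl
  intro w hw
  have := tl.eventually (gt_mem_nhds hw)
  obtain ⟨m, hm⟩ := eventually_atTop.1 this
  exact ⟨m, fun k hk => (hm k hk).le⟩

lemma Dyn.f0 {f lam} (h : Dyn f lam) : f.1 0 = 0 := by rw [h.lin 0 (by norm_num)]; ring

lemma DF.pow {f : Equiv.Perm ℝ} (h : DF f) (k : ℕ) : DF (f ^ k) := by
  induction k with
  | zero => exact DF.one
  | succ k ih => rw [pow_succ]; exact ih.mul h

def ngP : Equiv.Perm ℝ := Equiv.neg ℝ

lemma Dyn.contr {f lam} (h : Dyn f lam) {w : ℝ} (hw : 0 < w) :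
    ∃ m, ∀ x, |x| ≤ 5/12 → |(f.1 ^ m) x| ≤ w := by
  have fc : Continuous f.1 := h.df.1.continuous
  have mf := h.df.mono
  obtain ⟨m1, h1⟩ := pow_tendsto fc (a := 5/12) (fun x h0 h1 =>
    ⟨by have := mf h0; rwa [h.f0] at this, h.lt x h0 (by linarith)⟩) (by norm_num) w hw
  have key : ∀ k x, ((ngP * f.1 * ngP) ^ k) x = -((f.1 ^ k) (-x)) := fun k => by
    have : (ngP * f.1 * ngP) ^ k = ngP * f.1 ^ k * ngP⁻¹ := by
      rw [← conj_pow]; rfl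
    rw [this]; intro x; rfl
  have kc : ∀ x, (ngP * f.1 * ngP) x = -(f.1 (-x)) := fun x => rfl
  obtain ⟨m2, h2⟩ := pow_tendsto (f := ngP * f.1 * ngP) (by
      show Continuous fun x => -(f.1 (-x))
      fun_prop) (a := 5/12) (fun x h0 h1 => by
    rw [kc]
    have := mf (show -x < 0 by linarith)
    rw [h.f0] at this
    have := h.gt (-x) (by linarith) (by linarith)
    constructor <;> linarith) (by norm_num) w hw
  refine ⟨max m1 m2, fun x hx => ?_⟩
  have a1 := h1 _ (le_max_left m1 m2)
  have a2 := h2 _ (le_max_right m1 m2)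
  rw [key] at a2
  have mm := (h.df.pow (max m1 m2)).mono.monotone
  have b1 := mm (abs_le.1 hx).1
  have b2 := mm (abs_le.1 hx).2
  rw [abs_le]
  constructor <;> linarith

def tau (t : ℝ) : EQ := ⟨Equiv.addRight t, fun x => by show x + 1 + t = x + t + 1; ring⟩
lemma tau_ap (t x : ℝ) : (tau t).1 x = x + t := rfl
lemma tau_inv (t x : ℝ) : (tau t).1.symm x = x - t := rfl
lemma tau_neg (t : ℝ) : (tau t)⁻¹ = tau (-t) := Subtype.ext (Equiv.ext fun x => by
  show x - t = x + -t; ring)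
lemma tau_DF (t : ℝ) : DF (tau t).1 := ⟨by
  show Sm fun x : ℝ => x + t
  unfold Sm; fun_prop, fun x => by
  show 0 < deriv (fun x : ℝ => x + t) x
  simp⟩

def rotHom : Multiplicative S1 →* Equiv.Perm S1 where
  toFun t := rot t.toAdd
  map_one' := Equiv.ext fun x => add_zero x
  map_mul' s t := Equiv.ext fun x => by
    show x + (s.toAdd + t.toAdd) = x + t.toAdd + s.toAdd
    rw [add_assoc, add_comm s.toAdd]

lemma tau_rot (α : ℝ) (j n : ℤ) : prj (tau (j * α + n)) = rot (α : S1) ^ j := by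
  have : prj (tau (j * α + n)) = rot ((j * α + n : ℝ) : S1) := (prj_eq fun x => rfl).symm
  have e2 : rot (α : S1) ^ j = rot (j • (α : S1)) := (map_zpow rotHom (Multiplicative.ofAdd (α : S1)) j).symm
  rw [this, e2]
  congr 1
  have : ((j • α : ℝ) : S1) = j • (α : S1) := AddCircle.coe_zsmul 1
  rw [← this, coe_S1_iff]
  exact ⟨n, by simp⟩

lemma dens {α : ℝ} (h : Irrational α) {a b : ℝ} (hab : a < b) : ∃ j n : ℤ, j * α + n ∈ Ioo a b := by
  have := (dense_addSubgroupClosure_pair_iff (a := α) (b := 1)).2 (by simpa using h)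
  obtain ⟨x, hx, hx2⟩ := this.exists_between hab
  obtain ⟨j, n, e⟩ := AddSubgroup.mem_closure_pair.1 hx
  exact ⟨j, n, by simpa [← e] using hx2⟩


def Z0 {ι : Type*} (l : Filter ι) (u : ι → ℝ → ℝ) : Prop := ∀ ε > 0, ∀ᶠ i in l, ∀ x, |u i x| ≤ ε

lemma cos_half {t : ℝ} (h : |t| ≤ 1/6) : 1/2 ≤ Real.cos (2 * Real.pi * t) := by
  rw [← Real.cos_abs, ← Real.cos_pi_div_three]
  have hp := Real.pi_pos
  have e : |2 * Real.pi * t| = 2 * Real.pi * |t| := by rw [abs_mul, abs_of_pos (by positivity)]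
  rw [e]
  apply Real.cos_le_cos_of_nonneg_of_le_pi (by positivity) (by linarith)
  nlinarith

def chi (x : ℝ) : ℝ := st (2 * Real.cos (2 * Real.pi * x))
def sg0 (x : ℝ) : ℝ := 2 * Real.sin (2 * Real.pi * x) * st (2 * Real.cos (2 * Real.pi * x) + 1)

lemma chi_sm : Sm chi := st_sm.comp (show Sm fun x : ℝ => 2 * Real.cos (2 * Real.pi * x) by unfold Sm; fun_prop)
lemma sg0_sm : Sm sg0 := ContDiff.mul (by fun_prop) (st_sm.comp (show Sm fun x : ℝ => 2 * Real.cos (2 * Real.pi * x) + 1 by unfold Sm; fun_prop))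
lemma cos_p (x : ℝ) : Real.cos (2 * Real.pi * (x + 1)) = Real.cos (2 * Real.pi * x) := by
  rw [mul_add, mul_one, Real.cos_add_two_pi]
lemma sin_p (x : ℝ) : Real.sin (2 * Real.pi * (x + 1)) = Real.sin (2 * Real.pi * x) := by
  rw [mul_add, mul_one, Real.sin_add_two_pi]
lemma chi_p (x : ℝ) : chi (x + 1) = chi x := by rw [chi, chi, cos_p]
lemma sg0_p (x : ℝ) : sg0 (x + 1) = sg0 x := by rw [sg0, sg0, cos_p, sin_p]
lemma chi_BS : BS chi := BS.of_periodic chi_sm chi_p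
lemma sg0_BS : BS sg0 := BS.of_periodic sg0_sm sg0_p
lemma chi_b (x : ℝ) : 0 ≤ chi x ∧ chi x ≤ 1 := ⟨st_nn _, st_le _⟩
lemma chi_one {x : ℝ} (h : |x| ≤ 1/6) : chi x = 1 := st1 (by linarith [cos_half h])
lemma out_zero {x : ℝ} (h : |x - 1/2| ≤ 1/6) : chi x = 0 ∧ sg0 x = 0 := by
  have h1 := cos_half h
  have h2 : Real.cos (2 * Real.pi * (x - 1/2)) = - Real.cos (2 * Real.pi * x) := by
    rw [← Real.cos_sub_pi]; congr 1; ring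
  rw [h2] at h1
  exact ⟨st0 (by linarith), by rw [sg0, st0 (by linarith), mul_zero]⟩

lemma chi_key (x : ℝ) {v e : ℝ} (hv : |v| ≤ e) : 0 ≤ deriv chi x * (v - e * sg0 x) := by
  have d : deriv chi x = deriv st (2 * Real.cos (2 * Real.pi * x)) * (-(4 * Real.pi * Real.sin (2 * Real.pi * x))) := by
    have a1 : HasDerivAt (fun x : ℝ => 2 * Real.cos (2 * Real.pi * x)) (-(4 * Real.pi * Real.sin (2 * Real.pi * x))) x := by
      have := (((hasDerivAt_id x).const_mul (2 * Real.pi)).cos).const_mul 2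
      refine this.congr_deriv ?_
      simp only [id]; ring
    exact ((st_sm.d _).hasDerivAt.comp x a1).deriv
  rw [d]
  set c := Real.cos (2 * Real.pi * x) with hc
  set s := Real.sin (2 * Real.pi * x) with hs
  have sc : s^2 + c^2 = 1 := Real.sin_sq_add_cos_sq _
  have b1 : 0 ≤ deriv st (2 * c) := st_mono.deriv_nonneg
  have hp := Real.pi_pos
  have hv' := abs_le.1 hv
  have e0 : 0 ≤ e := (abs_nonneg _).trans hv
  rcases lt_or_ge (2 * c) 0 with h | h
  · have : deriv st (2 * c) = 0 := by
      have : st =ᶠ[𝓝 (2*c)] fun _ => (0:ℝ) := by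
        filter_upwards [Iio_mem_nhds h] with y hy using st0 hy.le
      rw [this.deriv_eq]; simp
    rw [this]; simp
  rcases lt_or_ge 1 (2 * c) with h' | h'
  · have : deriv st (2 * c) = 0 := by
      have : st =ᶠ[𝓝 (2*c)] fun _ => (1:ℝ) := by
        filter_upwards [Ioi_mem_nhds h'] with y hy using st1 (le_of_lt hy)
      rw [this.deriv_eq]; simp
    rw [this]; simp
  have z : sg0 x = 2 * s := by rw [sg0, st1 (by linarith), mul_one]
  rw [z]
  have key : 0 ≤ -(s * (v - e * (2 * s))) := by
    have s2 : 1/4 ≤ s^2 := by nlinarith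
    rcases le_total 0 s with h0 | h0
    · have : 1/2 ≤ s := by nlinarith
      have : v - e * (2 * s) ≤ 0 := by nlinarith
      nlinarith
    · have : s ≤ -1/2 := by nlinarith
      have : 0 ≤ v - e * (2 * s) := by nlinarith
      nlinarith
  have := mul_nonneg b1 (mul_nonneg (by positivity : 0 ≤ 4 * Real.pi) key)
  linarith

def fw (h : Equiv.Perm ℝ) (x : ℝ) : ℝ := chi x * dsp h x + (1 - chi x) * (NN 0 (dsp h) * sg0 x)

lemma EQ_dsp {h : Equiv.Perm ℝ} (hh : h ∈ EQ) (x : ℝ) : dsp h (x + 1) = dsp h x := by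
  rw [dsp, hh, dsp]; ring
lemma EQ_BS {h : Equiv.Perm ℝ} (hh : h ∈ EQ) (hd : DF h) : BS (dsp h) := BS.of_periodic hd.dsm (EQ_dsp hh)

def e0c : ℝ := 1 / (NN 1 sg0 + 1) / 2
lemma e0c_pos : 0 < e0c := by have := NN_nonneg 1 sg0; unfold e0c; positivity

structure Adm (h : EQ) : Prop where
  df : DF h.1
  sm : ∀ x, |dsp h.1 x| ≤ e0c

lemma fw_BS {h : EQ} (A : Adm h) : BS (fw h.1) :=
  (chi_BS.mul (EQ_BS h.2 A.df)).add (((BS.cst 1).sub chi_BS).mul (sg0_BS.cmul _))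

lemma fw_spec {h : EQ} (A : Adm h) : DF (mkP (fw h.1)) ∧ (∀ x, mkP (fw h.1) x = x + fw h.1 x) ∧ dsp (mkP (fw h.1)) = fw h.1 := by
  have vB := EQ_BS h.2 A.df
  refine mkP_spec (fw_BS A).sm (fun x => ?_) (fw_BS A).le0
  set e := NN 0 (dsp h.1)
  have ee : e ≤ e0c := NN0_le A.sm
  have e0 : 0 ≤ e := NN_nonneg _ _
  have d1 := (chi_sm.d x).hasDerivAt
  have d2 := (vB.sm.d x).hasDerivAt
  have d3 := ((sg0_sm.d x).hasDerivAt).const_mul e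
  have d := ((d1.mul d2).add ((d1.const_sub 1).mul d3)).deriv
  have d' : deriv (fw h.1) x = _ := d
  rw [d']
  have k := chi_key x (vB.le0 x)
  have p := A.df.dpos x
  have q := sg0_BS.le1 x
  have n1 := NN_nonneg 1 sg0
  have q2 : |e * deriv sg0 x| ≤ 1/2 := by
    rw [abs_mul, abs_of_nonneg e0]
    calc e * |deriv sg0 x| ≤ e0c * (NN 1 sg0 + 1) := mul_le_mul ee (by linarith) (abs_nonneg _) e0c_pos.le
      _ = 1/2 := by unfold e0c; field_simp
  have q3 := (abs_le.1 q2).1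
  have c := chi_b x
  have t1 : 0 ≤ chi x * (1 + deriv (dsp h.1) x) := mul_nonneg c.1 p.le
  rcases eq_or_lt_of_le c.2 with c1 | c1
  · have : 0 < chi x * (1 + deriv (dsp h.1) x) := by rw [c1, one_mul]; exact p
    have t2 : 0 ≤ (1 - chi x) * (1 + e * deriv sg0 x) := mul_nonneg (by linarith) (by linarith)
    nlinarith
  · have t2 : 0 < (1 - chi x) * (1 + e * deriv sg0 x) := mul_pos (by linarith) (by linarith)
    nlinarith

lemma fw_EQ {h : EQ} (A : Adm h) : mkP (fw h.1) ∈ EQ := fun x => by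
  rw [(fw_spec A).2.1, (fw_spec A).2.1, fw, chi_p, sg0_p, EQ_dsp h.2, fw]; ring

lemma fw_in {h : EQ} (A : Adm h) {x : ℝ} (hx : |x| ≤ 1/6) : mkP (fw h.1) x = h.1 x := by
  rw [(fw_spec A).2.1, fw, chi_one hx, dsp_eq h.1 x]; ring
lemma fw_out {h : EQ} (A : Adm h) {x : ℝ} (hx : |x - 1/2| ≤ 1/6) : mkP (fw h.1) x = x := by
  rw [(fw_spec A).2.1, fw, (out_zero hx).1, (out_zero hx).2]; ring

lemma fw_bd {h : EQ} (A : Adm h) {ε : ℝ} (hv : ∀ x, |dsp h.1 x| ≤ ε) (x : ℝ) : |fw h.1 x| ≤ 3 * ε := by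
  have c := chi_b x
  have e1 := hv x
  have e2 : NN 0 (dsp h.1) ≤ ε := NN0_le hv
  have e3 := NN_nonneg 0 (dsp h.1)
  have s : |sg0 x| ≤ 2 := by
    rw [sg0, abs_mul, abs_mul, abs_of_nonneg (st_nn _), abs_two]
    have := Real.abs_sin_le_one (2 * Real.pi * x)
    have := st_le (2 * Real.cos (2 * Real.pi * x) + 1)
    have := st_nn (2 * Real.cos (2 * Real.pi * x) + 1)
    have := abs_nonneg (Real.sin (2 * Real.pi * x))
    nlinarith
  rw [fw]
  refine (abs_add_le _ _).trans ?_
  rw [abs_mul, abs_mul, abs_mul, abs_of_nonneg c.1, abs_of_nonneg (by linarith : 0 ≤ 1 - chi x), abs_of_nonneg e3]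
  have a1 : chi x * |dsp h.1 x| ≤ 1 * ε := mul_le_mul c.2 e1 (abs_nonneg _) zero_le_one
  have a2 : NN 0 (dsp h.1) * |sg0 x| ≤ ε * 2 := mul_le_mul e2 s (abs_nonneg _) (e3.trans e2)
  have a3 : (1 - chi x) * (NN 0 (dsp h.1) * |sg0 x|) ≤ 1 * (ε * 2) :=
    mul_le_mul (by linarith) a2 (by positivity) zero_le_one
  linarith

lemma frag_EB {ι : Type*} {l : Filter ι} {r : ℕ} {h : ι → EQ} (A : ∀ i, Adm (h i))
    (eb : EB l (r+2) fun i => dsp (h i).1) (z : Z0 l fun i => dsp (h i).1) :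
    (EB l (r+2) (fun i => dsp (mkP (fw (h i).1))) ∧ Z0 l (fun i => dsp (mkP (fw (h i).1)))) ∧
    EB l (r+2) (fun i => dsp ((mkP (fw (h i).1))⁻¹ * (h i).1)) ∧ Z0 l (fun i => dsp ((mkP (fw (h i).1))⁻¹ * (h i).1)) := by
  have e1 : (fun i => dsp (mkP (fw (h i).1))) = fun i => fw (h i).1 := funext fun i => (fw_spec (A i)).2.2
  have w1 : EB l (r+2) fun i => fw (h i).1 := by
    refine ((chi_BS.eb _).mul eb).add ((((BS.cst 1).sub chi_BS).eb _).mul ((EB.const ⟨e0c, Eventually.of_forall fun i => ?_⟩).mul (sg0_BS.eb _)))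
    rw [abs_of_nonneg (NN_nonneg _ _)]
    exact NN0_le (A i).sm
  have w0 : Z0 l fun i => fw (h i).1 := fun ε he => by
    filter_upwards [z (ε/3) (by positivity)] with i hi x
    exact (fw_bd (A i) hi x).trans (by linarith)
  rw [e1]
  refine ⟨⟨w1, w0⟩, ?_⟩
  have w2 := EB.nl w1 w0
  have he : ∀ i x, dsp ((mkP (fw (h i).1))⁻¹ * (h i).1) x + fw (h i).1 (x + dsp ((mkP (fw (h i).1))⁻¹ * (h i).1) x) = dsp (h i).1 x := fun i x => by
    rw [← dsp_eq]
    have k : mkP (fw (h i).1) (((mkP (fw (h i).1))⁻¹ * (h i).1) x) = (h i).1 x := Equiv.apply_symm_apply _ _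
    rw [(fw_spec (A i)).2.1] at k
    unfold dsp; linarith
  refine ⟨EB.div (c := 1/2) (by norm_num) w1 eb (fun i => ((fw_spec (A i)).1.inv.mul (A i).df).dsm) (fun i x => ?_) ?_ he, fun ε hε => ?_⟩
  · have := (fw_spec (A i)).1.dpos x
    rwa [(fw_spec (A i)).2.2] at this
  · filter_upwards [w2.2 1 (by omega) (1/2) (by norm_num)] with i hi x
    have := hi x
    rw [iteratedDeriv_one] at this
    linarith [(abs_le.1 this).1]
  · filter_upwards [z (ε/2) (by positivity), w0 (ε/2) (by positivity)] with i h1 h2 x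
    have := he i x
    have a1 := abs_le.1 (h1 x)
    have a2 := abs_le.1 (h2 (x + dsp ((mkP (fw (h i).1))⁻¹ * (h i).1) x))
    rw [abs_le]; constructor <;> linarith

/-- cutting off -/
lemma cut_thm : ∃ c : Equiv.Perm ℝ → Equiv.Perm ℝ, (∀ g : EQ, DF g.1 → (∀ x, |x - 1/2| ≤ 1/12 → g.1 x = x) →
      DF (c g.1) ∧ Sup (5/12) (c g.1) ∧ ∀ x, |x| ≤ 1/2 → c g.1 x = g.1 x) ∧
    ∀ {ι : Type} {l : Filter ι} {r : ℕ} {h : ι → EQ}, (∀ i, DF (h i).1) → (∀ i x, |x - 1/2| ≤ 1/12 → (h i).1 x = x) →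
      EB l r (fun i => dsp (h i).1) → Z0 l (fun i => dsp (h i).1) →
      EB l r (fun i => dsp (c (h i).1)) ∧ Z0 l (fun i => dsp (c (h i).1)) := by
  obtain ⟨ψ, ps, p1, p0, pb⟩ := cut_ex (show (5/12:ℝ) < 1/2 by norm_num)
  have pB : BS ψ := BS.of_supp ps (B := 1/2) fun x hx => p0 x hx.le
  have key : ∀ g : EQ, DF g.1 → (∀ x, |x - 1/2| ≤ 1/12 → g.1 x = x) →
      (∀ x, 5/12 ≤ |x| → ψ x * dsp g.1 x = 0) ∧ (∀ x, |x| ≤ 1/2 → ψ x * dsp g.1 x = dsp g.1 x) := by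
    intro g hg hf
    have f0 : ∀ x, 5/12 ≤ |x| → |x| ≤ 1/2 → dsp g.1 x = 0 := fun x h1 h2 => by
      have h2' := abs_le.1 h2
      rcases le_abs.1 h1 with h3 | h3
      · rw [dsp, hf x (abs_le.2 ⟨by linarith, by linarith⟩)]; ring
      · rw [← EQ_dsp g.2, dsp, hf (x+1) (abs_le.2 ⟨by linarith, by linarith⟩)]; ring
    constructor
    · intro x hx
      rcases le_total |x| (1/2) with h | h
      · rw [f0 x hx h, mul_zero]
      · rw [p0 x h, zero_mul]
    · intro x hx
      rcases le_total |x| (5/12) with h | h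
      · rw [p1 x h, one_mul]
      · rw [f0 x h hx, mul_zero]
  have main : ∀ g : EQ, DF g.1 → (∀ x, |x - 1/2| ≤ 1/12 → g.1 x = x) →
      DF (mkP fun x => ψ x * dsp g.1 x) ∧ (∀ x, mkP (fun x => ψ x * dsp g.1 x) x = x + ψ x * dsp g.1 x) ∧
      dsp (mkP fun x => ψ x * dsp g.1 x) = fun x => ψ x * dsp g.1 x := by
    intro g hg hf
    obtain ⟨k1, k2⟩ := key g hg hf
    have B := pB.mul (EQ_BS g.2 hg)
    refine mkP_spec B.sm (fun x => ?_) B.le0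
    rcases lt_or_ge |x| (1/2) with h | h
    · have : (fun x => ψ x * dsp g.1 x) =ᶠ[𝓝 x] dsp g.1 := by
        filter_upwards [(isOpen_lt continuous_abs continuous_const).mem_nhds h] with y hy using k2 y hy.le
      rw [this.deriv_eq]; exact hg.dpos x
    · have : (fun x => ψ x * dsp g.1 x) =ᶠ[𝓝 x] fun _ => (0:ℝ) := by
        filter_upwards [(isOpen_lt continuous_const continuous_abs).mem_nhds (show 5/12 < |x| by linarith)] with y hy using k1 y (le_of_lt hy)
      rw [this.deriv_eq]; simp
  refine ⟨fun g => mkP fun x => ψ x * dsp g x, fun g hg hf => ⟨(main g hg hf).1, fun x hx => ?_, fun x hx => ?_⟩, ?_⟩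
  · rw [(main g hg hf).2.1, (key g hg hf).1 x hx, add_zero]
  · rw [(main g hg hf).2.1, (key g hg hf).2 x hx, ← dsp_eq]
  · intro ι l r h hd hf eb z
    have e1 : (fun i => dsp (mkP fun x => ψ x * dsp (h i).1 x)) = fun i x => ψ x * dsp (h i).1 x :=
      funext fun i => (main (h i) (hd i) (hf i)).2.2
    rw [e1]
    refine ⟨(pB.eb r).mul eb, fun ε he => ?_⟩
    filter_upwards [z ε he] with i hi x
    rw [abs_mul, abs_of_nonneg (pb x).1]
    have := hi x
    have := (pb x).2
    have := (pb x).1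
    have := abs_nonneg (dsp (h i).1 x)
    nlinarith


def bet : ℝ := 1/165000
lemma bet_pos : 0 < bet := by norm_num [bet]
def sc : Equiv.Perm ℝ := Equiv.mulLeft₀ bet bet_pos.ne'
lemma sc_ap (x : ℝ) : sc x = bet * x := rfl
lemma sc_inv (x : ℝ) : sc⁻¹ x = bet⁻¹ * x := rfl
lemma sc_DF : DF sc := ⟨by
  show Sm fun x : ℝ => bet * x
  unfold Sm; fun_prop, fun x => by
  show 0 < deriv (fun x : ℝ => bet * x) x
  rw [deriv_const_mul_id']; exact bet_pos⟩

lemma EQ_lip {g : Equiv.Perm ℝ} (hg : g ∈ EQ) (hd : DF g) (x y : ℝ) : |g x - g y| ≤ (1 + NN 1 (dsp g)) * |x - y| := by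
  have B := EQ_BS hg hd
  have := Convex.norm_image_sub_le_of_norm_deriv_le (f := dsp g) (s := univ) (C := NN 1 (dsp g)) (x := y) (y := x)
    (fun z _ => B.sm.d z) (fun z _ => B.le1 z) convex_univ trivial trivial
  rw [Real.norm_eq_abs, Real.norm_eq_abs] at this
  have e : g x - g y = (x - y) + (dsp g x - dsp g y) := by unfold dsp; ring
  rw [e, add_mul, one_mul]
  exact (abs_add_le _ _).trans (by linarith)

lemma conj_EB {ι : Type*} {l : Filter ι} {r : ℕ} {g : Equiv.Perm ℝ} (hg : g ∈ EQ) (hd : DF g) {p : ι → Equiv.Perm ℝ}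
    (eb : EB l r fun i => dsp (p i)) (z : Z0 l fun i => dsp (p i)) :
    EB l r (fun i => dsp (g * p i * g⁻¹)) ∧ Z0 l (fun i => dsp (g * p i * g⁻¹)) := by
  have B := EQ_BS hg hd
  have B' := EQ_BS (EQ.inv_mem hg) hd.inv
  constructor
  · have e : (fun i => dsp (g * p i * g⁻¹)) = fun i x => (dsp g⁻¹ x + dsp (p i) (x + dsp g⁻¹ x)) + dsp g (x + (dsp g⁻¹ x + dsp (p i) (x + dsp g⁻¹ x))) := by
      funext i x
      have a1 : x + (dsp g⁻¹ x + dsp (p i) (x + dsp g⁻¹ x)) = p i (g⁻¹ x) := by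
        rw [← add_assoc, ← dsp_eq, ← dsp_eq]
      have a2 : (dsp g⁻¹ x + dsp (p i) (x + dsp g⁻¹ x)) = p i (g⁻¹ x) - x := by linarith
      rw [a1, a2]
      show g (p i (g⁻¹ x)) - x = _
      rw [dsp_eq g]; ring
    rw [e]
    have h1 : EB l r fun i x => (dsp g⁻¹ x + dsp (p i) (x + dsp g⁻¹ x)) := (B'.eb r).add (eb.comp1 (B'.eb r))
    exact h1.add ((B.eb r).comp1 h1)
  · intro ε he
    have n1 := NN_nonneg 1 (dsp g)
    filter_upwards [z (ε / (1 + NN 1 (dsp g))) (by positivity)] with i hi x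
    have e : dsp (g * p i * g⁻¹) x = g (p i (g⁻¹ x)) - g (g⁻¹ x) := by
      show g (p i (g⁻¹ x)) - x = _
      congr 1; exact (g.apply_symm_apply x).symm
    rw [e]
    refine (EQ_lip hg hd _ _).trans ?_
    have := hi (g⁻¹ x)
    rw [le_div_iff₀ (by positivity)] at this
    rw [mul_comm]; exact this

lemma sc_EB {ι : Type*} {l : Filter ι} {r : ℕ} {p : ι → Equiv.Perm ℝ}
    (eb : EB l r fun i => dsp (p i)) (z : Z0 l fun i => dsp (p i)) :
    EB l r (fun i => dsp (sc⁻¹ * p i * sc)) ∧ Z0 l (fun i => dsp (sc⁻¹ * p i * sc)) := by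
  have e : (fun i => dsp (sc⁻¹ * p i * sc)) = fun i x => bet⁻¹ * dsp (p i) (bet * x + 0) := by
    funext i x
    show sc⁻¹ (p i (sc x)) - x = _
    rw [sc_ap, sc_inv, add_zero, dsp]
    have := bet_pos.ne'
    field_simp
  rw [e]
  refine ⟨(eb.affine bet 0).cmul _, fun ε he => ?_⟩
  have b := bet_pos
  filter_upwards [z (bet * ε) (by positivity)] with i hi x
  rw [abs_mul, abs_of_pos (by positivity), inv_mul_le_iff₀ b]
  exact hi _

lemma Dyn.pr {f lam} (h : Dyn f lam) (k : ℕ) : (f.1 ^ k) (1/2) = 1/2 := by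
  induction k with
  | zero => rfl
  | succ k ih => rw [pow_succ, Equiv.Perm.mul_apply, h.r, ih]
lemma Dyn.pl {f lam} (h : Dyn f lam) (k : ℕ) : (f.1 ^ k) (-1/2) = -1/2 := by
  induction k with
  | zero => rfl
  | succ k ih => rw [pow_succ, Equiv.Perm.mul_apply, h.l, ih]

lemma Sup.HI {w : ℝ} {p : Equiv.Perm ℝ} (h : Sup w p) (hw : w ≤ 1/2) : p ∈ HI := fun x hx => h x (by
  by_contra hc
  push Not at hc
  have := abs_lt.1 hc
  exact hx ⟨by linarith, by linarith⟩)

lemma Sup.fx {w : ℝ} {p : Equiv.Perm ℝ} (h : Sup w p) : Fx (-w) w p := fun x hx => h x (by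
  by_contra hc
  push Not at hc
  exact hx (abs_lt.1 hc))

lemma shr {f lam} (D : Dyn f lam) : ∃ m : ℕ, ∀ p, DF p → Sup (5/12) p →
    DF (sc⁻¹ * (f.1^m * p * (f.1^m)⁻¹) * sc) ∧ Sup 1 (sc⁻¹ * (f.1^m * p * (f.1^m)⁻¹) * sc) ∧
    ∃ P0 P : HI, P0.1 = p ∧ P.1 = sc * (sc⁻¹ * (f.1^m * p * (f.1^m)⁻¹) * sc) * sc⁻¹ ∧ Pr P0 = (f^m)⁻¹ * Pr P * f^m := by
  obtain ⟨m, hm⟩ := D.contr bet_pos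
  have DL := D.df.pow m
  have mm := DL.mono
  refine ⟨m, fun p hp hs => ?_⟩
  have h1 : DF (f.1^m * p * (f.1^m)⁻¹) := (DL.mul hp).mul DL.inv
  have h2 : Sup bet (f.1^m * p * (f.1^m)⁻¹) := fun x hx => by
    have : 5/12 ≤ |(f.1^m)⁻¹ x| := by
      by_contra hc
      push Not at hc
      have hc' := abs_lt.1 hc
      have a1 := mm hc'.1
      have a2 := mm hc'.2
      have a3 : (f.1^m) ((f.1^m)⁻¹ x) = x := Equiv.apply_symm_apply _ _
      rw [a3] at a1 a2
      have b1 := (abs_le.1 (hm (5/12) (by norm_num))).2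
      have b2 := (abs_le.1 (hm (-(5/12)) (by norm_num))).1
      rcases le_abs.1 hx with h | h <;> linarith
    rw [Equiv.Perm.mul_apply, Equiv.Perm.mul_apply, hs _ this]
    exact Equiv.apply_symm_apply _ _
  refine ⟨(sc_DF.inv.mul h1).mul sc_DF, fun x hx => ?_, ⟨p, hs.HI (by norm_num)⟩, ⟨f.1^m * p * (f.1^m)⁻¹, h2.HI (by norm_num [bet])⟩, rfl, ?_, ?_⟩
  · rw [Equiv.Perm.mul_apply, Equiv.Perm.mul_apply, h2]
    · exact Equiv.symm_apply_apply _ _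
    · rw [sc_ap, abs_mul, abs_of_pos bet_pos]
      have := bet_pos
      nlinarith
  · group
  · have := Pr_conj (f := ⟨p, hs.HI (by norm_num)⟩) (f' := ⟨f.1^m * p * (f.1^m)⁻¹, h2.HI (by norm_num [bet])⟩) (g := f^m)
      hs.fx mm ?_ ?_ (by norm_num) (by norm_num) rfl
    · rw [this]; group
    · have a := (D.pl m).symm.le.trans (mm.monotone (show (-1/2:ℝ) ≤ -(5/12) by norm_num))
      exact a
    · exact (mm.monotone (show (5/12:ℝ) ≤ 1/2 by norm_num)).trans (D.pr m).le

theorem frag_thm {f lam} (D : Dyn f lam) {r : ℝ} (hr : |r - 1/2| ≤ 1/12) : ∃ (m : ℕ) (q : Fin 2 → EQ → Equiv.Perm ℝ),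
    (∀ h, Adm h → (∀ c, DF (q c h) ∧ Sup 1 (q c h)) ∧ ∃ P : Fin 2 → HI, (∀ c, (P c).1 = sc * q c h * sc⁻¹) ∧
      h = ((f^m)⁻¹ * Pr (P 0) * f^m) * (tau r * ((f^m)⁻¹ * Pr (P 1) * f^m) * (tau r)⁻¹)) ∧
    ∀ s, ∀ ε > 0, ∃ δ > 0, ∀ h, Adm h → Cl (s+2) δ h.1 → ∀ c, Cl s ε (q c h) := by
  obtain ⟨m, hm⟩ := shr D
  obtain ⟨c, c1, c2⟩ := cut_thm
  let kk (h : EQ) : Fin 2 → Equiv.Perm ℝ := ![mkP (fw h.1), (tau r).1⁻¹ * ((mkP (fw h.1))⁻¹ * h.1) * ((tau r).1⁻¹)⁻¹]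
  have kE : ∀ h, Adm h → ∀ i, kk h i ∈ EQ := fun h A i => by
    fin_cases i
    · exact fw_EQ A
    · exact EQ.mul_mem (EQ.mul_mem (EQ.inv_mem (tau r).2) (EQ.mul_mem (EQ.inv_mem (fw_EQ A)) h.2)) (EQ.inv_mem (EQ.inv_mem (tau r).2))
  have kD : ∀ h, Adm h → ∀ i, DF (kk h i) := fun h A i => by
    fin_cases i
    · exact (fw_spec A).1
    · exact ((tau_DF r).inv.mul ((fw_spec A).1.inv.mul A.df)).mul (tau_DF r).inv.inv
  have kF : ∀ h, Adm h → ∀ i x, |x - 1/2| ≤ 1/12 → kk h i x = x := fun h A i x hx => by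
    fin_cases i
    · exact fw_out A (by linarith)
    · show (mkP (fw h.1))⁻¹ (h.1 (x + r)) - r = x
      have h1 : |x + r - 1| ≤ 1/6 := by
        have := abs_le.1 hx
        have := abs_le.1 hr
        rw [abs_le]; constructor <;> linarith
      have h2 := fw_in A h1
      have h3 := h.2 (x + r - 1)
      have h4 := fw_EQ A (x + r - 1)
      rw [sub_add_cancel] at h3 h4
      have : mkP (fw h.1) (x + r) = h.1 (x + r) := by rw [h3, h4, h2]
      have h5 : (mkP (fw h.1))⁻¹ (mkP (fw h.1) (x + r)) = x + r := Equiv.symm_apply_apply _ _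
      rw [← this, h5]; ring
  refine ⟨m, fun i h => sc⁻¹ * (f.1^m * c (kk h i) * (f.1^m)⁻¹) * sc, fun h A => ?_, fun s ε hε => ?_⟩
  · have C := fun i => c1 ⟨_, kE h A i⟩ (kD h A i) (kF h A i)
    have M := fun i => hm _ (C i).1 (C i).2.1
    refine ⟨fun i => ⟨(M i).1, (M i).2.1⟩, ?_⟩
    choose P0 P e1 e2 e3 using fun i => (M i).2.2
    refine ⟨P, e2, ?_⟩
    rw [← e3, ← e3]
    have e4 : ∀ i, Pr (P0 i) = ⟨_, kE h A i⟩ := fun i => by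
      refine Subtype.ext (EQ_ext (Pr (P0 i)).2 (kE h A i) fun x hx => ?_)
      rw [Pr_dom0 _ hx, e1]
      exact (C i).2.2 x (abs_le.2 ⟨by linarith [hx.1], by linarith [hx.2]⟩)
    rw [e4, e4]
    apply Subtype.ext
    show h.1 = mkP (fw h.1) * ((tau r).1 * ((tau r).1⁻¹ * ((mkP (fw h.1))⁻¹ * h.1) * ((tau r).1⁻¹)⁻¹) * ((tau r).1)⁻¹)
    group
  · let ι := {h : EQ // Adm h}
    let g : ι → ℝ := fun h => nr (s + 3) (dsp h.1.1)
    have ev : ∀ ε > 0, ∀ᶠ i in comap g (𝓝 0), g i < ε := fun ε he => by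
      rw [eventually_comap]
      filter_upwards [gt_mem_nhds he] with a ha i hi
      rw [hi]; exact ha
    have eb : EB (comap g (𝓝 0)) (s+2) fun i : ι => dsp i.1.1 :=
      EB_of_nr (fun i => EQ_BS i.1.2 i.2.df) ⟨1, (ev 1 one_pos).mono fun i hi => hi.le⟩
    have z : Z0 (comap g (𝓝 0)) fun i : ι => dsp i.1.1 := fun ε he => by
      filter_upwards [ev ε he] with i hi x
      exact ((EQ_BS i.1.2 i.2.df).le0 x).trans ((NN_le_nr (by omega) _).trans hi.le)
    obtain ⟨a1, a2⟩ := frag_EB (fun i : ι => i.2) eb z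
    have k : ∀ j : Fin 2, EB (comap g (𝓝 0)) (s+2) (fun i : ι => dsp (kk i.1 j)) ∧ Z0 (comap g (𝓝 0)) (fun i : ι => dsp (kk i.1 j)) := fun j => by
      fin_cases j
      · exact a1
      · exact conj_EB (EQ.inv_mem (tau r).2) (tau_DF r).inv a2.1 a2.2
    have fin : ∀ j : Fin 2, NL (comap g (𝓝 0)) s (fun i : ι => dsp (sc⁻¹ * (f.1^m * c (kk i.1 j) * (f.1^m)⁻¹) * sc)) := fun j => by
      have b := c2 (h := fun i : ι => ⟨kk i.1 j, kE _ i.2 j⟩) (fun i => kD _ i.2 j) (fun i => kF _ i.2 j) (k j).1 (k j).2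
      have b2 := conj_EB (EQ.pow_mem f.2 m) (D.df.pow m) b.1 b.2
      have b3 := sc_EB b2.1 b2.2
      exact (EB.nl (r := s+1) b3.1 b3.2).mono (by omega)
    choose δ h0 hδ using fun j => nl_ex (fun i => nr_nonneg _ _) (fin j) hε
    refine ⟨min (δ 0) (δ 1) / ((s+2+1 : ℕ):ℝ), div_pos (lt_min (h0 0) (h0 1)) (by positivity), fun h A hc j => hδ j ⟨h, A⟩ ?_⟩
    refine (Cl.nr hc).trans ?_
    rw [mul_div_cancel₀ _ (by positivity)]
    fin_cases j
    exacts [min_le_left _ _, min_le_right _ _]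


lemma map_Wd {G H : Type*} [Group G] [Group H] (φ : G →* H) (a : Fin 4 → G) (b : Fin 3 → G) :
    φ (Wd a b) = Wd (fun k => φ (a k)) (fun k => φ (b k)) := by
  simp only [Wd, map_mul, map_inv, map_WW]

lemma Wd_split {G : Type*} [Group G] (P Q : Subgroup G) (hc : ∀ x ∈ P, ∀ y ∈ Q, Commute x y)
    {α u : Fin 4 → G} {m b : Fin 3 → G} (h1 : ∀ k, α k ∈ P) (h2 : ∀ k, m k ∈ P) (h3 : ∀ k, u k ∈ Q) (h4 : ∀ k, b k ∈ Q) :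
    Wd (fun k => α k * u k) (fun k => m k * b k) = Wd α m * Wd u b := by
  let φ := MonoidHom.noncommCoprod P.subtype Q.subtype (fun x y => hc x.1 x.2 y.1 y.2)
  let α' : Fin 4 → P := fun k => ⟨_, h1 k⟩
  let m' : Fin 3 → P := fun k => ⟨_, h2 k⟩
  let u' : Fin 4 → Q := fun k => ⟨_, h3 k⟩
  let b' : Fin 3 → Q := fun k => ⟨_, h4 k⟩
  have e := map_Wd φ (fun k => (α' k, u' k)) (fun k => (m' k, b' k))
  refine Eq.trans (Eq.symm (e.trans ?_)) ?_
  · rfl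
  · have e1 := map_Wd (MonoidHom.fst P Q) (fun k => (α' k, u' k)) (fun k => (m' k, b' k))
    have e2 := map_Wd (MonoidHom.snd P Q) (fun k => (α' k, u' k)) (fun k => (m' k, b' k))
    have e3 := map_Wd P.subtype α' m'
    have e4 := map_Wd Q.subtype u' b'
    exact congrArg₂ (· * ·) ((congrArg P.subtype e1).trans e3) ((congrArg Q.subtype e2).trans e4)

/-- pointwise stabilizer -/
def fixS (K : Set ℝ) : Subgroup (Equiv.Perm ℝ) where
  carrier := {f | ∀ x ∈ K, f x = x}
  mul_mem' := fun {f g} hf hg x hx => by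
    show f (g x) = x
    rw [hg x hx, hf x hx]
  one_mem' := fun _ _ => rfl
  inv_mem' := fun {f} hf x hx => by rw [Equiv.Perm.inv_eq_iff_eq, hf x hx]

lemma fixS_comm (K : Set ℝ) : ∀ x ∈ fixS Kᶜ, ∀ y ∈ fixS K, Commute x y := fun x hx y hy =>
  Equiv.Perm.Disjoint.commute fun z => by
    by_cases h : z ∈ K
    · exact Or.inr (hy z h)
    · exact Or.inl (hx z h)

lemma emb {J K : Set ℝ} (hJK : J ⊆ K) {û α : Fin 4 → Equiv.Perm ℝ} {b m : Fin 3 → Equiv.Perm ℝ}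
    (hα : ∀ k, α k ∈ fixS Jᶜ) (hm : ∀ k, m k ∈ fixS Jᶜ) (hu : ∀ k, ∀ x ∈ K, û k x = α k x)
    (hb : ∀ k, ∀ x ∈ J, b k x = m k x) (hb2 : ∀ k, b k ∈ fixS Kᶜ) : Wd û b = Wd α m := by
  have u1 : ∀ k, (α k)⁻¹ * û k ∈ fixS K := fun k x hx => by
    rw [Equiv.Perm.mul_apply, hu k x hx]; exact Equiv.symm_apply_apply _ _
  have b1 : ∀ k, (m k)⁻¹ * b k ∈ fixS J := fun k x hx => by
    rw [Equiv.Perm.mul_apply, hb k x hx]; exact Equiv.symm_apply_apply _ _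
  have b2 : ∀ k, (m k)⁻¹ * b k ∈ fixS Kᶜ := fun k =>
    (fixS _).mul_mem ((fixS _).inv_mem fun x hx => hm k x fun h => hx (hJK h)) (hb2 k)
  have e := Wd_split _ _ (fixS_comm J) hα hm (fun k x hx => u1 k x (hJK hx)) b1
  simp only [mul_inv_cancel_left] at e
  rw [e]
  have e2 := Wd_split _ _ (fixS_comm K) (α := fun _ => 1) (b := fun _ => 1) (fun _ => (fixS _).one_mem) b2 u1 (fun _ => (fixS _).one_mem)
  simp only [one_mul, mul_one] at e2
  rw [e2]
  simp [Wd, WW]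

lemma iter_aff {d : ℝ → ℝ} (hd : Sm d) (c p q : ℝ) (k : ℕ) :
    iteratedDeriv k (fun x => c * d (p * x + q)) = fun x => c * p^k * iteratedDeriv k d (p * x + q) := by
  induction k with
  | zero => funext x; simp
  | succ k ih =>
    rw [iteratedDeriv_succ, ih]
    funext x
    have h1 : HasDerivAt (fun x : ℝ => p * x + q) p x := by
      simpa using ((hasDerivAt_id x).const_mul p).add_const q
    have h2 := ((hd.hd k (p * x + q)).comp x h1).const_mul (c * p^k)
    rw [show (fun x => c * p^k * iteratedDeriv k d (p * x + q)) = fun x => c * p^k * (iteratedDeriv k d ∘ fun x => p * x + q) x from rfl, h2.deriv]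
    ring

def Aff (xs : ℝ) : Equiv.Perm ℝ := (tau xs).1 * sc
lemma Aff_ap (xs x : ℝ) : Aff xs x = bet * x + xs := rfl
lemma Aff_inv (xs x : ℝ) : (Aff xs)⁻¹ x = bet⁻¹ * (x - xs) := rfl
lemma Aff_conj (xs : ℝ) (a : Equiv.Perm ℝ) (x : ℝ) :
    (Aff xs * a * (Aff xs)⁻¹) x = x + bet * dsp a (bet⁻¹ * (x - xs)) := by
  rw [Equiv.Perm.mul_apply, Equiv.Perm.mul_apply, Aff_inv, Aff_ap, dsp]
  have := bet_pos.ne'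
  field_simp; ring

lemma Aff_fx {xs : ℝ} {a : Equiv.Perm ℝ} (ha : Sup 33 a) {x : ℝ} (hx : 1/5000 ≤ |x - xs|) :
    (Aff xs * a * (Aff xs)⁻¹) x = x := by
  rw [Aff_conj, dsp, ha, sub_self, mul_zero, add_zero]
  rw [abs_mul, abs_of_pos (inv_pos.2 bet_pos), ← div_eq_inv_mul, le_div_iff₀ bet_pos]
  exact le_trans (by norm_num [bet]) hx

lemma V_ex {Λ xs : ℝ} (L0 : 0 < Λ) (L1 : Λ < 1/10) (hx : xs ∈ Ioo (1/200:ℝ) (51/10000)) {a : ℕ → Equiv.Perm ℝ}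
    (ha : ∀ i, DF (a i) ∧ Sup 33 (a i)) {s : ℕ → ℕ} (hs : Tendsto s atTop atTop)
    (hc : ∀ᶠ i in atTop, Cl (s i) ((1/2)^i * (Λ^i * bet)^(s i)) (a i)) :
    ∃ V, DF V ∧ Sup (1/100) V ∧ ∀ i x, x ∈ Icc (1/1000:ℝ) (1/100) → V (Λ^i * x) = Λ^i * (Aff xs * a i * (Aff xs)⁻¹) x := by
  have b0 := bet_pos
  have Lp : ∀ i, 0 < Λ^i := fun i => pow_pos L0 i
  have Ll : ∀ i, Λ^i ≤ 1 := fun i => pow_le_one₀ L0.le (by linarith)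
  let g : ℕ → ℝ → ℝ := fun i x => (Λ^i * bet) * dsp (a i) ((Λ^i * bet)⁻¹ * x + -(bet⁻¹ * xs))
  have dB : ∀ i, BS (dsp (a i)) := fun i => (ha i).2.bs (ha i).1
  have gB : ∀ i, BS (g i) := fun i => ((dB i).affine _ _).cmul _
  have git : ∀ i k x, iteratedDeriv k (g i) x = (Λ^i * bet) * ((Λ^i * bet)⁻¹)^k * iteratedDeriv k (dsp (a i)) ((Λ^i * bet)⁻¹ * x + -(bet⁻¹ * xs)) :=
    fun i k x => by rw [iter_aff (dB i).sm]
  have arg : ∀ i x, (Λ^i * bet)⁻¹ * x + -(bet⁻¹ * xs) = bet⁻¹ * ((Λ^i)⁻¹ * x - xs) := fun i x => by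
    rw [mul_inv]; ring
  have argb : ∀ i x, 1/5000 < |(Λ^i)⁻¹ * x - xs| → 33 < |bet⁻¹ * ((Λ^i)⁻¹ * x - xs)| := fun i x h => by
    rw [abs_mul, abs_of_pos (inv_pos.2 b0), ← div_eq_inv_mul, lt_div_iff₀ b0]
    exact lt_of_le_of_lt (by norm_num [bet]) h
  have gz : ∀ i x k, 1/5000 < |(Λ^i)⁻¹ * x - xs| → iteratedDeriv k (g i) x = 0 := fun i x k h => by
    rw [git, arg, iter_zero_of_zero (U := {y | 33 < |y|}) (isOpen_lt continuous_const continuous_abs) _ k _ (argb i x h), mul_zero]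
    intro y hy
    rw [dsp, (ha i).2 y (le_of_lt hy), sub_self]
  have uq : ∀ i x, x ∈ Icc (1/1000:ℝ) (1/100) → ∀ j, j ≠ i → 1/5000 < |(Λ^j)⁻¹ * (Λ^i * x) - xs| := fun i x hxx j hj => by
    rcases lt_or_gt_of_ne hj with h | h
    · obtain ⟨k, rfl⟩ := Nat.exists_eq_add_of_lt h
      have e : (Λ^j)⁻¹ * (Λ^(j+k+1) * x) = Λ^k * (Λ * x) := by
        have := (Lp j).ne'
        rw [pow_succ, pow_add]; field_simp
      rw [e]
      have h1 : Λ * x ≤ 1/10 * (1/100) := mul_le_mul L1.le hxx.2 (by linarith [hxx.1]) (by norm_num)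
      have h0 : 0 < Λ * x := mul_pos L0 (by linarith [hxx.1])
      have h2 : Λ^k * (Λ * x) ≤ 1 * (Λ * x) := mul_le_mul_of_nonneg_right (Ll k) h0.le
      rw [lt_abs]; right; linarith [hx.1]
    · obtain ⟨k, rfl⟩ := Nat.exists_eq_add_of_lt h
      have e : (Λ^(i+k+1))⁻¹ * (Λ^i * x) = (Λ^(k+1))⁻¹ * x := by
        have := (Lp i).ne'
        have := (Lp k).ne'
        have := L0.ne'
        rw [pow_succ, pow_add, pow_succ]; field_simp
      rw [e]
      have h1 : Λ^(k+1) ≤ 1/10 := by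
        rw [pow_succ]
        have := Ll k
        have := Lp k
        nlinarith
      have h2 : 10 ≤ (Λ^(k+1))⁻¹ := by
        rw [le_inv_comm₀ (by norm_num) (Lp _)]; linarith
      have h3 : 10 * (1/1000) ≤ (Λ^(k+1))⁻¹ * x := mul_le_mul h2 hxx.1 (by norm_num) (by positivity)
      rw [lt_abs]; left; linarith [hx.2]
  have bd : ∀ k, ∀ᶠ i in atTop, ∀ x, |iteratedDeriv k (g i) x| ≤ (1/2)^i := fun k => by
    filter_upwards [hc, hs.eventually_ge_atTop k] with i h1 h2 x
    have hp : 0 < Λ^i * bet := mul_pos (Lp i) b0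
    have hl : Λ^i * bet ≤ 1 := by
      have := Ll i
      have : bet ≤ 1 := by norm_num [bet]
      nlinarith
    rw [git, abs_mul, abs_of_pos (by positivity)]
    calc _ ≤ (Λ^i * bet) * ((Λ^i * bet)⁻¹)^k * ((1/2)^i * (Λ^i * bet)^(s i)) := by
            gcongr; exact h1 k h2 _
      _ = (1/2)^i * ((Λ^i * bet) * (Λ^i * bet)^(s i - k)) := by
            obtain ⟨t, ht⟩ := Nat.exists_eq_add_of_le h2
            rw [ht, Nat.add_sub_cancel_left, pow_add, inv_pow]; field_simp
      _ ≤ (1/2)^i * (1 * 1) := by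
            gcongr; exact pow_le_one₀ hp.le hl
      _ = (1/2)^i := by ring
  have sg : Summable fun i : ℕ => ((1:ℝ)/2)^i := summable_geometric_two
  have Vs : Sm fun x => ∑' i, g i x := by
    refine contDiff_tsum_of_eventually (v := fun _ i => (1/2)^i) (fun i => (gB i).sm) (fun _ _ => sg) fun k _ => ?_
    rw [Nat.cofinite_eq_atTop]
    filter_upwards [bd k] with i hi x
    rw [norm_iteratedFDeriv_eq_norm_iteratedDeriv]; exact hi x
  have sk : ∀ k, Summable fun i => NN k (g i) := fun k => by
    refine Summable.of_norm_bounded_eventually_nat sg ?_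
    filter_upwards [bd k] with i hi
    rw [Real.norm_eq_abs, abs_of_nonneg (NN_nonneg _ _)]; exact NN_le hi
  have s0 : ∀ x, Summable fun i => g i x := fun x =>
    Summable.of_norm_bounded (sk 0) fun i => (gB i).le0 x
  have Vd : ∀ x, HasDerivAt (fun x => ∑' i, g i x) (∑' i, deriv (g i) x) x := fun x =>
    hasDerivAt_tsum (sk 1) (fun i y => ((gB i).sm.d y).hasDerivAt) (fun i y => (gB i).le1 y) (s0 0) x
  have Vb : ∀ x, |∑' i, g i x| ≤ ∑' i, NN 0 (g i) := fun x => by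
    rw [← Real.norm_eq_abs]
    exact tsum_of_norm_bounded (sk 0).hasSum fun i => (gB i).le0 x
  have Vp : ∀ x, 0 < 1 + deriv (fun x => ∑' i, g i x) x := fun x => by
    rw [(Vd x).deriv]
    by_cases h : ∃ i, |(Λ^i)⁻¹ * x - xs| ≤ 1/5000
    · obtain ⟨i, hi⟩ := h
      have hi' := abs_le.1 hi
      have ex : x = Λ^i * ((Λ^i)⁻¹ * x) := by rw [mul_inv_cancel_left₀ (Lp i).ne']
      rw [tsum_eq_single i]
      · have := git i 1 x
        rw [iteratedDeriv_one, iteratedDeriv_one, pow_one, mul_inv_cancel₀ (mul_pos (Lp i) b0).ne', one_mul] at this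
        rw [this]; exact (ha i).1.dpos _
      · intro j hj
        have := gz j x 1 (by
          rw [ex]
          exact uq i _ ⟨by linarith [hx.1], by linarith [hx.2]⟩ j hj)
        rwa [iteratedDeriv_one] at this
    · push Not at h
      have : ∀ i, deriv (g i) x = 0 := fun i => by
        have := gz i x 1 (h i)
        rwa [iteratedDeriv_one] at this
      simp [this]
  obtain ⟨v1, v2, v3⟩ := mkP_spec Vs Vp Vb
  refine ⟨_, v1, fun x hxx => ?_, fun i x hxx => ?_⟩
  · rw [v2]
    have : ∀ i, g i x = 0 := fun i => by
      have := gz i x 0 (by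
        have h1 : 1 ≤ (Λ^i)⁻¹ := (one_le_inv₀ (Lp i)).2 (Ll i)
        rcases le_abs.1 hxx with h | h
        · have : 1 * (1/100) ≤ (Λ^i)⁻¹ * x := mul_le_mul h1 h (by norm_num) (by positivity)
          rw [lt_abs]; left; linarith [hx.2]
        · have : 0 < (Λ^i)⁻¹ * (-x) := mul_pos (by positivity) (by linarith)
          rw [lt_abs]; right; linarith [hx.1])
      rwa [iteratedDeriv_zero] at this
    simp [this]
  · rw [v2, tsum_eq_single i, Aff_conj]
    · show Λ^i * x + (Λ^i * bet) * dsp (a i) _ = _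
      rw [arg, inv_mul_cancel_left₀ (Lp i).ne']; ring
    · intro j hj
      have := gz j (Λ^i * x) 0 (uq i x hxx j hj)
      rwa [iteratedDeriv_zero] at this


lemma conj_inn {g : Equiv.Perm ℝ} {c w : ℝ} (hf : ∀ x, w ≤ |x - c| → g x = x) {x : ℝ} (hx : |x - c| < w) : |g x - c| < w := by
  by_contra h
  push Not at h
  have := g.injective (hf _ h)
  rw [this] at h; linarith

lemma M_ex {xs : ℝ} (hx : xs ∈ Ioo (1/200:ℝ) (51/10000)) {m : Fin 3 → Equiv.Perm ℝ} (hm : ∀ l, DF (m l) ∧ Sup 33 (m l))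
    {t : Fin 3 → ℝ} (ht : ∀ l, 0 ≤ t l ∧ t l ≤ 1/400) (hs : ∀ l k, l ≠ k → 1/2500 ≤ |t l - t k|) :
    ∃ M, DF M ∧ Sup (1/100) M ∧ (∀ l x, |x - xs| < 1/5000 → M (x + t l) = (Aff xs * m l * (Aff xs)⁻¹) x + t l) ∧
      ∀ l x, x ∉ Icc (1/1000:ℝ) (1/100) → M (x + t l) = x + t l := by
  have AD : DF (Aff xs) := (tau_DF xs).mul sc_DF
  let c : Fin 3 → Equiv.Perm ℝ := fun l => (tau (t l)).1 * (Aff xs * m l * (Aff xs)⁻¹) * (tau (t l)).1⁻¹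
  have cap : ∀ l x, c l x = (Aff xs * m l * (Aff xs)⁻¹) (x - t l) + t l := fun l x => rfl
  have cD : ∀ l, DF (c l) := fun l => ((tau_DF _).mul ((AD.mul (hm l).1).mul AD.inv)).mul (tau_DF _).inv
  have fz : ∀ l x, 1/5000 ≤ |x - (t l + xs)| → c l x = x := fun l x h => by
    rw [cap, Aff_fx (hm l).2 (by rwa [sub_sub])]; ring
  have sep : ∀ l k x, l ≠ k → |x - (t l + xs)| < 1/5000 → 1/5000 ≤ |x - (t k + xs)| := fun l k x hl h => by
    have h1 := hs l k hl
    have := abs_lt.1 h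
    rw [le_abs] at h1 ⊢
    rcases h1 with h1 | h1
    · left; linarith
    · right; linarith
  have key : ∀ l x, |x - (t l + xs)| < 1/5000 → (c 0 * c 1 * c 2) x = c l x := fun l x h => by
    have hi := conj_inn (fz l) h
    rw [Equiv.Perm.mul_apply, Equiv.Perm.mul_apply]
    fin_cases l
    · simp only [Fin.zero_eta, Fin.mk_one, Fin.reduceFinMk] at *
      rw [fz 2 x (sep 0 2 _ (by decide) h), fz 1 x (sep 0 1 _ (by decide) h)]
    · simp only [Fin.zero_eta, Fin.mk_one, Fin.reduceFinMk] at *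
      rw [fz 2 x (sep 1 2 _ (by decide) h), fz 0 _ (sep 1 0 _ (by decide) hi)]
    · simp only [Fin.zero_eta, Fin.mk_one, Fin.reduceFinMk] at *
      rw [fz 1 _ (sep 2 1 _ (by decide) hi), fz 0 _ (sep 2 0 _ (by decide) hi)]
  have fix : ∀ x, (∀ l, 1/5000 ≤ |x - (t l + xs)|) → (c 0 * c 1 * c 2) x = x := fun x h => by
    rw [Equiv.Perm.mul_apply, Equiv.Perm.mul_apply, fz 2 x (h 2), fz 1 x (h 1), fz 0 x (h 0)]
  refine ⟨c 0 * c 1 * c 2, ((cD 0).mul (cD 1)).mul (cD 2), fun x h => fix x fun l => ?_, fun l x h => ?_, fun l x h => fix _ fun k => ?_⟩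
  · have := ht l
    rw [le_abs] at h ⊢
    rcases h with h | h
    · left; linarith [hx.2]
    · right; linarith [hx.1]
  · rw [key l _ (by rwa [add_comm (t l), add_sub_add_right_eq_sub]), cap, add_sub_cancel_right]
  · have h1 := ht l
    have h2 := ht k
    rw [le_abs]
    by_cases h3 : x < 1/1000
    · right; linarith [hx.1]
    · left
      have : 1/100 < x := by
        by_contra h4
        push Not at h3 h4
        exact h ⟨h3, h4⟩
      linarith [hx.2]

lemma Dyn.plin {f lam} (D : Dyn f lam) (k : ℕ) {x : ℝ} (hx : |x| ≤ 1/100) : (f.1 ^ k) x = lam^k * x := by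
  induction k with
  | zero => simp
  | succ k ih =>
    rw [pow_succ', Equiv.Perm.mul_apply, ih, D.lin, pow_succ]
    · ring
    · rw [abs_mul, abs_of_pos (pow_pos D.l0 k)]
      have := pow_le_one₀ (n := k) D.l0.le D.l1.le
      have := abs_nonneg x
      nlinarith



lemma circ {f lam} (D : Dyn f lam) {M0 : ℕ} {xs : ℝ} (hx : xs ∈ Ioo (1/200:ℝ) (51/10000)) {a : ℕ → Equiv.Perm ℝ} {m : Fin 3 → Equiv.Perm ℝ}
    (ha : ∀ i, DF (a i) ∧ Sup 33 (a i)) (hm : ∀ l, DF (m l) ∧ Sup 33 (m l)) {t : Fin 3 → ℝ} (ht : ∀ l, 0 ≤ t l ∧ t l ≤ 1/400)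
    {V M : HI} (vs : Sup (1/100) V.1) (ms : Sup (1/100) M.1)
    (hV : ∀ i x, x ∈ Icc (1/1000:ℝ) (1/100) → V.1 ((lam^M0)^i * x) = (lam^M0)^i * (Aff xs * a i * (Aff xs)⁻¹) x)
    (hM : ∀ l x, |x - xs| < 1/5000 → M.1 (x + t l) = (Aff xs * m l * (Aff xs)⁻¹) x + t l)
    (hM2 : ∀ l x, x ∉ Icc (1/1000:ℝ) (1/100) → M.1 (x + t l) = x + t l)
    {I : Fin 4 → ℕ} {q : Equiv.Perm ℝ} (hq : q = Wd (fun k => a (I k)) m) (qs : Sup 33 q) {P : HI} (hP : P.1 = sc * q * sc⁻¹) :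
    Pr P = (tau xs)⁻¹ * Wd (fun k => (f^(M0 * I k))⁻¹ * Pr V * f^(M0 * I k)) (fun l => (tau (t l))⁻¹ * Pr M * tau (t l)) * tau xs := by
  have Linv : ∀ (n : ℕ) (x y : ℝ), (f.1^n) x = y → (f.1^n)⁻¹ y = x := fun n x y h => by
    rw [← h]; exact Equiv.symm_apply_apply _ _
  have Lm : ∀ n : ℕ, StrictMono (((f.1^n)⁻¹ : Equiv.Perm ℝ) : ℝ → ℝ) := fun n => (D.df.pow n).inv.mono
  have Lr : ∀ n : ℕ, (f.1^n)⁻¹ (1/2) = 1/2 := fun n => Linv n _ _ (D.pr n)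
  have Ll : ∀ n : ℕ, (f.1^n)⁻¹ (-1/2) = -1/2 := fun n => Linv n _ _ (D.pl n)
  have uH : ∀ n : ℕ, (f.1^n)⁻¹ * V.1 * ((f.1^n)⁻¹)⁻¹ ∈ HI := fun n x hx => by
    have : ((f.1^n)⁻¹)⁻¹ x ∉ Ioo (-1/2:ℝ) (1/2) := fun h => by
      have e : (f.1^n)⁻¹ (((f.1^n)⁻¹)⁻¹ x) = x := Equiv.apply_symm_apply _ _
      have b1 := Lm n h.1
      have b2 := Lm n h.2
      rw [e, Ll] at b1
      rw [e, Lr] at b2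
      exact hx ⟨b1, b2⟩
    rw [Equiv.Perm.mul_apply, Equiv.Perm.mul_apply, V.2 _ this]
    exact Equiv.apply_symm_apply _ _
  have bap : ∀ l x, ((tau (t l)).1⁻¹ * M.1 * ((tau (t l)).1⁻¹)⁻¹) x = M.1 (x + t l) - t l := fun l x => rfl
  have bK : ∀ l x, x ∉ Icc (1/1000:ℝ) (1/100) → ((tau (t l)).1⁻¹ * M.1 * ((tau (t l)).1⁻¹)⁻¹) x = x := fun l x h => by
    rw [bap, hM2 l x h]; ring
  have bH : ∀ l, (tau (t l)).1⁻¹ * M.1 * ((tau (t l)).1⁻¹)⁻¹ ∈ HI := fun l x hx => bK l x fun h =>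
    hx ⟨by linarith [h.1], by linarith [h.2]⟩
  let uu : Fin 4 → HI := fun k => ⟨_, uH (M0 * I k)⟩
  let bb : Fin 3 → HI := fun l => ⟨_, bH l⟩
  have pu : ∀ k, Pr (uu k) = (f^(M0 * I k))⁻¹ * Pr V * f^(M0 * I k) := fun k => by
    have := Pr_conj (f := V) (f' := uu k) (g := (f^(M0 * I k))⁻¹) (a := -1/2) (b := 1/2) V.2 (Lm _) (Ll _).symm.le (Lr _).le le_rfl le_rfl rfl
    rwa [inv_inv] at this
  have pb : ∀ l, Pr (bb l) = (tau (t l))⁻¹ * Pr M * tau (t l) := fun l => by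
    have := Pr_conj (f := M) (f' := bb l) (g := (tau (t l))⁻¹) ms.fx (tau_DF _).inv.mono
      (show -1/2 ≤ -(1/100) - t l by linarith [(ht l).2]) (show 1/100 - t l ≤ 1/2 by linarith [(ht l).1]) (by norm_num) (by norm_num) rfl
    rwa [inv_inv] at this
  have e1 : (Wd uu bb).1 = Aff xs * q * (Aff xs)⁻¹ := by
    have s1 : (Wd uu bb).1 = _ := map_Wd HI.subtype uu bb
    have s2 := map_Wd (MulAut.conj (Aff xs)).toMonoidHom (fun k => a (I k)) m
    rw [← hq] at s2
    rw [s1]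
    refine Eq.trans ?_ s2.symm
    have Jf : ∀ y : Equiv.Perm ℝ, Sup 33 y → Aff xs * y * (Aff xs)⁻¹ ∈ fixS (Ioo (xs - 1/5000) (xs + 1/5000))ᶜ := fun y hy x hx =>
      Aff_fx hy (by
        by_contra hc
        push Not at hc
        have := abs_lt.1 hc
        exact hx ⟨by linarith, by linarith⟩)
    refine emb (J := Ioo (xs - 1/5000) (xs + 1/5000)) (K := Icc (1/1000) (1/100)) ?_ (fun k => Jf _ (ha _).2) (fun k => Jf _ (hm _).2) ?_ ?_ ?_
    · intro x h
      exact ⟨by linarith [h.1, hx.1], by linarith [h.2, hx.2]⟩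
    · intro k x h
      have hy : (Aff xs * a (I k) * (Aff xs)⁻¹) x ∈ Icc (1/1000:ℝ) (1/100) := by
        rcases lt_or_ge |x - xs| (1/5000) with h1 | h1
        · have := abs_lt.1 (conj_inn (g := Aff xs * a (I k) * (Aff xs)⁻¹) (fun x hx => Aff_fx (ha _).2 hx) h1)
          exact ⟨by linarith [hx.1], by linarith [hx.2]⟩
        · rw [Aff_fx (ha _).2 h1]; exact h
      show (f.1^(M0 * I k))⁻¹ (V.1 ((f.1^(M0 * I k)) x)) = _
      have ab : ∀ z : ℝ, z ∈ Icc (1/1000:ℝ) (1/100) → |z| ≤ 1/100 := fun z hz => abs_le.2 ⟨by linarith [hz.1], hz.2⟩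
      rw [D.plin _ (ab _ h), pow_mul lam, hV _ _ h]
      apply Linv
      show (f.1^(M0 * I k)) ((Aff xs * a (I k) * (Aff xs)⁻¹) x) = _
      rw [D.plin _ (ab _ hy), pow_mul lam]
    · intro l x h
      show M.1 (x + t l) - t l = _
      rw [hM l x (abs_lt.2 ⟨by linarith [h.1], by linarith [h.2]⟩)]
      exact add_sub_cancel_right _ _
    · intro l x h
      exact bK l x h
  have e2 := Pr_conj (f := Wd uu bb) (f' := P) (g := (tau xs)⁻¹) (a := xs - 1/5000) (b := xs + 1/5000)
    (fun x h => by
      rw [e1]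
      refine Aff_fx qs ?_
      by_contra hc
      push Not at hc
      have := abs_lt.1 hc
      exact h ⟨by linarith, by linarith⟩) (tau_DF _).inv.mono
    (show -1/2 ≤ xs - 1/5000 - xs by linarith) (show xs + 1/5000 - xs ≤ 1/2 by linarith) (by linarith [hx.1]) (by linarith [hx.2])
    (by
      rw [e1, hP]
      show sc * q * sc⁻¹ = (tau xs).1⁻¹ * ((tau xs).1 * sc * q * ((tau xs).1 * sc)⁻¹) * ((tau xs).1⁻¹)⁻¹
      group)
  rw [e2, map_Wd, inv_inv]
  simp only [pu, pb]


def Len (S : Set (Equiv.Perm S1)) (k : ℕ) (g : Equiv.Perm S1) : Prop :=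
  ∃ l : List (Equiv.Perm S1), l.length ≤ k ∧ (∀ x ∈ l, x ∈ S ∨ x⁻¹ ∈ S) ∧ l.prod = g

lemma Len.mul {S : Set (Equiv.Perm S1)} {k k' : ℕ} {g g' : Equiv.Perm S1} (h : Len S k g) (h' : Len S k' g') : Len S (k + k') (g * g') := by
  obtain ⟨l, a, b, c⟩ := h
  obtain ⟨l', a', b', c'⟩ := h'
  refine ⟨l ++ l', by rw [List.length_append]; omega, fun x hx => ?_, by rw [List.prod_append, c, c']⟩
  rcases List.mem_append.1 hx with h | h
  · exact b x h
  · exact b' x h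

lemma Len.inv {S : Set (Equiv.Perm S1)} {k : ℕ} {g : Equiv.Perm S1} (h : Len S k g) : Len S k g⁻¹ := by
  obtain ⟨l, a, b, c⟩ := h
  refine ⟨(l.map fun x => x⁻¹).reverse, by simpa using a, fun x hx => ?_, by rw [← List.prod_inv_reverse, c]⟩
  simp only [List.mem_reverse, List.mem_map] at hx
  obtain ⟨y, hy, rfl⟩ := hx
  rw [inv_inv]
  exact (b y hy).symm

lemma Len.fin {S : Set (Equiv.Perm S1)} {k : ℕ} {g : Equiv.Perm S1} (h : Len S k g) : g ∈ Subgroup.closure S ∧ wordLength S g ≤ k := by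
  obtain ⟨l, a, b, c⟩ := h
  constructor
  · rw [← c]
    refine Subgroup.list_prod_mem _ fun x hx => ?_
    rcases b x hx with h | h
    · exact Subgroup.subset_closure h
    · exact (Subgroup.inv_mem_iff _).1 (Subgroup.subset_closure h)
  · exact le_trans (Nat.sInf_le ⟨l, rfl, b, c⟩) a

def UL (F₁ F₂ F₃ : Equiv.Perm S1) : Subgroup (Equiv.Perm S1 × Equiv.Perm S1 → Equiv.Perm S1) where
  carrier := {w | ∃ k, ∀ p : Equiv.Perm S1 × Equiv.Perm S1, Len {F₁, F₂, F₃, p.1, p.2} k (w p)}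
  mul_mem' := fun ⟨k, h⟩ ⟨k', h'⟩ => ⟨k + k', fun p => (h p).mul (h' p)⟩
  one_mem' := ⟨0, fun p => ⟨[], le_rfl, by simp, rfl⟩⟩
  inv_mem' := fun ⟨k, h⟩ => ⟨k, fun p => (h p).inv⟩

lemma UL_gen (F₁ F₂ F₃ : Equiv.Perm S1) {w : Equiv.Perm S1 × Equiv.Perm S1 → Equiv.Perm S1}
    (h : ∀ p, w p ∈ ({F₁, F₂, F₃, p.1, p.2} : Set (Equiv.Perm S1))) : w ∈ UL F₁ F₂ F₃ :=
  ⟨1, fun p => ⟨[w p], le_rfl, fun x hx => by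
    rw [List.mem_singleton] at hx
    rw [hx]; exact Or.inl (h p), by simp⟩⟩

lemma Wd_mem {G : Type*} [Group G] (H : Subgroup G) {a : Fin 4 → G} {b : Fin 3 → G} (ha : ∀ k, a k ∈ H) (hb : ∀ k, b k ∈ H) : Wd a b ∈ H := by
  unfold Wd WW
  repeat' first | exact ha _ | exact hb _ | apply mul_mem | apply inv_mem

lemma one_lift {G : ℝ → ℝ} (h : IsLift 1 G) : ∃ N : ℤ, ∀ x, G x = x + N := by
  have hi : ∀ x, ∃ n : ℤ, G x = x + n := fun x => (coe_S1_iff (x := G x) (y := x)).1 (h.2.2.2 x).symm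
  choose n hn using hi
  have hc : Continuous fun x => G x - x := h.1.continuous.sub continuous_id
  have hn' : ∀ x, G x - x = n x := fun x => by rw [hn x]; ring
  have hcn : Continuous n := by
    refine Int.isClosedEmbedding_coe_real.isInducing.continuous_iff.2 ?_
    have : (fun x => G x - x) = (fun z : ℤ => (z:ℝ)) ∘ n := funext hn'
    exact this ▸ hc
  refine ⟨n 0, fun x => ?_⟩
  rw [hn x, PreconnectedSpace.constant inferInstance hcn (x := x) (y := 0)]

lemma distC_unpack {n : ℕ} {ε : ℝ} {h : Equiv.Perm S1} (hh : HasLift h) (hd : distC n h 1 < ε) :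
    ∃ f : EQ, DF f.1 ∧ h = prj f ∧ Cl n ε f.1 := by
  obtain ⟨F0, hF0⟩ := hh
  obtain ⟨d, ⟨F, G, hF, hG, rfl⟩, hlt⟩ := exists_lt_of_csInf_lt
    (by
      refine ⟨_, F0, fun x => x, hF0, ⟨contDiff_id, fun x => rfl, fun x => ?_, fun x => rfl⟩, rfl⟩
      rw [deriv_id'']; exact one_pos) hd
  obtain ⟨N, hN⟩ := one_lift hG
  have hGe : G = fun x => x + (N:ℝ) := funext hN
  have hL : IsLift h (fun x => F x - N) := by
    refine ⟨hF.1.sub contDiff_const, fun x => by simp only [hF.2.1]; ring, fun x => ?_, fun x => ?_⟩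
    · rw [deriv_sub_const]; exact hF.2.2.1 x
    · rw [hF.2.2.2 x]
      exact coe_S1_iff.2 ⟨N, by ring⟩
  obtain ⟨f, df, fe, rfl⟩ := lift_perm hL
  refine ⟨f, df, rfl, fun j hj x => ?_⟩
  have hbs := EQ_BS f.2 df
  have hdd : dsp f.1 = F - G := by
    funext y
    show f.1 y - y = F y - G y
    rw [fe, hN]; ring
  have hit : ∀ (j : ℕ) y, iteratedDeriv j F y - iteratedDeriv j G y = iteratedDeriv j (dsp f.1) y := fun j y => by
    rw [hdd, iteratedDeriv_sub]
    · exact (hF.1.of_le (by exact_mod_cast le_top)).contDiffAt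
    · exact (hG.1.of_le (by exact_mod_cast le_top)).contDiffAt
  have hl : liftDist n F G = ⨆ j : Fin (n+1), NN j (dsp f.1) := by
    unfold liftDist NN
    simp only [hit]
  have := hbs.le j x
  have h2 : NN j (dsp f.1) ≤ ⨆ j : Fin (n+1), NN j (dsp f.1) :=
    le_ciSup (f := fun j : Fin (n+1) => NN j (dsp f.1)) (Set.finite_range _).bddAbove ⟨j, by omega⟩
  linarith


lemma eps_cmp {Λ : ℝ} (h0 : 0 < Λ) (h1 : Λ < 1/10) {i n : ℕ} (hi : i / 8 = n) :
    (1/2:ℝ)^(8*n+8) * (Λ^(8*n+8) * bet)^n ≤ (1/2)^i * (Λ^i * bet)^(n - 9) := by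
  have hle : i ≤ 8*n+8 := by omega
  have hb := bet_pos
  have hb1 : bet ≤ 1 := by unfold bet; norm_num
  have hL : Λ^(8*n+8) ≤ Λ^i := pow_le_pow_of_le_one h0.le (by linarith) hle
  have hi1 : Λ^i ≤ 1 := pow_le_one₀ h0.le (by linarith)
  have hp : 0 < Λ^i := pow_pos h0 i
  have e1 : (1/2:ℝ)^(8*n+8) ≤ (1/2)^i := pow_le_pow_of_le_one (by norm_num) (by norm_num) hle
  have e2 : (Λ^(8*n+8) * bet)^n ≤ (Λ^i * bet)^n := by gcongr
  have e3 : (Λ^i * bet)^n ≤ (Λ^i * bet)^(n-9) := pow_le_pow_of_le_one (by positivity) (by nlinarith) (by omega)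
  have := e2.trans e3
  gcongr

theorem final (F₁ F₂ F₃ : Equiv.Perm S1)
    (h₁ : F1Hyp F₁) (h₃ : F3Hyp F₃) :
    ∃ (ε : ℕ → ℝ) (κ : ℕ → ℕ), (∀ n, 0 < ε n) ∧ (∀ n, 0 < κ n) ∧
      ∀ h : ℕ → Equiv.Perm S1, (∀ n, HasLift (h n)) →
        (∀ n, distC n (h n) 1 < ε n) →
        ∃ F₄ F₅ : Equiv.Perm S1, HasLift F₄ ∧ HasLift F₅ ∧
          ∀ n, h n ∈ Subgroup.closure ({F₁, F₂, F₃, F₄, F₅} : Set (Equiv.Perm S1)) ∧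
            wordLength ({F₁, F₂, F₃, F₄, F₅} : Set (Equiv.Perm S1)) (h n) ≤ κ n := by
  obtain ⟨f, lam, D, rfl⟩ := dyn_ex h₁
  obtain ⟨α, hα, rfl⟩ := h₃
  obtain ⟨jr, nr', hr⟩ := dens hα (show (1/2 - 1/12:ℝ) < 1/2 + 1/12 by norm_num)
  obtain ⟨jx, nx, hx⟩ := dens hα (show (1/200:ℝ) < 51/10000 by norm_num)
  obtain ⟨j1, n1, ht1⟩ := dens hα (show (1/900:ℝ) < 1/800 by norm_num)
  obtain ⟨j2, n2, ht2⟩ := dens hα (show (1/500:ℝ) < 1/400 by norm_num)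
  obtain ⟨M0, hM0⟩ := exists_pow_lt_of_lt_one (show (0:ℝ) < 1/10 by norm_num) D.l1
  have hL0 : 0 < lam^M0 := pow_pos D.l0 _
  obtain ⟨mf, q, hq, hqe⟩ := frag_thm D (r := jr*α+nr') (abs_le.2 ⟨by linarith [hr.1], by linarith [hr.2]⟩)
  obtain ⟨m, hm, hl1, hl2⟩ := local_thm
  let jt : Fin 3 → ℤ := ![0, j1, j2]
  let nt : Fin 3 → ℤ := ![0, n1, n2]
  let t : Fin 3 → ℝ := fun l => jt l * α + nt l
  have t0 : t 0 = 0 := by simp [t, jt, nt]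
  have t1 : t 1 = j1*α+n1 := rfl
  have t2 : t 2 = j2*α+n2 := rfl
  have ht : ∀ l, 0 ≤ t l ∧ t l ≤ 1/400 := fun l => by
    fin_cases l
    · show 0 ≤ t 0 ∧ t 0 ≤ 1/400
      rw [t0]; norm_num
    · show 0 ≤ t 1 ∧ t 1 ≤ 1/400
      rw [t1]; exact ⟨by linarith [ht1.1], by linarith [ht1.2]⟩
    · show 0 ≤ t 2 ∧ t 2 ≤ 1/400
      rw [t2]; exact ⟨by linarith [ht2.1], by linarith [ht2.2]⟩
  have d01 : 1/2500 ≤ t 1 - t 0 := by rw [t0, t1]; linarith [ht1.1]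
  have d02 : 1/2500 ≤ t 2 - t 0 := by rw [t0, t2]; linarith [ht2.1]
  have d12 : 1/2500 ≤ t 2 - t 1 := by rw [t1, t2]; linarith [ht2.1, ht1.2]
  have hs : ∀ l k, l ≠ k → 1/2500 ≤ |t l - t k| := by
    have A : ∀ l k, 1/2500 ≤ t l - t k → 1/2500 ≤ |t l - t k| ∧ 1/2500 ≤ |t k - t l| := fun l k h =>
      ⟨h.trans (le_abs_self _), by rw [abs_sub_comm]; exact h.trans (le_abs_self _)⟩
    intro l k hlk
    fin_cases l <;> fin_cases k
    · exact absurd rfl hlk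
    · exact (A 1 0 d01).2
    · exact (A 2 0 d02).2
    · exact (A 1 0 d01).1
    · exact absurd rfl hlk
    · exact (A 2 1 d12).2
    · exact (A 2 0 d02).1
    · exact (A 2 1 d12).1
    · exact absurd rfl hlk
  have E : ∀ n, ∃ δ > 0, ∀ h : EQ, Adm h → Cl n δ h.1 → 9 ≤ n → ∀ c, ∃ a : Fin 4 → Equiv.Perm ℝ,
      (∀ k, DF (a k) ∧ Sup 33 (a k) ∧ Cl (n-9) ((1/2:ℝ)^(8*n+8) * ((lam^M0)^(8*n+8) * bet)^n) (a k)) ∧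
      ∀ K, 1 ≤ K → q c h = Wd a (m K) := by
    intro n
    have hb := bet_pos
    obtain ⟨δ1, hδ1, H1⟩ := hl2 (n-9) ((1/2:ℝ)^(8*n+8) * ((lam^M0)^(8*n+8) * bet)^n) (by positivity)
    obtain ⟨δ, hδ, H2⟩ := hqe (n-9+7) δ1 hδ1
    refine ⟨δ, hδ, fun h ha hc hn c => ?_⟩
    exact H1 _ ((hq h ha).1 c).1 ((hq h ha).1 c).2 (H2 h ha (by rwa [show n-9+7+2 = n by omega]) c)
  choose δ hδ hE using E
  let cF : Equiv.Perm S1 × Equiv.Perm S1 → Equiv.Perm S1 := fun _ => prj f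
  let cR : Equiv.Perm S1 × Equiv.Perm S1 → Equiv.Perm S1 := fun _ => rot (α : S1)
  let WP : ℕ → ℕ → (Equiv.Perm S1 × Equiv.Perm S1 → Equiv.Perm S1) := fun n c =>
    (cR^jx)⁻¹ * Wd (fun k : Fin 4 => (cF^(M0 * (8*n+4*c+k)))⁻¹ * Prod.fst * cF^(M0 * (8*n+4*c+k)))
      (fun l => (cR^(jt l))⁻¹ * Prod.snd * cR^(jt l)) * cR^jx
  let W : ℕ → (Equiv.Perm S1 × Equiv.Perm S1 → Equiv.Perm S1) := fun n =>
    ((cF^mf)⁻¹ * WP n 0 * cF^mf) * (cR^jr * ((cF^mf)⁻¹ * WP n 1 * cF^mf) * (cR^jr)⁻¹)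
  have hcF : cF ∈ UL (prj f) F₂ (rot (α : S1)) := UL_gen _ _ _ fun p => by simp [cF]
  have hcR : cR ∈ UL (prj f) F₂ (rot (α : S1)) := UL_gen _ _ _ fun p => by simp [cR]
  have hp1 : Prod.fst ∈ UL (prj f) F₂ (rot (α : S1)) := UL_gen _ _ _ fun p => by simp
  have hp2 : Prod.snd ∈ UL (prj f) F₂ (rot (α : S1)) := UL_gen _ _ _ fun p => by simp
  have hWP : ∀ n c, WP n c ∈ UL (prj f) F₂ (rot (α : S1)) := fun n c =>
    mul_mem (mul_mem (inv_mem (zpow_mem hcR _)) (Wd_mem _ (fun k => mul_mem (mul_mem (inv_mem (pow_mem hcF _)) hp1) (pow_mem hcF _))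
      fun l => mul_mem (mul_mem (inv_mem (zpow_mem hcR _)) hp2) (zpow_mem hcR _))) (zpow_mem hcR _)
  have hW : ∀ n, ∃ k, ∀ p : Equiv.Perm S1 × Equiv.Perm S1, Len {prj f, F₂, rot (α : S1), p.1, p.2} k (W n p) := fun n =>
    show W n ∈ UL (prj f) F₂ (rot (α : S1)) from
    mul_mem (mul_mem (mul_mem (inv_mem (pow_mem hcF _)) (hWP _ _)) (pow_mem hcF _))
      (mul_mem (mul_mem (zpow_mem hcR _) (mul_mem (mul_mem (inv_mem (pow_mem hcF _)) (hWP _ _)) (pow_mem hcF _))) (inv_mem (zpow_mem hcR _)))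
  choose κ hκ using hW
  refine ⟨fun n => min e0c (δ n), fun n => κ n + 1, fun n => lt_min e0c_pos (hδ n), fun n => Nat.succ_pos _, fun h hh hd => ?_⟩
  have hu := fun n => distC_unpack (hh n) (hd n)
  choose g gd ge gc using hu
  have hA : ∀ n, Adm (g n) := fun n => ⟨gd n, fun x => by
    have := gc n 0 (Nat.zero_le _) x
    rw [iteratedDeriv_zero] at this
    exact this.trans (min_le_left _ _)⟩
  have hK : ∃ K, 1 ≤ K ∧ ∀ n c, n < 9 → ∃ a : Fin 4 → Equiv.Perm ℝ, (∀ k, DF (a k) ∧ Sup 33 (a k)) ∧ q c (g n) = Wd a (m K) := by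
    have := fun n c => hl1 (q c (g n)) ((hq _ (hA n)).1 c).1 ((hq _ (hA n)).1 c).2
    choose K0 hK0 using this
    refine ⟨1 + ∑ n ∈ Finset.range 9, ∑ c, K0 n c, by omega, fun n c hn => hK0 n c _ ?_⟩
    have e1 : K0 n c ≤ ∑ c, K0 n c := Finset.single_le_sum (f := fun c => K0 n c) (fun _ _ => Nat.zero_le _) (Finset.mem_univ c)
    have e2 := Finset.single_le_sum (f := fun n => ∑ c, K0 n c) (fun _ _ => Nat.zero_le _) (Finset.mem_range.2 hn)
    omega
  obtain ⟨K, hK1, hK2⟩ := hK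
  have hA4 : ∀ n c, ∃ a : Fin 4 → Equiv.Perm ℝ, (∀ k, DF (a k) ∧ Sup 33 (a k)) ∧ q c (g n) = Wd a (m K) ∧
      (9 ≤ n → ∀ k, Cl (n-9) ((1/2:ℝ)^(8*n+8) * ((lam^M0)^(8*n+8) * bet)^n) (a k)) := by
    intro n c
    rcases lt_or_ge n 9 with hn | hn
    · obtain ⟨a, b1, b2⟩ := hK2 n c hn
      exact ⟨a, b1, b2, fun h => by omega⟩
    · obtain ⟨a, b1, b2⟩ := hE n (g n) (hA n) ((gc n).mono le_rfl (min_le_right _ _)) hn c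
      exact ⟨a, fun k => ⟨(b1 k).1, (b1 k).2.1⟩, b2 K hK1, fun _ k => (b1 k).2.2⟩
  choose A A1 A2 A3 using hA4
  let a : ℕ → Equiv.Perm ℝ := fun i => A (i/8) (Fin.ofNat 2 (i/4)) (Fin.ofNat 4 i)
  have ha : ∀ i, DF (a i) ∧ Sup 33 (a i) := fun i => A1 _ _ _
  have haI : ∀ n (c : Fin 2) (k : Fin 4), a (8*n+4*c+k) = A n c k := fun n c k => by
    have e1 : (8*n+4*(c:ℕ)+(k:ℕ))/8 = n := by omega
    have e2 : Fin.ofNat 2 ((8*n+4*(c:ℕ)+(k:ℕ))/4) = c := by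
      apply Fin.ext; simp only [Fin.val_ofNat]; omega
    have e3 : Fin.ofNat 4 (8*n+4*(c:ℕ)+(k:ℕ)) = k := by
      apply Fin.ext; simp only [Fin.val_ofNat]; omega
    show A _ _ _ = _
    rw [e1, e2, e3]
  have hst : Tendsto (fun i : ℕ => i/8 - 9) atTop atTop := by
    refine tendsto_atTop.2 fun b => ?_
    filter_upwards [eventually_ge_atTop (8*(b+9))] with i hi
    omega
  obtain ⟨V, V1, V2, V3⟩ := V_ex hL0 hM0 hx ha hst (by
    filter_upwards [eventually_ge_atTop 72] with i hi
    exact (A3 (i/8) _ (by omega) _).mono le_rfl (eps_cmp hL0 hM0 rfl))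
  obtain ⟨M, M1, M2, M3, M4⟩ := M_ex hx (hm K) ht hs
  let v : HI := ⟨V, V2.HI (by norm_num)⟩
  let u : HI := ⟨M, M2.HI (by norm_num)⟩
  refine ⟨prj (Pr v), prj (Pr u), ⟨_, prj_lift _ (Pr_DF V1 (by norm_num) V2)⟩, ⟨_, prj_lift _ (Pr_DF M1 (by norm_num) M2)⟩, fun n => ?_⟩
  have key : h n = W n (prj (Pr v), prj (Pr u)) := by
    obtain ⟨hdq, P, hP1, hP2⟩ := hq (g n) (hA n)
    have hc : ∀ c : Fin 2, prj (Pr (P c)) = WP n c (prj (Pr v), prj (Pr u)) := fun c => by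
      have := circ D hx ha (hm K) ht (V := v) (M := u) V2 M2 V3 M3 M4 (I := fun k => 8*n+4*c+k) (q := q c (g n))
        (by simp only [haI]; exact A2 n c) ((hdq c).2.mono (by norm_num)) (hP1 c)
      rw [this, map_mul, map_mul, map_inv, map_Wd, tau_rot]
      simp only [map_mul, map_inv, map_pow]
      have tt : ∀ l, prj (tau (t l)) = rot (α : S1)^(jt l) := fun l => tau_rot α _ _
      simp only [tt]
      have ev := map_Wd (Pi.evalMonoidHom (fun _ : Equiv.Perm S1 × Equiv.Perm S1 => Equiv.Perm S1) (prj (Pr v), prj (Pr u)))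
        (fun k : Fin 4 => (cF^(M0 * (8*n+4*(c:ℕ)+k)))⁻¹ * Prod.fst * cF^(M0 * (8*n+4*(c:ℕ)+k)))
        (fun l => (cR^(jt l))⁻¹ * Prod.snd * cR^(jt l))
      show _ = (rot (α : S1)^jx)⁻¹ * (Wd _ _ : Equiv.Perm S1 × Equiv.Perm S1 → Equiv.Perm S1) (prj (Pr v), prj (Pr u)) * rot (α : S1)^jx
      congr 2
    have h0 := hc 0
    have h1 := hc 1
    rw [ge n, hP2]
    simp only [map_mul, map_inv, map_pow]
    rw [h0, h1, tau_rot]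
    rfl
  have := hκ n (prj (Pr v), prj (Pr u))
  rw [← key] at this
  exact ⟨this.fin.1, this.fin.2.trans (Nat.le_succ _)⟩


/-- given `F₁, F₂, F₃` as above, there are sequences `ε_n > 0`, `k_n > 0`
such that any sequence `h_n` with `‖h_n − id‖_{C^n} < ε_n` is contained, with word length
bounds `d_S(h_n, id) ≤ k_n`, in the group generated by `S = {F₁, F₂, F₃, F₄, F₅}` for some
suitable `F₄, F₅ ∈ Diff^∞(ℝ/ℤ)`. -/
theorem lemma_better (F₁ F₂ F₃ : Equiv.Perm S1)
    (h₁ : F1Hyp F₁) (h₂ : F2Hyp F₂) (h₃ : F3Hyp F₃) :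
    ∃ (ε : ℕ → ℝ) (κ : ℕ → ℕ), (∀ n, 0 < ε n) ∧ (∀ n, 0 < κ n) ∧
      ∀ h : ℕ → Equiv.Perm S1, (∀ n, HasLift (h n)) →
        (∀ n, distC n (h n) 1 < ε n) →
        ∃ F₄ F₅ : Equiv.Perm S1, HasLift F₄ ∧ HasLift F₅ ∧
          ∀ n, h n ∈ Subgroup.closure ({F₁, F₂, F₃, F₄, F₅} : Set (Equiv.Perm S1)) ∧
            wordLength ({F₁, F₂, F₃, F₄, F₅} : Set (Equiv.Perm S1)) (h n) ≤ κ n := by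
  exact final F₁ F₂ F₃ h₁ h₃

end
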